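/- Let C ⊆ ℝ⁴ be a sharp open convex cone whose projectivization is a quasi-homogeneous properly convex projective domain in ℝP³, i.e., there is a compact set K ⊆ C with ⋃_{g∈Aut(C)} g(K) = C. Suppose C is indecomposable and not strictly convex (there exist linearly independent u, v in ∂C with the closed segment [u,v] contained in ∂C). Then: (a) Aut(C) is irreducible, i.e., there is no linear subspace V of ℝ⁴ with 0 < dim V < 4 and g(V) = V for all g ∈ Aut(C); and (b) the subgroup {g ∈ Aut(C) | |det g| = 1} is a discrete subgroup of GL(4,ℝ). -/

import Mathlib

open Matrix Set Filter Topology Pointwise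

noncomputable section

/-- The affine action on ℝⁿ of an (n+1)×(n+1) invertible matrix in affine form
(ℝⁿ is identified with the hyperplane x_{n+1} = 1). -/
def affAct (n : ℕ) (g : GL (Fin (n + 1)) ℝ) (x : Fin n → ℝ) : Fin n → ℝ :=
  fun i => (∑ j : Fin n, g.val i.castSucc j.castSucc * x j) + g.val i.castSucc (Fin.last n)

/-- A matrix in GL(n+1,ℝ) has affine form if its last row is (0, …, 0, 1). -/
def IsAffineForm (n : ℕ) (g : GL (Fin (n + 1)) ℝ) : Prop :=
  (∀ j : Fin n, g.val (Fin.last n) j.castSucc = 0) ∧ g.val (Fin.last n) (Fin.last n) = 1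

/-- Aut(Ω): the group (here: set) of affine transformations of ℝⁿ preserving Ω,
realized as affine-form matrices in GL(n+1,ℝ). -/
def AutSet (n : ℕ) (Ω : Set (Fin n → ℝ)) : Set (GL (Fin (n + 1)) ℝ) :=
  {g | IsAffineForm n g ∧ affAct n g '' Ω = Ω}

/-- Aut⁰(Ω): the identity component of Aut(Ω). -/
def AutIdComp (n : ℕ) (Ω : Set (Fin n → ℝ)) : Set (GL (Fin (n + 1)) ℝ) :=
  connectedComponentIn (AutSet n Ω) 1

/-- The limit set Λ_G of a subset G of Aut(Ω). -/
def limitSet (n : ℕ) (Ω : Set (Fin n → ℝ)) (G : Set (GL (Fin (n + 1)) ℝ)) :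
    Set (Fin n → ℝ) :=
  {ξ | ξ ∈ frontier Ω ∧ ∃ x ∈ Ω, ∃ u : ℕ → GL (Fin (n + 1)) ℝ,
    (∀ k, u k ∈ G) ∧ Filter.Tendsto (fun k => affAct n (u k) x) Filter.atTop (nhds ξ)}

/-- Ω is a convex affine domain: a nonempty open convex subset of ℝⁿ. -/
def IsConvexDomain (n : ℕ) (Ω : Set (Fin n → ℝ)) : Prop :=
  Ω.Nonempty ∧ IsOpen Ω ∧ Convex ℝ Ω

/-- Ω contains no complete affine line. -/
def HasNoLine (n : ℕ) (Ω : Set (Fin n → ℝ)) : Prop :=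
  ¬ ∃ x ∈ Ω, ∃ v : Fin n → ℝ, v ≠ 0 ∧ ∀ t : ℝ, x + t • v ∈ Ω

/-- Ω is a properly convex affine domain. -/
def IsProperlyConvexDomain (n : ℕ) (Ω : Set (Fin n → ℝ)) : Prop :=
  IsConvexDomain n Ω ∧ HasNoLine n Ω

/-- Ω is quasi-homogeneous: some compact K ⊆ Ω has ⋃_{g ∈ Aut(Ω)} g(K) = Ω. -/
def IsQuasiHomogeneous (n : ℕ) (Ω : Set (Fin n → ℝ)) : Prop :=
  ∃ K : Set (Fin n → ℝ), IsCompact K ∧ K ⊆ Ω ∧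
    (⋃ g ∈ AutSet n Ω, affAct n g '' K) = Ω

/-- Aut(Ω) is irreducible: it preserves no nonempty proper affine subspace of ℝⁿ. -/
def IsIrreducibleAut (n : ℕ) (Ω : Set (Fin n → ℝ)) : Prop :=
  ¬ ∃ S : AffineSubspace ℝ (Fin n → ℝ), (S : Set (Fin n → ℝ)).Nonempty ∧
      (S : Set (Fin n → ℝ)) ≠ Set.univ ∧
      ∀ g ∈ AutSet n Ω, affAct n g '' (S : Set (Fin n → ℝ)) = (S : Set (Fin n → ℝ))

/-- The asymptotic cone AC(Ω). -/
def asympCone (n : ℕ) (Ω : Set (Fin n → ℝ)) : Set (Fin n → ℝ) :=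
  {u | ∀ x ∈ Ω, ∀ t : ℝ, 0 ≤ t → x + t • u ∈ Ω}

/-- Ω is a cone with some vertex v. -/
def IsCone (n : ℕ) (Ω : Set (Fin n → ℝ)) : Prop :=
  ∃ v : Fin n → ℝ, ∀ x ∈ Ω, ∀ t : ℝ, 0 < t → v + t • (x - v) ∈ Ω

/-- Two subsets of ℝⁿ are affinely equivalent. -/
def AffinelyEquivalent (n : ℕ) (Ω Ω' : Set (Fin n → ℝ)) : Prop :=
  ∃ e : (Fin n → ℝ) ≃ᵃ[ℝ] (Fin n → ℝ), e '' Ω = Ω'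

/-- Γ acts freely on Ω. -/
def ActsFreely (n : ℕ) (Ω : Set (Fin n → ℝ)) (Γ : Set (GL (Fin (n + 1)) ℝ)) : Prop :=
  ∀ γ ∈ Γ, γ ≠ 1 → ∀ x ∈ Ω, affAct n γ x ≠ x

/-- Γ acts properly discontinuously on Ω. -/
def ActsProperlyDiscontinuously (n : ℕ) (Ω : Set (Fin n → ℝ))
    (Γ : Set (GL (Fin (n + 1)) ℝ)) : Prop :=
  ∀ K L : Set (Fin n → ℝ), K ⊆ Ω → L ⊆ Ω → IsCompact K → IsCompact L →
    {γ ∈ Γ | (affAct n γ '' K ∩ L).Nonempty}.Finite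

/-- Γ acts cocompactly on Ω. -/
def ActsCocompactly (n : ℕ) (Ω : Set (Fin n → ℝ)) (Γ : Set (GL (Fin (n + 1)) ℝ)) : Prop :=
  ∃ K : Set (Fin n → ℝ), IsCompact K ∧ K ⊆ Ω ∧ (⋃ γ ∈ Γ, affAct n γ '' K) = Ω

/-- The linear part of an affine-form matrix has determinant one. -/
def LinearPartDetOne (n : ℕ) (g : GL (Fin (n + 1)) ℝ) : Prop :=
  (Matrix.of fun i j : Fin n => g.val i.castSucc j.castSucc).det = 1

/-- The linear action of g ∈ GL(4,ℝ) on ℝ⁴. -/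
def linAct (g : GL (Fin 4) ℝ) (x : Fin 4 → ℝ) : Fin 4 → ℝ :=
  g.val.mulVec x

/-- The linear automorphism group of a cone C ⊆ ℝ⁴. -/
def AutCone (C : Set (Fin 4 → ℝ)) : Set (GL (Fin 4) ℝ) :=
  {g | linAct g '' C = C}

namespace ConeDuality

open scoped InnerProductSpace
open ContinuousLinearMap (adjoint adjoint_inner_left adjoint_inner_right)

variable {E : Type*} [NormedAddCommGroup E] [InnerProductSpace ℝ E]

/-- A pair of mutually dual closed convex cones, both with nonempty interior. -/
structure DualPair (P Q : Set E) : Prop where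
  mem_left : ∀ x, x ∈ P ↔ ∀ f ∈ Q, 0 ≤ ⟪f, x⟫_ℝ
  mem_right : ∀ f, f ∈ Q ↔ ∀ x ∈ P, 0 ≤ ⟪x, f⟫_ℝ
  int_left : (interior P).Nonempty
  int_right : (interior Q).Nonempty

namespace DualPair

variable {P Q : Set E}

theorem symm (h : DualPair P Q) : DualPair Q P :=
  ⟨h.mem_right, h.mem_left, h.int_right, h.int_left⟩

theorem inner_nonneg (h : DualPair P Q) {f x : E} (hf : f ∈ Q) (hx : x ∈ P) : 0 ≤ ⟪f, x⟫_ℝ :=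
  (h.mem_left x).1 hx f hf

theorem isClosed (h : DualPair P Q) : IsClosed P := by
  have : P = ⋂ f ∈ Q, {x | 0 ≤ ⟪f, x⟫_ℝ} := by
    ext x; simp [h.mem_left x]
  rw [this]
  exact isClosed_biInter fun f _ => isClosed_le continuous_const (by fun_prop)

theorem zero_mem (h : DualPair P Q) : (0 : E) ∈ P := (h.mem_left 0).2 (by simp)

theorem add_mem (h : DualPair P Q) {x y : E} (hx : x ∈ P) (hy : y ∈ P) : x + y ∈ P := by
  rw [h.mem_left]
  intro f hf
  rw [inner_add_right]
  exact add_nonneg (h.inner_nonneg hf hx) (h.inner_nonneg hf hy)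

theorem smul_mem (h : DualPair P Q) {x : E} (hx : x ∈ P) {t : ℝ} (ht : 0 ≤ t) : t • x ∈ P := by
  rw [h.mem_left]
  intro f hf
  rw [inner_smul_right]
  exact mul_nonneg ht (h.inner_nonneg hf hx)

theorem convex (h : DualPair P Q) : Convex ℝ P := by
  intro x hx y hy a b ha hb _
  exact h.add_mem (h.smul_mem hx ha) (h.smul_mem hy hb)

theorem smul_mem_interior (h : DualPair P Q) {x : E} (hx : x ∈ interior P) {t : ℝ} (ht : 0 < t) :
    t • x ∈ interior P := by
  have h1 : t • x ∈ t • interior P := Set.smul_mem_smul_set hx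
  rw [← interior_smul₀ ht.ne'] at h1
  refine interior_mono ?_ h1
  rintro _ ⟨y, hy, rfl⟩
  exact h.smul_mem hy ht.le

theorem mem_of_smul_mem (h : DualPair P Q) {x : E} {t : ℝ} (ht : 0 < t) (hx : t • x ∈ P) :
    x ∈ P := by
  have := h.smul_mem hx (inv_pos.2 ht).le
  rwa [smul_smul, inv_mul_cancel₀ ht.ne', one_smul] at this

theorem add_mem_interior (h : DualPair P Q) {x y : E} (hx : x ∈ interior P) (hy : y ∈ P) :
    x + y ∈ interior P := by
  have h1 : x + y ∈ interior P + {y} := Set.add_mem_add hx rfl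
  refine (interior_maximal ?_ (isOpen_interior.add_right)) h1
  rintro _ ⟨a, ha, b, rfl, rfl⟩
  exact h.add_mem (interior_subset ha) hy

theorem exists_sub_smul_mem_interior (_h : DualPair P Q) {x : E} (hx : x ∈ interior P) (y : E) :
    ∃ ε : ℝ, 0 < ε ∧ x - ε • y ∈ interior P := by
  have hc : Continuous fun t : ℝ => x - t • y := by fun_prop
  have h0 : ∀ᶠ t in 𝓝 (0 : ℝ), x - t • y ∈ interior P :=
    hc.continuousAt.eventually_mem (isOpen_interior.mem_nhds (by simpa using hx))
  have h1 := (h0.filter_mono nhdsWithin_le_nhds).and (self_mem_nhdsWithin (s := Ioi (0 : ℝ)))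
  obtain ⟨t, ht, ht'⟩ := h1.exists
  exact ⟨t, ht', ht⟩

theorem exists_sub_smul_mem (h : DualPair P Q) {x : E} (hx : x ∈ interior P) (y : E) :
    ∃ ε : ℝ, 0 < ε ∧ x - ε • y ∈ P :=
  let ⟨ε, hε, hm⟩ := h.exists_sub_smul_mem_interior hx y
  ⟨ε, hε, interior_subset hm⟩

theorem inner_pos (h : DualPair P Q) {f x : E} (hx : x ∈ interior P) (hf : f ∈ Q) (hf0 : f ≠ 0) :
    0 < ⟪f, x⟫_ℝ := by
  obtain ⟨ε, hε, hm⟩ := h.exists_sub_smul_mem hx f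
  have h1 := h.inner_nonneg hf hm
  rw [inner_sub_right, inner_smul_right] at h1
  have h2 : 0 < ⟪f, f⟫_ℝ := real_inner_self_pos.2 hf0
  nlinarith [mul_pos hε h2]

theorem eq_zero_of_inner_eq_zero (h : DualPair P Q) {f x : E} (hx : x ∈ interior P) (hf : f ∈ Q)
    (h0 : ⟪f, x⟫_ℝ = 0) : f = 0 := by
  by_contra hf0
  exact (h.inner_pos hx hf hf0).ne' h0

theorem coercive (h : DualPair P Q) {f : E} (hf : f ∈ interior Q) :
    ∃ δ : ℝ, 0 < δ ∧ ∀ x ∈ P, δ * ‖x‖ ≤ ⟪f, x⟫_ℝ := by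
  obtain ⟨ε, hε, hb⟩ := Metric.mem_nhds_iff.1 (mem_interior_iff_mem_nhds.1 hf)
  refine ⟨ε / 2, by positivity, fun x hx => ?_⟩
  rcases eq_or_ne x 0 with rfl | hx0
  · simp
  have hn : 0 < ‖x‖ := norm_pos_iff.2 hx0
  have hm : f - (ε / 2 / ‖x‖) • x ∈ Q := by
    apply hb
    rw [Metric.mem_ball, dist_eq_norm, sub_sub_cancel_left, norm_neg, norm_smul, Real.norm_eq_abs,
      abs_of_pos (by positivity), div_mul_cancel₀ _ hn.ne']
    linarith
  have h1 := h.inner_nonneg hm hx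
  rw [inner_sub_left, inner_smul_left, real_inner_self_eq_norm_sq] at h1
  have : (ε / 2 / ‖x‖) * ‖x‖ ^ 2 = ε / 2 * ‖x‖ := by field_simp
  simp only [conj_trivial] at h1
  linarith

theorem sharp (h : DualPair P Q) {x : E} (hx : x ∈ P) (hx' : -x ∈ P) : x = 0 := by
  obtain ⟨f, hf⟩ := h.int_right
  by_contra h0
  have h1 := h.symm.inner_pos hf hx h0
  have h2 := h.inner_nonneg (interior_subset hf) hx'
  rw [inner_neg_right, real_inner_comm] at h2
  linarith

theorem normal (h : DualPair P Q) :
    ∃ c : ℝ, 0 < c ∧ ∀ x ∈ P, ∀ y ∈ P, ‖x‖ ≤ c * ‖x + y‖ := by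
  obtain ⟨f, hf⟩ := h.int_right
  obtain ⟨δ, hδ, hb⟩ := h.coercive hf
  refine ⟨(‖f‖ + 1) / δ, by positivity, fun x hx y hy => ?_⟩
  have h1 := hb x hx
  have h2 := h.inner_nonneg (interior_subset hf) hy
  have h3 := real_inner_le_norm f (x + y)
  rw [inner_add_right] at h3
  rw [div_mul_eq_mul_div, le_div_iff₀ hδ]
  nlinarith [norm_nonneg (x + y)]

theorem isCompact_slice (h : DualPair P Q) [FiniteDimensional ℝ E] {f : E} (hf : f ∈ interior Q)
    (a : ℝ) : IsCompact {x | x ∈ P ∧ ⟪f, x⟫_ℝ = a} := by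
  obtain ⟨δ, hδ, hb⟩ := h.coercive hf
  refine Metric.isCompact_of_isClosed_isBounded ?_ ?_
  · exact h.isClosed.inter (isClosed_eq (by fun_prop) continuous_const)
  · refine isBounded_iff_forall_norm_le.2 ⟨a / δ, fun x hx => ?_⟩
    rw [le_div_iff₀ hδ, mul_comm, ← hx.2]
    exact hb x hx.1

theorem mem_interior_of_inner_pos (h : DualPair P Q) [FiniteDimensional ℝ E] {x : E}
    (hx : ∀ f ∈ Q, f ≠ 0 → 0 < ⟪f, x⟫_ℝ) : x ∈ interior P := by
  obtain ⟨e, he⟩ := h.int_left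
  have hQ := h.symm.isCompact_slice he 1
  set S := {f | f ∈ Q ∧ ⟪e, f⟫_ℝ = 1} with hS
  have hpos : ∀ f ∈ S, 0 < ⟪f, x⟫_ℝ := fun f hf => hx f hf.1 (by
    rintro rfl; simpa using hf.2)
  obtain ⟨m, hm0, hm⟩ : ∃ m : ℝ, 0 < m ∧ ∀ f ∈ S, m ≤ ⟪f, x⟫_ℝ := by
    rcases S.eq_empty_or_nonempty with hemp | hne
    · exact ⟨1, one_pos, by simp [hemp]⟩
    · obtain ⟨f0, hf0, hmin⟩ := hQ.exists_isMinOn hne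
        (f := fun f => ⟪f, x⟫_ℝ) (by fun_prop)
      exact ⟨_, hpos f0 hf0, fun f hf => hmin hf⟩
  have hmem : x - m • e ∈ P := by
    rw [h.mem_left]
    intro f hf
    rcases eq_or_ne f 0 with rfl | hf0
    · simp
    have hp := h.inner_pos he hf hf0
    have hfs : (⟪f, e⟫_ℝ)⁻¹ • f ∈ S := by
      refine ⟨h.symm.smul_mem hf (inv_pos.2 hp).le, ?_⟩
      rw [inner_smul_right, real_inner_comm f e, inv_mul_cancel₀ hp.ne']
    have h1 := hm _ hfs
    rw [inner_smul_left, conj_trivial, inv_mul_eq_div, le_div_iff₀ hp] at h1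
    rw [inner_sub_right, inner_smul_right]
    linarith
  have := h.add_mem_interior (h.smul_mem_interior he hm0) hmem
  simpa using this

theorem exists_support (h : DualPair P Q) [FiniteDimensional ℝ E] {x : E} (hx : x ∈ P)
    (hx' : x ∉ interior P) : ∃ f ∈ Q, f ≠ 0 ∧ ⟪f, x⟫_ℝ = 0 := by
  by_contra! hcon
  exact hx' (h.mem_interior_of_inner_pos fun f hf hf0 =>
    lt_of_le_of_ne (h.inner_nonneg hf hx) (hcon f hf hf0).symm)

theorem linearMap_eq_zero (h : DualPair P Q) {F : Type*} [AddCommGroup F] [Module ℝ F]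
    (A : E →ₗ[ℝ] F) (hA : ∀ x ∈ interior P, A x = 0) : A = 0 := by
  obtain ⟨e, he⟩ := h.int_left
  ext y
  obtain ⟨ε, hε, hm⟩ := h.exists_sub_smul_mem_interior he y
  have h1 := hA _ hm
  rw [map_sub, hA _ he, zero_sub, neg_eq_zero, map_smul] at h1
  simpa using (smul_eq_zero.1 h1).resolve_left hε.ne'

theorem span_eq_top (h : DualPair P Q) : Submodule.span ℝ (interior P) = ⊤ := by
  obtain ⟨e, he⟩ := h.int_left
  rw [eq_top_iff]
  intro y _
  obtain ⟨ε, hε, hm⟩ := h.exists_sub_smul_mem_interior he y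
  have : y = ε⁻¹ • (e - (e - ε • y)) := by
    rw [sub_sub_cancel, smul_smul, inv_mul_cancel₀ hε.ne', one_smul]
  rw [this]
  exact Submodule.smul_mem _ _ (Submodule.sub_mem _ (Submodule.subset_span he)
    (Submodule.subset_span hm))

end DualPair

section

namespace DualPair

variable {P Q : Set E}

theorem mul_norm_le_inner (h : DualPair P Q) {f : E} {ε : ℝ} (hε : 0 ≤ ε)
    (hb : Metric.closedBall f ε ⊆ Q) {x : E} (hx : x ∈ P) : ε * ‖x‖ ≤ ⟪f, x⟫_ℝ := by
  rcases eq_or_ne x 0 with rfl | hx0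
  · simp
  have hn : 0 < ‖x‖ := norm_pos_iff.2 hx0
  have hm : f - (ε / ‖x‖) • x ∈ Q := by
    apply hb
    rw [Metric.mem_closedBall, dist_eq_norm, sub_sub_cancel_left, norm_neg, norm_smul,
      Real.norm_eq_abs, abs_of_nonneg (by positivity), div_mul_cancel₀ _ hn.ne']
  have h1 := h.inner_nonneg hm hx
  rw [inner_sub_left, inner_smul_left, real_inner_self_eq_norm_sq] at h1
  have : (ε / ‖x‖) * ‖x‖ ^ 2 = ε * ‖x‖ := by field_simp
  simp only [conj_trivial] at h1
  linarith

theorem exists_nonzero_mem_interior [Nontrivial E] (h : DualPair P Q) :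
    ∃ x ∈ interior P, x ≠ 0 := by
  by_contra! hcon
  have h1 := h.linearMap_eq_zero (LinearMap.id : E →ₗ[ℝ] E) fun x hx => hcon x hx
  obtain ⟨z, hz⟩ := exists_ne (0 : E)
  exact hz (LinearMap.congr_fun h1 z)

theorem compact_coercive (h : DualPair P Q) {K : Set E} (hK : IsCompact K)
    (hKP : K ⊆ interior P) :
    ∃ r : ℝ, 0 < r ∧ (∀ k ∈ K, Metric.closedBall k r ⊆ P) ∧
      ∀ k ∈ K, ∀ f ∈ Q, r * ‖f‖ ≤ ⟪k, f⟫_ℝ := by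
  obtain ⟨r, hr, hsub⟩ := hK.exists_cthickening_subset_open isOpen_interior hKP
  have hb : ∀ k ∈ K, Metric.closedBall k r ⊆ P := fun k hk =>
    (Metric.closedBall_subset_cthickening hk r).trans (hsub.trans interior_subset)
  exact ⟨r, hr, hb, fun k hk f hf => h.symm.mul_norm_le_inner hr.le (hb k hk) hf⟩

variable [FiniteDimensional ℝ E]

/-- A point of a compact slice which is central with respect to all points of the cone. -/
theorem exists_central [Nontrivial E] (h : DualPair P Q) {f : E} (hf : f ∈ interior Q) :
    ∃ x ∈ P, ⟪f, x⟫_ℝ = 1 ∧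
      ∀ y ∈ P, (((Module.finrank ℝ E : ℝ) + 1) * ⟪f, y⟫_ℝ) • x - y ∈ P := by
  set n := Module.finrank ℝ E with hn
  set B : Set E := {y | y ∈ P ∧ ⟪f, y⟫_ℝ = 1} with hB
  have hBc : IsCompact B := h.isCompact_slice hf 1
  have hpos : ∀ y ∈ P, y ≠ 0 → 0 < ⟪f, y⟫_ℝ := fun y hy hy0 => by
    rw [real_inner_comm]; exact h.symm.inner_pos hf hy hy0
  have hnorm : ∀ y ∈ P, y ≠ 0 → (⟪f, y⟫_ℝ)⁻¹ • y ∈ B := fun y hy hy0 =>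
    ⟨h.smul_mem hy (inv_pos.2 (hpos y hy hy0)).le, by
      rw [inner_smul_right, inv_mul_cancel₀ (hpos y hy hy0).ne']⟩
  obtain ⟨e, he, he0⟩ := h.exists_nonzero_mem_interior
  set y0 : E := (⟪f, e⟫_ℝ)⁻¹ • e
  have hy0 : y0 ∈ B := hnorm e (interior_subset he) he0
  let F : B → Set E := fun y => {x | ⟪f, x⟫_ℝ = 1 ∧ ((n : ℝ) + 1) • x - (y : E) ∈ P}
  have hFP : ∀ y : B, F y ⊆ B := by
    rintro y x ⟨hx1, hx2⟩
    refine ⟨?_, hx1⟩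
    have h1 := h.add_mem hx2 y.2.1
    rw [sub_add_cancel] at h1
    exact h.mem_of_smul_mem (by positivity) h1
  have hinter : (⋂ y, F y).Nonempty := by
    refine Convex.helly_theorem_compact' (𝕜 := ℝ) ?_ ?_ ?_
    · intro y x hx z hz a b ha hb hab
      refine ⟨?_, ?_⟩
      · rw [inner_add_right, inner_smul_right, inner_smul_right, hx.1, hz.1]; linarith
      · have h1 := h.add_mem (h.smul_mem hx.2 ha) (h.smul_mem hz.2 hb)
        convert h1 using 1
        have : (y : E) = a • (y : E) + b • (y : E) := by rw [← add_smul, hab, one_smul]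
        nth_rewrite 1 [this]
        module
    · intro y
      refine hBc.of_isClosed_subset ?_ (hFP y)
      exact (isClosed_eq (by fun_prop) continuous_const).inter (h.isClosed.preimage (by fun_prop))
    · intro I hI
      set m : ℝ := (n : ℝ) + 1 - I.card with hm
      have hm0 : 0 ≤ m := by
        have : (I.card : ℝ) ≤ (n : ℝ) + 1 := by exact_mod_cast hI
        linarith
      have hn1 : (0 : ℝ) < (n : ℝ) + 1 := by positivity
      have hsum : ∀ J : Finset B, ∑ z ∈ J, (z : E) ∈ P := fun J => by
        classical
        induction J using Finset.induction_on with
        | empty => simpa using h.zero_mem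
        | insert a s ha ih => rw [Finset.sum_insert ha]; exact h.add_mem a.2.1 ih
      refine ⟨((n : ℝ) + 1)⁻¹ • (∑ z ∈ I, (z : E) + m • y0), ?_⟩
      simp only [mem_iInter]
      intro y hy
      refine ⟨?_, ?_⟩
      · rw [inner_smul_right, inner_add_right, inner_sum, inner_smul_right, hy0.2,
          Finset.sum_congr rfl fun (z : B) _ => z.2.2]
        simp only [Finset.sum_const, nsmul_eq_mul, mul_one, hm]
        field_simp
        ring
      · classical
        rw [smul_smul, mul_inv_cancel₀ hn1.ne', one_smul, ← Finset.add_sum_erase I _ hy]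
        have h1 := h.add_mem (hsum (I.erase y)) (h.smul_mem hy0.1 hm0)
        convert h1 using 1
        abel
  obtain ⟨x, hx⟩ := hinter
  simp only [mem_iInter] at hx
  refine ⟨x, (hFP ⟨y0, hy0⟩ (hx _)).1, (hx ⟨y0, hy0⟩).1, fun y hy => ?_⟩
  rcases eq_or_ne y 0 with rfl | hyz
  · simpa using h.zero_mem
  have hp := hpos y hy hyz
  have h1 := h.smul_mem (hx ⟨_, hnorm y hy hyz⟩).2 hp.le
  convert h1 using 1
  simp only [smul_sub, smul_smul]
  rw [mul_inv_cancel₀ hp.ne', one_smul, mul_comm]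

theorem mem_interior_of_central (h : DualPair P Q) {x : E} {c : E → ℝ} (hx : x ∈ P)
    (hc : ∀ y ∈ P, c y • x - y ∈ P) : x ∈ interior P := by
  by_contra hx'
  obtain ⟨φ, hφ, hφ0, h0⟩ := h.exists_support hx hx'
  obtain ⟨e, he⟩ := h.int_left
  have h1 := h.inner_nonneg hφ (hc e (interior_subset he))
  rw [inner_sub_right, inner_smul_right, h0] at h1
  linarith [h.inner_pos he hφ hφ0]

end DualPair

variable [FiniteDimensional ℝ E]

/-- The operator `g` maps the cone `P` to itself. -/
theorem adjoint_mem_of_map {P Q : Set E} (h : DualPair P Q) {A : E →L[ℝ] E}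
    (hA : ∀ x ∈ P, A x ∈ P) {f : E} (hf : f ∈ Q) : adjoint A f ∈ Q := by
  rw [h.mem_right]
  intro x hx
  rw [adjoint_inner_right, real_inner_comm]
  exact h.inner_nonneg hf (hA x hx)

/-- A group `G` of linear automorphisms of the cone `P` with dual cone `Q` that acts cocompactly on
the interior of `P`. -/
structure QuasiHomogeneous (P Q : Set E) (G : Set (E →L[ℝ] E)) : Prop where
  pair : DualPair P Q
  one_mem : 1 ∈ G
  mul_mem : ∀ g ∈ G, ∀ h ∈ G, g * h ∈ G
  exists_inv : ∀ g ∈ G, ∃ h ∈ G, g * h = 1 ∧ h * g = 1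
  map : ∀ g ∈ G, ∀ x ∈ P, g x ∈ P
  cocompact : ∃ K : Set E, IsCompact K ∧ K ⊆ interior P ∧
    ∀ x ∈ interior P, ∃ g ∈ G, ∃ k ∈ K, g k = x

namespace QuasiHomogeneous

variable {P Q : Set E} {G : Set (E →L[ℝ] E)}

theorem map_dual (h : QuasiHomogeneous P Q G) {g : E →L[ℝ] E} (hg : g ∈ G) {f : E} (hf : f ∈ Q) :
    adjoint g f ∈ Q :=
  adjoint_mem_of_map h.pair (h.map g hg) hf

theorem map_interior (h : QuasiHomogeneous P Q G) {g : E →L[ℝ] E} (hg : g ∈ G) {x : E}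
    (hx : x ∈ interior P) : g x ∈ interior P := by
  refine h.pair.mem_interior_of_inner_pos fun f hf hf0 => ?_
  rw [← adjoint_inner_left]
  refine h.pair.inner_pos hx (h.map_dual hg hf) fun h0 => hf0 ?_
  obtain ⟨k, -, hk, -⟩ := h.exists_inv g hg
  have h1 : adjoint k (adjoint g f) = f := by
    refine ext_inner_right ℝ fun v => ?_
    rw [adjoint_inner_left, adjoint_inner_left, ← mul_apply_eq_comp, hk,
      one_apply_eq_self]
  rw [← h1, h0, map_zero]

theorem adjoint_mul (g k : E →L[ℝ] E) : adjoint (g * k) = adjoint k * adjoint g :=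
  ContinuousLinearMap.adjoint_comp g k

theorem adjoint_one : adjoint (1 : E →L[ℝ] E) = 1 := by
  refine (ContinuousLinearMap.eq_adjoint_iff 1 1).2 ?_ |>.symm
  simp

/-- Quasi-homogeneity passes to the dual cone with the adjoint group. -/
theorem symm [Nontrivial E] (h : QuasiHomogeneous P Q G) :
    QuasiHomogeneous Q P {g | adjoint g ∈ G} where
  pair := h.pair.symm
  one_mem := by simpa [adjoint_one] using h.one_mem
  mul_mem g hg k hk := by
    rw [mem_ofPred_eq, adjoint_mul]
    exact h.mul_mem _ hk _ hg
  exists_inv g hg := by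
    obtain ⟨k, hk, h1, h2⟩ := h.exists_inv _ hg
    refine ⟨adjoint k, by simpa using hk, ?_, ?_⟩
    · have := congrArg adjoint h2
      rwa [adjoint_mul, adjoint_one, ContinuousLinearMap.adjoint_adjoint] at this
    · have := congrArg adjoint h1
      rwa [adjoint_mul, adjoint_one, ContinuousLinearMap.adjoint_adjoint] at this
  map g hg f hf := by
    have := h.map_dual hg hf
    rwa [ContinuousLinearMap.adjoint_adjoint] at this
  cocompact := by
    obtain ⟨K, hK, hKP, hcov⟩ := h.cocompact
    obtain ⟨r, hr, -, hco⟩ := h.pair.compact_coercive hK hKP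
    set c : ℝ := (Module.finrank ℝ E : ℝ) + 1
    let S : Set (E × E) := {z | z.1 ∈ Q ∧ z.2 ∈ K ∧ ⟪z.1, z.2⟫_ℝ = 1 ∧
      ∀ y ∈ P, (c * ⟪z.1, y⟫_ℝ) • z.2 - y ∈ P}
    have hS : IsCompact S := by
      refine ((isCompact_closedBall (0 : E) (1 / r)).prod hK).of_isClosed_subset ?_ ?_
      · have : S = {z | z.1 ∈ Q} ∩ {z | z.2 ∈ K} ∩ {z | ⟪z.1, z.2⟫_ℝ = 1} ∩
            ⋂ y ∈ P, {z : E × E | (c * ⟪z.1, y⟫_ℝ) • z.2 - y ∈ P} := by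
          ext z; simp [S, and_assoc]
        rw [this]
        refine (((h.pair.symm.isClosed.preimage continuous_fst).inter
          (hK.isClosed.preimage continuous_snd)).inter
          (isClosed_eq (by fun_prop) continuous_const)).inter ?_
        exact isClosed_biInter fun y _ => h.pair.isClosed.preimage (by fun_prop)
      · rintro ⟨f, k⟩ ⟨hf, hk, h1, -⟩
        refine ⟨?_, hk⟩
        rw [mem_closedBall_zero_iff, le_div_iff₀ hr, mul_comm]
        have := hco k hk f hf
        rwa [real_inner_comm, h1] at this
    refine ⟨Prod.fst '' S, hS.image continuous_fst, ?_, ?_⟩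
    · rintro _ ⟨⟨f, k⟩, ⟨hf, hk, h1, h2⟩, rfl⟩
      refine h.pair.symm.mem_interior_of_inner_pos fun y hy hy0 => ?_
      refine lt_of_le_of_ne (h.pair.symm.inner_nonneg hy hf) fun h0 => hy0 ?_
      have h3 := h2 y hy
      simp only at h3 h0 ⊢
      rw [real_inner_comm, ← h0, mul_zero, zero_smul, zero_sub] at h3
      exact h.pair.sharp hy h3
    · intro f hf
      obtain ⟨x, hx, hx1, hx2⟩ := h.pair.exists_central hf
      have hxi : x ∈ interior P := h.pair.mem_interior_of_central hx hx2
      obtain ⟨g, hg, k, hk, rfl⟩ := hcov x hxi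
      obtain ⟨g', hg', h1, h2⟩ := h.exists_inv g hg
      have hinv : ∀ y, g' (g y) = y := fun y => by
        rw [← mul_apply_eq_comp, h2, one_apply_eq_self]
      have hinv' : ∀ y, g (g' y) = y := fun y => by
        rw [← mul_apply_eq_comp, h1, one_apply_eq_self]
      refine ⟨adjoint g', by simpa using hg', adjoint g f,
        ⟨(adjoint g f, k), ⟨h.map_dual hg (interior_subset hf), hk, ?_, ?_⟩, rfl⟩, ?_⟩
      · simpa only [adjoint_inner_left] using hx1
      · intro y hy
        have := h.map g' hg' _ (hx2 (g y) (h.map g hg y hy))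
        rw [map_sub, map_smul, hinv, hinv] at this
        simpa only [adjoint_inner_left] using this
      · refine ext_inner_right ℝ fun v => ?_
        rw [adjoint_inner_left, adjoint_inner_left, hinv']

end QuasiHomogeneous

end

section

theorem apply_apply_of_mul_eq_one {g k : E →L[ℝ] E} (h : g * k = 1) (y : E) : g (k y) = y := by
  rw [← mul_apply_eq_comp, h, one_apply_eq_self]

/-- The two extremal rays `f₁`, `f₂` generate the two-dimensional cone `S`. -/
structure ConeBasis (S : Set E) (f₁ f₂ : E) : Prop where
  left_mem : f₁ ∈ S
  right_mem : f₂ ∈ S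
  indep : ∀ a b : ℝ, a • f₁ + b • f₂ = 0 → a = 0 ∧ b = 0
  gen : ∀ x ∈ S, ∃ a b : ℝ, 0 ≤ a ∧ 0 ≤ b ∧ x = a • f₁ + b • f₂

namespace ConeBasis

variable {S : Set E} {f₁ f₂ : E}

theorem symm (h : ConeBasis S f₁ f₂) : ConeBasis S f₂ f₁ where
  left_mem := h.right_mem
  right_mem := h.left_mem
  indep a b hab := (h.indep b a (by rw [add_comm, hab])).symm
  gen x hx := by
    obtain ⟨a, b, ha, hb, rfl⟩ := h.gen x hx
    exact ⟨b, a, hb, ha, add_comm _ _⟩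

theorem left_ne_zero (h : ConeBasis S f₁ f₂) : f₁ ≠ 0 := by
  rintro rfl
  exact one_ne_zero (h.indep 1 0 (by simp)).1

theorem right_ne_zero (h : ConeBasis S f₁ f₂) : f₂ ≠ 0 := h.symm.left_ne_zero

theorem unique (h : ConeBasis S f₁ f₂) {a b c d : ℝ}
    (he : a • f₁ + b • f₂ = c • f₁ + d • f₂) : a = c ∧ b = d := by
  have := h.indep (a - c) (b - d) (by
    rw [sub_smul, sub_smul, sub_add_sub_comm, he, sub_self])
  exact ⟨sub_eq_zero.1 this.1, sub_eq_zero.1 this.2⟩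

/-- An automorphism of a two-dimensional cone permutes its extremal rays. -/
theorem permutes (h : ConeBasis S f₁ f₂) {g k : E →L[ℝ] E} (hkg : k * g = 1)
    (hg : ∀ x ∈ S, g x ∈ S) (hk : ∀ x ∈ S, k x ∈ S) :
    (∃ c : ℝ, g f₁ = c • f₁) ∨ ∃ c : ℝ, g f₁ = c • f₂ := by
  obtain ⟨α, β, hα, hβ, h1⟩ := h.gen _ (hg _ h.left_mem)
  obtain ⟨a, b, ha, hb, h2⟩ := h.gen _ (hk _ h.left_mem)
  obtain ⟨a', b', ha', hb', h3⟩ := h.gen _ (hk _ h.right_mem)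
  rcases eq_or_lt_of_le hα with hα0 | hα0
  · exact Or.inr ⟨β, by rw [h1, ← hα0]; simp⟩
  rcases eq_or_lt_of_le hβ with hβ0 | hβ0
  · exact Or.inl ⟨α, by rw [h1, ← hβ0]; simp⟩
  exfalso
  have h4 : (α * a + β * a') • f₁ + (α * b + β * b') • f₂ = (1 : ℝ) • f₁ + (0 : ℝ) • f₂ := by
    have := apply_apply_of_mul_eq_one hkg f₁
    rw [h1, map_add, map_smul, map_smul, h2, h3] at this
    rw [one_smul, zero_smul, add_zero]
    refine Eq.trans ?_ this
    module
  have h5 := (h.unique h4)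
  have h6 : b = 0 := by nlinarith [h5.2, mul_nonneg hα0.le hb, mul_nonneg hβ0.le hb']
  have h7 : b' = 0 := by nlinarith [h5.2, mul_nonneg hα0.le hb, mul_nonneg hβ0.le hb']
  rw [h6, zero_smul, add_zero] at h2
  rw [h7, zero_smul, add_zero] at h3
  obtain ⟨γ, δ, -, -, hg2⟩ := h.gen _ (hg _ h.right_mem)
  have h8 := apply_apply_of_mul_eq_one hkg f₂
  rw [hg2, map_add, map_smul, map_smul, h2, h3] at h8
  have h9 := h.unique (a := γ * a + δ * a') (b := 0) (c := 0) (d := 1) (by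
    rw [zero_smul, zero_smul, one_smul, zero_add, add_zero, ← h8]
    module)
  exact one_ne_zero h9.2.symm

theorem permutes_right (h : ConeBasis S f₁ f₂) {g k : E →L[ℝ] E} (hkg : k * g = 1)
    (hg : ∀ x ∈ S, g x ∈ S) (hk : ∀ x ∈ S, k x ∈ S) {c : ℝ} (hc : g f₁ = c • f₁) :
    ∃ c : ℝ, g f₂ = c • f₂ := by
  rcases h.symm.permutes hkg hg hk with h1 | ⟨d, hd⟩
  · exact h1
  exfalso
  have h2 : g (d • f₁ - c • f₂) = 0 := by
    rw [map_sub, map_smul, map_smul, hc, hd]; module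
  have h3 : d • f₁ - c • f₂ = 0 := by
    rw [← apply_apply_of_mul_eq_one hkg (d • f₁ - c • f₂), h2, map_zero]
  have h4 := h.indep d (-c) (by rw [← h3]; module)
  rw [h4.1, zero_smul] at hd
  apply h.right_ne_zero
  rw [← apply_apply_of_mul_eq_one hkg f₂, hd, map_zero]

end ConeBasis

variable [FiniteDimensional ℝ E]

theorem DualPair.exists_coneBasis {P Q : Set E} (h : DualPair P Q) (W : Submodule ℝ E)
    (hW : Module.finrank ℝ (Submodule.span ℝ (P ∩ W)) = 2) :
    ∃ f₁ f₂, ConeBasis (P ∩ W) f₁ f₂ := by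
  obtain ⟨e, he⟩ := h.int_right
  obtain ⟨x, y, hx, hy, hspan, hind⟩ : ∃ x y : E, x ∈ P ∩ W ∧ y ∈ P ∩ W ∧
      Submodule.span ℝ {x, y} = Submodule.span ℝ (P ∩ W) ∧
      ∀ a b : ℝ, a • x + b • y = 0 → a = 0 ∧ b = 0 := by
    obtain ⟨f, hf1, hf2, hf3⟩ := Submodule.exists_fun_fin_finrank_span_eq ℝ (P ∩ (W : Set E))
    revert f
    rw [hW]
    intro f hf1 hf2 hf3
    have hf : f = ![f 0, f 1] := by ext i; fin_cases i <;> rfl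
    refine ⟨f 0, f 1, hf1 0, hf1 1, ?_, LinearIndependent.pair_iff.1 (hf ▸ hf3)⟩
    rw [← hf2]
    congr 1
    ext z
    simp [eq_comm]
  have hx0 : x ≠ 0 := by rintro rfl; simpa using hind 1 0
  have hy0 : y ≠ 0 := by rintro rfl; simpa using hind 0 1
  have hex : 0 < ⟪e, x⟫_ℝ := by rw [real_inner_comm]; exact h.symm.inner_pos he hx.1 hx0
  have hey : 0 < ⟪e, y⟫_ℝ := by rw [real_inner_comm]; exact h.symm.inner_pos he hy.1 hy0
  set d : E := ⟪e, y⟫_ℝ • x - ⟪e, x⟫_ℝ • y with hd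
  have hd0 : d ≠ 0 := fun h0 => hey.ne' (hind ⟪e, y⟫_ℝ (-⟪e, x⟫_ℝ) (by
    rw [neg_smul, ← sub_eq_add_neg]; exact h0)).1
  have hdd : 0 < ⟪d, d⟫_ℝ := real_inner_self_pos.2 hd0
  set B : Set E := {b | (b ∈ P ∩ W) ∧ ⟪e, b⟫_ℝ = 1} with hB
  have hBc : IsCompact B := by
    refine (h.isCompact_slice he 1).of_isClosed_subset ?_ fun b hb => ⟨hb.1.1, hb.2⟩
    exact (h.isClosed.inter W.closed_of_finiteDimensional).inter
      (isClosed_eq (by fun_prop) continuous_const)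
  have hnorm : ∀ z ∈ P ∩ W, 0 < ⟪e, z⟫_ℝ → (⟪e, z⟫_ℝ)⁻¹ • z ∈ B := fun z hz hp =>
    ⟨⟨h.smul_mem hz.1 (inv_pos.2 hp).le, W.smul_mem _ hz.2⟩, by
      rw [inner_smul_right, inv_mul_cancel₀ hp.ne']⟩
  have hBne : B.Nonempty := ⟨_, hnorm x hx hex⟩
  obtain ⟨f₁, hf₁, hmin⟩ := hBc.exists_isMinOn hBne (f := fun b => ⟪d, b⟫_ℝ) (by fun_prop)
  obtain ⟨f₂, hf₂, hmax⟩ := hBc.exists_isMaxOn hBne (f := fun b => ⟪d, b⟫_ℝ) (by fun_prop)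
  have hline : ∀ b ∈ B, ∃ t : ℝ, b = f₁ + t • d := by
    intro b hb
    have hm : b - f₁ ∈ Submodule.span ℝ {x, y} := by
      rw [hspan]
      exact Submodule.sub_mem _ (Submodule.subset_span hb.1) (Submodule.subset_span hf₁.1)
    obtain ⟨α, β, hαβ⟩ := Submodule.mem_span_pair.1 hm
    have h0 : α * ⟪e, x⟫_ℝ + β * ⟪e, y⟫_ℝ = 0 := by
      have : ⟪e, b - f₁⟫_ℝ = 0 := by rw [inner_sub_right, hb.2, hf₁.2, sub_self]
      rwa [← hαβ, inner_add_right, inner_smul_right, inner_smul_right] at this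
    refine ⟨α / ⟪e, y⟫_ℝ, ?_⟩
    have hβ : β = -(α / ⟪e, y⟫_ℝ * ⟪e, x⟫_ℝ) := by field_simp; linarith
    have hα : α = α / ⟪e, y⟫_ℝ * ⟪e, y⟫_ℝ := by field_simp
    have : b = f₁ + (α • x + β • y) := by rw [hαβ]; abel
    rw [this, hβ, hd]
    nth_rewrite 1 [hα]
    module
  obtain ⟨T, hT⟩ := hline f₂ hf₂
  have hval : ∀ t : ℝ, ⟪d, f₁ + t • d⟫_ℝ = ⟪d, f₁⟫_ℝ + t * ⟪d, d⟫_ℝ := fun t => by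
    rw [inner_add_right, inner_smul_right]
  have hrange : ∀ b ∈ B, ∃ t : ℝ, b = f₁ + t • d ∧ 0 ≤ t ∧ t ≤ T := by
    intro b hb
    obtain ⟨t, rfl⟩ := hline b hb
    have h1 : ⟪d, f₁⟫_ℝ ≤ ⟪d, f₁ + t • d⟫_ℝ := hmin hb
    have h2 : ⟪d, f₁ + t • d⟫_ℝ ≤ ⟪d, f₂⟫_ℝ := hmax hb
    rw [hT, hval, hval] at h2
    rw [hval] at h1
    exact ⟨t, rfl, by nlinarith, by nlinarith⟩
  have hT0 : 0 < T := by
    by_contra hle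
    obtain ⟨t, ht, ht0, htT⟩ := hrange _ (hnorm x hx hex)
    obtain ⟨s, hs, hs0, hsT⟩ := hrange _ (hnorm y hy hey)
    rw [show t = 0 by linarith, zero_smul, add_zero] at ht
    rw [show s = 0 by linarith, zero_smul, add_zero] at hs
    have := (hind (⟪e, x⟫_ℝ)⁻¹ (-(⟪e, y⟫_ℝ)⁻¹) (by rw [ht, neg_smul, hs, add_neg_cancel])).1
    exact (inv_pos.2 hex).ne' this
  refine ⟨f₁, f₂, hf₁.1, hf₂.1, fun a b hab => ?_, fun z hz => ?_⟩
  · have h1 : ⟪e, a • f₁ + b • f₂⟫_ℝ = 0 := by rw [hab, inner_zero_right]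
    rw [inner_add_right, inner_smul_right, inner_smul_right, hf₁.2, hf₂.2] at h1
    have h2 : (b * T) • d = 0 := by
      rw [← hab, hT, show a = -b by linarith]; module
    have h3 := (smul_eq_zero.1 h2).resolve_right hd0
    have h4 : b = 0 := (mul_eq_zero.1 h3).resolve_right hT0.ne'
    exact ⟨by linarith, h4⟩
  · rcases eq_or_ne z 0 with rfl | hz0
    · exact ⟨0, 0, le_rfl, le_rfl, by simp⟩
    have hez : 0 < ⟪e, z⟫_ℝ := by rw [real_inner_comm]; exact h.symm.inner_pos he hz.1 hz0
    obtain ⟨t, ht, ht0, htT⟩ := hrange _ (hnorm z hz hez)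
    refine ⟨⟪e, z⟫_ℝ * (1 - t / T), ⟪e, z⟫_ℝ * (t / T), ?_, by positivity, ?_⟩
    · exact mul_nonneg hez.le (by rw [sub_nonneg, div_le_one hT0]; exact htT)
    · have h1 : z = ⟪e, z⟫_ℝ • ((⟪e, z⟫_ℝ)⁻¹ • z) := by
        rw [smul_smul, mul_inv_cancel₀ hez.ne', one_smul]
      nth_rewrite 1 [h1]
      rw [ht, hT]
      have h2 : t = t / T * T := by field_simp
      nth_rewrite 1 [h2]
      module

end

section

theorem tendsto_clm_apply {g : ℕ → E →L[ℝ] E} {A : E →L[ℝ] E} {x : ℕ → E} {x₀ : E}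
    (hg : Tendsto g atTop (𝓝 A)) (hx : Tendsto x atTop (𝓝 x₀)) :
    Tendsto (fun n => g n (x n)) atTop (𝓝 (A x₀)) :=
  ((isBoundedBilinearMap_apply (𝕜 := ℝ)).continuous.tendsto (A, x₀)).comp (hg.prodMk_nhds hx)

/-- A sequence `g n` in `G` converging to a singular limit `A` and carrying a convergent sequence
`k n` of interior points to a sequence `x n` converging to `x₀`. -/
structure Degeneration (P : Set E) (G : Set (E →L[ℝ] E)) (x : ℕ → E) (x₀ : E)
    (g gi : ℕ → E →L[ℝ] E) (k : ℕ → E) (A : E →L[ℝ] E) (k₀ : E) : Prop where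
  g_mem : ∀ n, g n ∈ G
  gi_mem : ∀ n, gi n ∈ G
  mul_inv : ∀ n, g n * gi n = 1
  inv_mul : ∀ n, gi n * g n = 1
  k_mem : ∀ n, k n ∈ interior P
  apply_k : ∀ n, g n (k n) = x n
  tendsto_g : Tendsto g atTop (𝓝 A)
  tendsto_k : Tendsto k atTop (𝓝 k₀)
  k₀_mem : k₀ ∈ interior P
  map : ∀ y ∈ P, A y ∈ P
  apply_k₀ : A k₀ = x₀

theorem Degeneration.gi_apply {P : Set E} {G : Set (E →L[ℝ] E)} {x : ℕ → E} {x₀ : E}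
    {g gi : ℕ → E →L[ℝ] E} {k : ℕ → E} {A : E →L[ℝ] E} {k₀ : E}
    (d : Degeneration P G x x₀ g gi k A k₀) (n : ℕ) :
    gi n (x n) = k n := by
  rw [← d.apply_k, apply_apply_of_mul_eq_one (d.inv_mul n)]

variable [FiniteDimensional ℝ E]

theorem adjoint_apply_adjoint_apply {g k : E →L[ℝ] E} (h : g * k = 1) (f : E) :
    adjoint k (adjoint g f) = f :=
  ext_inner_right ℝ fun v => by
    rw [adjoint_inner_left, adjoint_inner_left, apply_apply_of_mul_eq_one h]

namespace QuasiHomogeneous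

variable {P Q : Set E} {G : Set (E →L[ℝ] E)}

/-- Cocompactness passes to subgroups of finite index. -/
theorem of_finite_index (h : QuasiHomogeneous P Q G) {G₀ : Set (E →L[ℝ] E)} (hsub : G₀ ⊆ G)
    (hone : 1 ∈ G₀) (hmul : ∀ g ∈ G₀, ∀ k ∈ G₀, g * k ∈ G₀)
    (hinv : ∀ g ∈ G₀, ∀ k ∈ G, g * k = 1 → k * g = 1 → k ∈ G₀)
    {ι : Type*} [Finite ι] (F : (E →L[ℝ] E) → ι)
    (hF : ∀ g ∈ G, ∀ s ∈ G, ∀ k ∈ G, s * k = 1 → k * s = 1 → F g = F s → g * k ∈ G₀) :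
    QuasiHomogeneous P Q G₀ where
  pair := h.pair
  one_mem := hone
  mul_mem := hmul
  exists_inv g hg := by
    obtain ⟨k, hk, h1, h2⟩ := h.exists_inv g (hsub hg)
    exact ⟨k, hinv g hg k hk h1 h2, h1, h2⟩
  map g hg := h.map g (hsub hg)
  cocompact := by
    classical
    obtain ⟨K, hK, hKP, hcov⟩ := h.cocompact
    have hrep : ∀ i : ι, ∃ s ∈ G, (∃ g ∈ G, F g = i) → F s = i := fun i => by
      by_cases hi : ∃ g ∈ G, F g = i
      · obtain ⟨g, hg, hgi⟩ := hi
        exact ⟨g, hg, fun _ => hgi⟩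
      · exact ⟨1, h.one_mem, fun h' => absurd h' hi⟩
    choose s hs hsF using hrep
    refine ⟨⋃ i, s i '' K, isCompact_iUnion fun i => hK.image (s i).continuous, ?_, ?_⟩
    · rintro x hx
      obtain ⟨i, k, hk, rfl⟩ := mem_iUnion.1 hx
      exact h.map_interior (hs i) (hKP hk)
    · intro x hx
      obtain ⟨g, hg, k, hk, rfl⟩ := hcov x hx
      obtain ⟨t, ht, h1, h2⟩ := h.exists_inv _ (hs (F g))
      refine ⟨g * t, hF g hg _ (hs (F g)) t ht h1 h2 (hsF (F g) ⟨g, hg, rfl⟩).symm,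
        s (F g) k, mem_iUnion.2 ⟨F g, k, hk, rfl⟩, ?_⟩
      rw [mul_apply_eq_comp, apply_apply_of_mul_eq_one h2]

/-- If the rays of `f₁` and `f₂` are permuted, the stabiliser of the first acts cocompactly. -/
theorem of_permutes (h : QuasiHomogeneous P Q G) {f₁ f₂ : E} (hf₁ : f₁ ≠ 0)
    (hperm : ∀ g ∈ G, (∃ c : ℝ, g f₁ = c • f₁) ∨ ∃ c : ℝ, g f₁ = c • f₂) :
    QuasiHomogeneous P Q {g | g ∈ G ∧ ∃ c : ℝ, g f₁ = c • f₁} := by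
  have hne : ∀ g k : E →L[ℝ] E, k * g = 1 → ∀ (c : ℝ) (v : E), g f₁ = c • v → c ≠ 0 := by
    rintro g k hk c v hc rfl
    apply hf₁
    rw [← apply_apply_of_mul_eq_one hk f₁, hc, zero_smul, map_zero]
  refine h.of_finite_index (fun g hg => hg.1) ⟨h.one_mem, 1, by simp⟩ ?_ ?_
    (F := fun g => ∃ k ∈ G, g * k = 1 ∧ k * g = 1 ∧ ∃ c : ℝ, k f₁ = c • f₁) ?_
  · rintro g ⟨hg, c, hc⟩ k ⟨hk, d, hd⟩
    exact ⟨h.mul_mem g hg k hk, d * c, by rw [mul_apply_eq_comp, hd, map_smul, hc, smul_smul]⟩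
  · rintro g ⟨hg, c, hc⟩ k hk h1 h2
    refine ⟨hk, c⁻¹, ?_⟩
    have hc0 := hne g k h2 c _ hc
    rw [eq_inv_smul_iff₀ hc0, ← map_smul, ← hc, apply_apply_of_mul_eq_one h2]
  · intro g hg s hs k hk h1 h2 hF
    refine ⟨h.mul_mem g hg k hk, ?_⟩
    obtain ⟨t, ht, h3, h4⟩ := h.exists_inv g hg
    have hgt := apply_apply_of_mul_eq_one h3
    rw [mul_apply_eq_comp]
    by_cases hs' : ∃ c : ℝ, k f₁ = c • f₁
    · obtain ⟨t', -, h3', h4', d, hd⟩ :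
          ∃ k ∈ G, g * k = 1 ∧ k * g = 1 ∧ ∃ c : ℝ, k f₁ = c • f₁ := by
        rw [hF]; exact ⟨k, hk, h1, h2, hs'⟩
      obtain ⟨c, hc⟩ := hs'
      have hd0 := hne _ _ h3' d _ hd
      refine ⟨c * d⁻¹, ?_⟩
      have : g f₁ = d⁻¹ • f₁ := by
        rw [eq_inv_smul_iff₀ hd0, ← map_smul, ← hd, apply_apply_of_mul_eq_one h3']
      rw [hc, map_smul, this, smul_smul]
    · have ht' : ¬ ∃ c : ℝ, t f₁ = c • f₁ := fun hcon => by
        obtain ⟨k', -, h1', h2', hc⟩ :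
            ∃ k ∈ G, s * k = 1 ∧ k * s = 1 ∧ ∃ c : ℝ, k f₁ = c • f₁ := by
          rw [← hF]; exact ⟨t, ht, h3, h4, hcon⟩
        have : k' = k := by
          rw [← mul_one k', ← h1, ← mul_assoc, h2', one_mul]
        exact hs' (this ▸ hc)
      obtain ⟨c, hc⟩ := (hperm k hk).resolve_left hs'
      obtain ⟨d, hd⟩ := (hperm t ht).resolve_left ht'
      have hd0 := hne _ _ h3 d _ hd
      refine ⟨c * d⁻¹, ?_⟩
      have : g f₂ = d⁻¹ • f₁ := by
        rw [eq_inv_smul_iff₀ hd0, ← map_smul, ← hd, hgt]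
      rw [hc, map_smul, this, smul_smul]

end QuasiHomogeneous

theorem QuasiHomogeneous.exists_degeneration {P Q : Set E} {G : Set (E →L[ℝ] E)}
    (h : QuasiHomogeneous P Q G) {x : ℕ → E} {x₀ : E} (hx : ∀ n, x n ∈ interior P)
    (hlim : Tendsto x atTop (𝓝 x₀)) :
    ∃ φ : ℕ → ℕ, StrictMono φ ∧ ∃ g gi k A k₀, Degeneration P G (x ∘ φ) x₀ g gi k A k₀ := by
  obtain ⟨K, hK, hKP, hcov⟩ := h.cocompact
  obtain ⟨r, hr, hball, -⟩ := h.pair.compact_coercive hK hKP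
  obtain ⟨c, hc, hnormal⟩ := h.pair.normal
  choose g hg k hk hgk using fun n => hcov (x n) (hx n)
  choose gi hgi h1 h2 using fun n => h.exists_inv (g n) (hg n)
  obtain ⟨R, hR⟩ := (Metric.isBounded_range_of_tendsto x hlim).exists_norm_le
  have hxR : ∀ n, ‖x n‖ ≤ R := fun n => hR _ ⟨n, rfl⟩
  have hR0 : 0 ≤ R := (norm_nonneg _).trans (hxR 0)
  set M : ℝ := (2 * c + 1) * R / r with hM
  have hM0 : 0 ≤ M := by positivity
  have hbound : ∀ n, ‖g n‖ ≤ M := by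
    intro n
    refine ContinuousLinearMap.opNorm_le_bound _ hM0 fun v => ?_
    rcases eq_or_ne v 0 with rfl | hv
    · simp
    have hvn : 0 < ‖v‖ := norm_pos_iff.2 hv
    set w : E := (r / ‖v‖) • v with hw
    have hwn : ‖w‖ = r := by
      rw [hw, norm_smul, Real.norm_eq_abs, abs_of_pos (by positivity), div_mul_cancel₀ _ hvn.ne']
    have e1 : g n (k n + w) ∈ P :=
      h.map _ (hg n) _ (hball _ (hk n) (by rw [Metric.mem_closedBall, dist_eq_norm,
        add_sub_cancel_left, hwn]))
    have e2 : g n (k n - w) ∈ P :=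
      h.map _ (hg n) _ (hball _ (hk n) (by rw [Metric.mem_closedBall, dist_eq_norm,
        sub_sub_cancel_left, norm_neg, hwn]))
    have e3 := hnormal _ e1 _ e2
    have e4 : g n (k n + w) + g n (k n - w) = (2 : ℝ) • x n := by
      rw [← map_add, ← hgk, ← map_smul]; congr 1; module
    rw [e4, norm_smul, Real.norm_ofNat] at e3
    have e5 : g n w = g n (k n + w) - x n := by rw [map_add, hgk]; abel
    have e6 : ‖g n w‖ ≤ (2 * c + 1) * R := by
      rw [e5]
      refine (norm_sub_le _ _).trans ?_
      nlinarith [hxR n]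
    rw [hw, map_smul, norm_smul, Real.norm_eq_abs, abs_of_pos (by positivity)] at e6
    rw [hM, div_mul_eq_mul_div, le_div_iff₀ hr]
    have e7 : r / ‖v‖ * ‖(g n) v‖ = (‖(g n) v‖ * r) / ‖v‖ := by ring
    rwa [e7, div_le_iff₀ hvn] at e6
  have hcomp : IsCompact (Metric.closedBall (0 : E →L[ℝ] E) M ×ˢ K) :=
    (isCompact_closedBall _ _).prod hK
  obtain ⟨⟨A, k₀⟩, ⟨-, hk₀⟩, φ, hφ, hlim2⟩ :=
    hcomp.tendsto_subseq (x := fun n => (g n, k n)) fun n =>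
      ⟨by simpa using hbound n, hk n⟩
  have hgl : Tendsto (g ∘ φ) atTop (𝓝 A) := (continuous_fst.tendsto _).comp hlim2
  have hkl : Tendsto (k ∘ φ) atTop (𝓝 k₀) := (continuous_snd.tendsto _).comp hlim2
  refine ⟨φ, hφ, g ∘ φ, gi ∘ φ, k ∘ φ, A, k₀, ?_⟩
  refine ⟨fun n => hg _, fun n => hgi _, fun n => h1 _, fun n => h2 _, fun n => hKP (hk _),
    fun n => hgk _, hgl, hkl, hKP hk₀, fun y hy => ?_, ?_⟩
  · exact h.pair.isClosed.mem_of_tendsto (tendsto_clm_apply hgl tendsto_const_nhds)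
      (Eventually.of_forall fun n => h.map _ (hg _) y hy)
  · exact tendsto_nhds_unique (tendsto_clm_apply hgl hkl)
      ((hlim.comp hφ.tendsto_atTop).congr fun n => (hgk _).symm)

namespace Degeneration

variable {P Q : Set E} {G : Set (E →L[ℝ] E)} {x : ℕ → E} {x₀ : E}
  {g gi : ℕ → E →L[ℝ] E} {k : ℕ → E} {A : E →L[ℝ] E} {k₀ : E}

theorem map_dual (d : Degeneration P G x x₀ g gi k A k₀) (hPQ : DualPair P Q) {f : E}
    (hf : f ∈ Q) : adjoint A f ∈ Q :=
  adjoint_mem_of_map hPQ d.map hf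

theorem map_submodule (d : Degeneration P G x x₀ g gi k A k₀) {V : Submodule ℝ E}
    (hV : ∀ g ∈ G, ∀ v ∈ V, g v ∈ V) {v : E} (hv : v ∈ V) : A v ∈ V :=
  V.closed_of_finiteDimensional.mem_of_tendsto (tendsto_clm_apply d.tendsto_g tendsto_const_nhds)
    (Eventually.of_forall fun n => hV _ (d.g_mem n) v hv)

/-- Preimages under the limit operator of two summands dominated by the sequence `x n`. -/
theorem exists_preimage_pair (d : Degeneration P G x x₀ g gi k A k₀)
    (h : QuasiHomogeneous P Q G) {y z : E} (hy : y ∈ P) (hz : z ∈ P)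
    (hle : ∀ n, x n - y - z ∈ P) :
    ∃ y' ∈ P, ∃ z' ∈ P, k₀ - y' - z' ∈ P ∧ A y' = y ∧ A z' = z ∧
      (y' + z' ∈ interior P → y + z ∈ interior P) := by
  obtain ⟨c, hc, hnormal⟩ := h.pair.normal
  obtain ⟨R, hR⟩ := (Metric.isBounded_range_of_tendsto k d.tendsto_k).exists_norm_le
  have hm : ∀ n, k n - gi n y - gi n z ∈ P := fun n => by
    rw [← d.gi_apply, ← map_sub, ← map_sub]; exact h.map _ (d.gi_mem n) _ (hle n)
  have hyP : ∀ n, gi n y ∈ P := fun n => h.map _ (d.gi_mem n) _ hy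
  have hzP : ∀ n, gi n z ∈ P := fun n => h.map _ (d.gi_mem n) _ hz
  have by' : ∀ n, ‖gi n y‖ ≤ c * R := fun n => by
    have := hnormal _ (hyP n) _ (h.pair.add_mem (hm n) (hzP n))
    rw [show gi n y + (k n - gi n y - gi n z + gi n z) = k n by abel] at this
    exact this.trans (mul_le_mul_of_nonneg_left (hR _ ⟨n, rfl⟩) hc.le)
  have bz : ∀ n, ‖gi n z‖ ≤ c * R := fun n => by
    have := hnormal _ (hzP n) _ (h.pair.add_mem (hm n) (hyP n))
    rw [show gi n z + (k n - gi n y - gi n z + gi n y) = k n by abel] at this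
    exact this.trans (mul_le_mul_of_nonneg_left (hR _ ⟨n, rfl⟩) hc.le)
  obtain ⟨⟨y', z'⟩, -, ψ, hψ, hlim⟩ :=
    ((isCompact_closedBall (0 : E) (c * R)).prod (isCompact_closedBall (0 : E) (c * R))
      ).tendsto_subseq (x := fun n => (gi n y, gi n z)) fun n =>
        ⟨by simpa using by' n, by simpa using bz n⟩
  have hly : Tendsto (fun n => gi (ψ n) y) atTop (𝓝 y') := (continuous_fst.tendsto _).comp hlim
  have hlz : Tendsto (fun n => gi (ψ n) z) atTop (𝓝 z') := (continuous_snd.tendsto _).comp hlim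
  have hlk := d.tendsto_k.comp hψ.tendsto_atTop
  have hlg := d.tendsto_g.comp hψ.tendsto_atTop
  refine ⟨y', h.pair.isClosed.mem_of_tendsto hly (Eventually.of_forall fun n => hyP _),
    z', h.pair.isClosed.mem_of_tendsto hlz (Eventually.of_forall fun n => hzP _),
    h.pair.isClosed.mem_of_tendsto ((hlk.sub hly).sub hlz) (Eventually.of_forall fun n => hm _),
    ?_, ?_, fun hint => ?_⟩
  · refine tendsto_nhds_unique (tendsto_clm_apply hlg hly) (tendsto_const_nhds.congr fun n => ?_)
    exact (apply_apply_of_mul_eq_one (d.mul_inv _) _).symm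
  · refine tendsto_nhds_unique (tendsto_clm_apply hlg hlz) (tendsto_const_nhds.congr fun n => ?_)
    exact (apply_apply_of_mul_eq_one (d.mul_inv _) _).symm
  · obtain ⟨n, hn⟩ := ((hly.add hlz).eventually (isOpen_interior.mem_nhds hint)).exists
    have := h.map_interior (d.g_mem (ψ n)) hn
    rwa [← map_add, apply_apply_of_mul_eq_one (d.mul_inv _)] at this

theorem exists_preimage (d : Degeneration P G x x₀ g gi k A k₀)
    (h : QuasiHomogeneous P Q G) {y : E} (hy : y ∈ P) (hle : ∀ n, x n - y ∈ P) :
    ∃ y' ∈ P, k₀ - y' ∈ P ∧ A y' = y := by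
  obtain ⟨y', hy', z', hz', hle', h1, -⟩ :=
    d.exists_preimage_pair h hy h.pair.zero_mem (by simpa using hle)
  refine ⟨y', hy', ?_, h1⟩
  simpa using h.pair.add_mem hle' hz'

/-- A dual vector with bounded orbit under the inverses lies in the image of the adjoint. -/
theorem exists_adjoint_preimage (d : Degeneration P G x x₀ g gi k A k₀) {f : E} {R : ℝ}
    {S : Set E} (hS : IsClosed S) (hfS : ∀ n, adjoint (gi n) f ∈ S)
    (hb : ∀ n, ‖adjoint (gi n) f‖ ≤ R) : ∃ f' ∈ S, adjoint A f' = f := by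
  obtain ⟨f', -, ψ, hψ, hlim⟩ :=
    (isCompact_closedBall (0 : E) R).tendsto_subseq (x := fun n => adjoint (gi n) f)
      fun n => by simpa using hb n
  have hlg : Tendsto (fun n => adjoint (g (ψ n))) atTop (𝓝 (adjoint A)) :=
    (adjoint.continuous.tendsto A).comp (d.tendsto_g.comp hψ.tendsto_atTop)
  refine ⟨f', hS.mem_of_tendsto hlim (Eventually.of_forall fun n => hfS _), ?_⟩
  refine tendsto_nhds_unique (tendsto_clm_apply hlg hlim) (tendsto_const_nhds.congr fun n => ?_)
  exact (adjoint_apply_adjoint_apply (d.inv_mul _) f).symm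

end Degeneration

end

section

/-- The cone `P` is the sum of the ray through `p` and its intersection with the kernel of `φ`. -/
def Splits (P Q : Set E) : Prop :=
  ∃ p ∈ P, ∃ φ ∈ Q, ⟪φ, p⟫_ℝ = 1 ∧ ∀ c ∈ P, c - ⟪φ, c⟫_ℝ • p ∈ P

/-- The cone `P` is strictly convex. -/
def StrictCone (P : Set E) : Prop :=
  ∀ u ∈ P, ∀ v ∈ P, (∀ a b : ℝ, a • u + b • v = 0 → a = 0 ∧ b = 0) → u + v ∈ interior P

theorem mem_orthogonal_line {p f : E} : f ∈ (ℝ ∙ p)ᗮ ↔ ⟪p, f⟫_ℝ = 0 :=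
  Submodule.mem_orthogonal_singleton_iff_inner_right

theorem Splits.symm {P Q : Set E} (h : DualPair P Q) (hs : Splits P Q) : Splits Q P := by
  obtain ⟨p, hp, φ, hφ, h1, hc⟩ := hs
  refine ⟨φ, hφ, p, hp, by rw [real_inner_comm, h1], fun q hq => ?_⟩
  rw [h.mem_right]
  intro c hcP
  have := h.inner_nonneg hq (hc c hcP)
  rw [inner_sub_right, inner_smul_right] at this ⊢
  rw [real_inner_comm q c, real_inner_comm q p, real_inner_comm φ c]
  linarith

theorem DualPair.exists_ray_exit {P Q : Set E} (h : DualPair P Q) {p c : E} (hp : p ∈ P)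
    (hp0 : p ≠ 0) (hc : c ∈ interior P) :
    ∃ s : ℝ, 0 < s ∧ c - s • p ∈ P ∧ c - s • p ∉ interior P ∧
      ∀ t : ℝ, 0 < t → c - s • p + t • p ∈ interior P := by
  obtain ⟨e, he⟩ := h.int_right
  have hep : 0 < ⟪e, p⟫_ℝ := by rw [real_inner_comm]; exact h.symm.inner_pos he hp hp0
  set T : Set ℝ := {s | c - s • p ∈ P} with hT
  have hTc : IsClosed T := h.isClosed.preimage (by fun_prop)
  have hTb : BddAbove T := ⟨⟪e, c⟫_ℝ / ⟪e, p⟫_ℝ, fun s hs => by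
    have := h.inner_nonneg (interior_subset he) hs
    rw [inner_sub_right, inner_smul_right] at this
    rw [le_div_iff₀ hep]; linarith⟩
  obtain ⟨ε, hε, hm⟩ := h.exists_sub_smul_mem hc p
  have hmax := hTc.csSup_mem ⟨ε, hm⟩ hTb
  set s := sSup T with hs
  have hs0 : 0 < s := hε.trans_le (le_csSup hTb hm)
  refine ⟨s, hs0, hmax, fun hint => ?_, fun t ht => ?_⟩
  · obtain ⟨δ, hδ, hm'⟩ := h.exists_sub_smul_mem hint p
    have : s + δ ∈ T := by
      rw [hT, mem_ofPred_eq]; convert hm' using 1; module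
    linarith [le_csSup hTb this]
  · rcases lt_or_ge t s with hts | hts
    · have h1 := h.add_mem_interior (h.smul_mem_interior hc (div_pos ht hs0))
        (h.smul_mem hmax (t := 1 - t / s) (by rw [sub_nonneg, div_le_one hs0]; exact hts.le))
      convert h1 using 1
      have : t = t / s * s := by field_simp
      nth_rewrite 1 [this]
      module
    · have h1 := h.add_mem_interior hc (h.smul_mem hp (sub_nonneg.2 hts))
      convert h1 using 1
      module

variable [FiniteDimensional ℝ E]

theorem DualPair.exists_orthogonal_of_disjoint {P Q : Set E} (h : DualPair P Q)
    (V : Submodule ℝ E) (hV : ∀ v ∈ V, v ∉ interior P) :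
    ∃ φ ∈ Q, φ ≠ 0 ∧ ∀ v ∈ V, ⟪φ, v⟫_ℝ = 0 := by
  obtain ⟨f, u, h1, h2⟩ := geometric_hahn_banach_open h.convex.interior isOpen_interior V.convex
    (disjoint_left.2 fun x hx hxV => hV x hxV hx)
  obtain ⟨e, he⟩ := h.int_left
  have hu : u ≤ 0 := by simpa using h2 0 V.zero_mem
  have hfV : ∀ v ∈ V, f v = 0 := by
    intro v hv
    by_contra hne
    have := h2 (((u - 1) / f v) • v) (V.smul_mem _ hv)
    rw [map_smul, smul_eq_mul, div_mul_cancel₀ _ hne] at this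
    linarith
  set ψ := (InnerProductSpace.toDual ℝ E).symm f with hψ
  have hψf : ∀ x, ⟪ψ, x⟫_ℝ = f x := fun x => by
    rw [hψ, InnerProductSpace.toDual_symm_apply]
  have hneg : ∀ x ∈ interior P, ⟪ψ, x⟫_ℝ < 0 := fun x hx => by
    rw [hψf]; exact (h1 x hx).trans_le hu
  refine ⟨-ψ, ?_, fun h0 => ?_, fun v hv => by rw [inner_neg_left, hψf, hfV v hv, neg_zero]⟩
  · rw [h.mem_right]
    intro x hx
    by_contra! hlt
    rw [inner_neg_right, real_inner_comm, neg_lt_zero] at hlt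
    have he0 := hneg e he
    set t := ⟪ψ, x⟫_ℝ / -⟪ψ, e⟫_ℝ with ht
    have ht0 : 0 < t := div_pos hlt (neg_pos.2 he0)
    have h3 := hneg _ (h.add_mem_interior (h.smul_mem_interior he ht0) hx)
    rw [inner_add_right, inner_smul_right] at h3
    have : t * ⟪ψ, e⟫_ℝ = -⟪ψ, x⟫_ℝ := by
      have hne := he0.ne
      rw [ht]; field_simp
    linarith
  · have := hneg e he
    rw [neg_eq_zero.1 h0, inner_zero_left] at this
    exact lt_irrefl _ this

namespace QuasiHomogeneous

variable {P Q : Set E} {G : Set (E →L[ℝ] E)}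

/-- Near a boundary point pushed inside by an invariant ray, the degeneration kills the ray. -/
theorem exists_ray_degeneration (h : QuasiHomogeneous P Q G) {p x : E} (hp : p ∈ P) (hp0 : p ≠ 0)
    (hinv : ∀ g ∈ G, ∃ c : ℝ, g p = c • p) (hx' : x ∉ interior P)
    (hxp : ∀ t : ℝ, 0 < t → x + t • p ∈ interior P) :
    ∃ (t : ℕ → ℝ) (g gi : ℕ → E →L[ℝ] E) (k : ℕ → E) (A : E →L[ℝ] E) (k₀ : E),
      (∀ n, 0 < t n) ∧ Degeneration P G (fun n => x + t n • p) x g gi k A k₀ ∧ A p = 0 := by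
  have hlim : Tendsto (fun n : ℕ => x + (1 / ((n : ℝ) + 1)) • p) atTop (𝓝 x) := by
    have := (tendsto_one_div_add_atTop_nhds_zero_nat (𝕜 := ℝ)).smul_const p
    simpa using this.const_add x
  obtain ⟨φ, -, g, gi, k, A, k₀, d⟩ :=
    h.exists_degeneration (fun n : ℕ => hxp (1 / ((n : ℝ) + 1)) (by positivity)) hlim
  refine ⟨fun n => 1 / ((φ n : ℝ) + 1), g, gi, k, A, k₀, fun n => by positivity, d, ?_⟩
  have hmem : A p ∈ ℝ ∙ p := by
    refine d.map_submodule (fun g hg v hv => ?_) (Submodule.mem_span_singleton_self p)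
    obtain ⟨a, rfl⟩ := Submodule.mem_span_singleton.1 hv
    obtain ⟨c, hc⟩ := hinv g hg
    rw [map_smul, hc]
    exact Submodule.smul_mem _ _ (Submodule.smul_mem _ _ (Submodule.mem_span_singleton_self p))
  obtain ⟨χ, hχ⟩ := Submodule.mem_span_singleton.1 hmem
  rcases lt_trichotomy χ 0 with hneg | h0 | hpos
  · exfalso
    have h1 := h.pair.smul_mem (d.map p hp) (inv_pos.2 (neg_pos.2 hneg)).le
    rw [← hχ, smul_smul, inv_neg, neg_mul, inv_mul_cancel₀ hneg.ne, neg_one_smul] at h1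
    exact hp0 (h.pair.sharp hp h1)
  · rw [← hχ, h0, zero_smul]
  · exfalso
    obtain ⟨ε, hε, hm⟩ := h.pair.exists_sub_smul_mem d.k₀_mem p
    have h1 := d.map _ hm
    rw [map_sub, map_smul, d.apply_k₀, ← hχ, smul_smul] at h1
    have h2 := h.pair.smul_mem_interior
      (h.pair.add_mem_interior (hxp (ε * χ) (by positivity)) h1) (t := 1 / 2) (by norm_num)
    apply hx'
    convert h2 using 1
    module

/-- An invariant ray whose dual face is a facet of the dual cone splits off. -/
theorem splits_of_facet (h : QuasiHomogeneous P Q G) {p : E} (hp : p ∈ P) (hp0 : p ≠ 0)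
    (hinv : ∀ g ∈ G, ∃ c : ℝ, g p = c • p)
    (hN : Submodule.span ℝ (Q ∩ ((ℝ ∙ p)ᗮ : Submodule ℝ E)) = (ℝ ∙ p)ᗮ) : Splits P Q := by
  set W := (ℝ ∙ p)ᗮ with hW
  obtain ⟨c, hc⟩ := h.pair.int_left
  obtain ⟨s, hs, hxP, hxI, hxt⟩ := h.pair.exists_ray_exit hp hp0 hc
  set x := c - s • p with hx
  have hcx : c = x + s • p := by rw [hx]; abel
  obtain ⟨t, g, gi, k, A, k₀, ht, d, hAp⟩ := h.exists_ray_degeneration hp hp0 hinv hxI hxt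
  obtain ⟨δ, hδ, hco⟩ := h.pair.symm.coercive hc
  obtain ⟨R, hR⟩ := (Metric.isBounded_range_of_tendsto k d.tendsto_k).exists_norm_le
  have hsurj : ∀ f ∈ Q ∩ (W : Set E), ∃ f' ∈ Q ∩ (W : Set E), adjoint A f' = f := by
    rintro f ⟨hfQ, hfW⟩
    have hmem : ∀ n, adjoint (gi n) f ∈ Q ∩ (W : Set E) := fun n => by
      refine ⟨h.map_dual (d.gi_mem n) hfQ, mem_orthogonal_line.2 ?_⟩
      obtain ⟨a, ha⟩ := hinv _ (d.gi_mem n)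
      rw [adjoint_inner_right, ha, inner_smul_left, mem_orthogonal_line.1 hfW, mul_zero]
    refine d.exists_adjoint_preimage (R := R * ‖f‖ / δ)
      (h.pair.symm.isClosed.inter W.closed_of_finiteDimensional) hmem fun n => ?_
    rw [le_div_iff₀ hδ, mul_comm]
    refine (hco _ (hmem n).1).trans ?_
    have h0 := mem_orthogonal_line.1 (hmem n).2
    have h1 : ⟪c, adjoint (gi n) f⟫_ℝ = ⟪x + t n • p, adjoint (gi n) f⟫_ℝ := by
      rw [hcx, inner_add_left, inner_add_left, inner_smul_left, inner_smul_left, h0]; simp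
    rw [h1, adjoint_inner_right, d.gi_apply]
    exact (real_inner_le_norm _ _).trans
      (mul_le_mul_of_nonneg_right (hR _ ⟨n, rfl⟩) (norm_nonneg _))
  have hAW : ∀ q, adjoint A q ∈ W := fun q => by
    rw [hW, mem_orthogonal_line, adjoint_inner_right, hAp, inner_zero_left]
  have hinj : ∀ r ∈ W, ∀ r' ∈ W, adjoint A r = adjoint A r' → r = r' := by
    let L : W →ₗ[ℝ] W := (adjoint A).toLinearMap.restrict fun q _ => hAW q
    have hL : Function.Surjective L := by
      have hle : W ≤ W.map (adjoint A).toLinearMap := by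
        conv_lhs => rw [← hN]
        refine Submodule.span_le.2 fun f hf => ?_
        obtain ⟨f', hf', he⟩ := hsurj f hf
        exact ⟨f', hf'.2, he⟩
      rintro ⟨w, hw⟩
      obtain ⟨w', hw', he⟩ := hle hw
      exact ⟨⟨w', hw'⟩, Subtype.ext he⟩
    intro r hr r' hr' he
    have := LinearMap.injective_iff_surjective.2 hL
      (a₁ := ⟨r, hr⟩) (a₂ := ⟨r', hr'⟩) (Subtype.ext he)
    exact congrArg Subtype.val this
  obtain ⟨φ, hφ, hφ0, hφx⟩ := h.pair.exists_support hxP hxI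
  have hAφ : adjoint A φ = 0 := by
    refine h.pair.eq_zero_of_inner_eq_zero d.k₀_mem (d.map_dual h.pair hφ) ?_
    rw [adjoint_inner_left, d.apply_k₀, hφx]
  have hφp : 0 < ⟪φ, p⟫_ℝ := by
    have := h.pair.inner_pos hc hφ hφ0
    rw [hcx, inner_add_right, hφx, inner_smul_right, zero_add] at this
    exact (mul_pos_iff_of_pos_left hs).1 this
  set φ' := (⟪φ, p⟫_ℝ)⁻¹ • φ with hφ'
  have hφ'p : ⟪φ', p⟫_ℝ = 1 := by
    rw [hφ', inner_smul_left, conj_trivial, inv_mul_cancel₀ hφp.ne']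
  have hAφ' : adjoint A φ' = 0 := by rw [hφ', map_smul, hAφ, smul_zero]
  refine ⟨p, hp, φ', h.pair.symm.smul_mem hφ (inv_pos.2 hφp).le, hφ'p, fun y hy => ?_⟩
  rw [h.pair.mem_left]
  intro q hq
  obtain ⟨f', hf', he⟩ := hsurj (adjoint A q) ⟨d.map_dual h.pair hq, hAW q⟩
  have hr : q - ⟪q, p⟫_ℝ • φ' ∈ W := by
    rw [hW, mem_orthogonal_line, inner_sub_right, inner_smul_right, real_inner_comm φ' p, hφ'p,
      real_inner_comm q p]
    ring
  have hreq := hinj _ hr f' hf'.2 (by rw [map_sub, map_smul, hAφ', smul_zero, sub_zero, he])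
  have h1 := h.pair.inner_nonneg hf'.1 hy
  rw [← hreq, inner_sub_left, inner_smul_left, conj_trivial] at h1
  rw [inner_sub_right, inner_smul_right]
  linarith

end QuasiHomogeneous

end

section

theorem finrank_orthogonal_line {n : ℕ} (hE : Module.finrank ℝ E = n + 1) {p : E} (hp : p ≠ 0) :
    Module.finrank ℝ ((ℝ ∙ p)ᗮ : Submodule ℝ E) = n := by
  have : Fact (Module.finrank ℝ E = n + 1) := ⟨hE⟩
  exact Submodule.finrank_orthogonal_span_singleton hp

theorem span_inter_le (P : Set E) (W : Submodule ℝ E) : Submodule.span ℝ (P ∩ W) ≤ W :=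
  Submodule.span_le.2 fun _ hx => hx.2

theorem eq_smul_of_finrank_eq_one {V : Submodule ℝ E} (hV : Module.finrank ℝ V = 1) {v w : E}
    (hv : v ∈ V) (hv0 : v ≠ 0) (hw : w ∈ V) : ∃ c : ℝ, w = c • v := by
  obtain ⟨c, hc⟩ := (finrank_eq_one_iff_of_nonzero' (⟨v, hv⟩ : V) fun h0 =>
    hv0 (congrArg Subtype.val h0)).1 hV ⟨w, hw⟩
  exact ⟨c, (congrArg Subtype.val hc).symm⟩

theorem ConeBasis.exists_dual_left {S : Set E} {f₁ f₂ : E} (h : ConeBasis S f₁ f₂) :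
    ∃ v : E, ⟪f₁, v⟫_ℝ = 1 ∧ ⟪f₂, v⟫_ℝ = 0 := by
  have h2 : ⟪f₂, f₂⟫_ℝ ≠ 0 := (real_inner_self_pos.2 h.right_ne_zero).ne'
  set w := f₁ - (⟪f₁, f₂⟫_ℝ / ⟪f₂, f₂⟫_ℝ) • f₂ with hw
  have hw2 : ⟪f₂, w⟫_ℝ = 0 := by
    rw [hw, inner_sub_right, inner_smul_right, div_mul_cancel₀ _ h2, real_inner_comm, sub_self]
  have hw0 : w ≠ 0 := fun h0 => one_ne_zero (h.indep 1 (-(⟪f₁, f₂⟫_ℝ / ⟪f₂, f₂⟫_ℝ)) (by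
    rw [one_smul, neg_smul, ← sub_eq_add_neg]; exact h0)).1
  have hw1 : ⟪f₁, w⟫_ℝ = ⟪w, w⟫_ℝ := by
    nth_rewrite 2 [hw]
    rw [inner_sub_left, inner_smul_left, hw2, mul_zero, sub_zero]
  have hww : ⟪w, w⟫_ℝ ≠ 0 := (real_inner_self_pos.2 hw0).ne'
  refine ⟨(⟪w, w⟫_ℝ)⁻¹ • w, ?_, ?_⟩
  · rw [inner_smul_right, hw1, inv_mul_cancel₀ hww]
  · rw [inner_smul_right, hw2, mul_zero]

theorem DualPair.eq_of_inner_eq {P Q : Set E} (h : DualPair P Q) {x y : E}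
    (he : ∀ q ∈ Q, ⟪q, x⟫_ℝ = ⟪q, y⟫_ℝ) : x = y := by
  rw [← sub_eq_zero]
  refine h.sharp ?_ ?_ <;> rw [h.mem_left] <;> intro q hq
  · rw [inner_sub_right, he q hq, sub_self]
  · rw [neg_sub, inner_sub_right, he q hq, sub_self]

variable [FiniteDimensional ℝ E]

theorem span_inter_eq {P : Set E} {W : Submodule ℝ E}
    (h : Module.finrank ℝ W ≤ Module.finrank ℝ (Submodule.span ℝ (P ∩ W))) :
    Submodule.span ℝ (P ∩ W) = W :=
  Submodule.eq_of_le_of_finrank_le (span_inter_le P W) h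

theorem one_le_finrank_of_mem {V : Submodule ℝ E} {v : E} (hv : v ∈ V) (hv0 : v ≠ 0) :
    1 ≤ Module.finrank ℝ V := by
  have : Nontrivial V := ⟨⟨v, hv⟩, 0, fun h => hv0 (congrArg Subtype.val h)⟩
  exact Module.finrank_pos

namespace QuasiHomogeneous

variable {P Q : Set E} {G : Set (E →L[ℝ] E)}

theorem false_of_two_small_faces (h : QuasiHomogeneous P Q G) (hE : Module.finrank ℝ E = 4)
    {p f₁ f₂ : E} (hp : p ∈ P) (hp0 : p ≠ 0) (hinv : ∀ g ∈ G, ∃ c : ℝ, g p = c • p)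
    (hb : ConeBasis (Q ∩ ((ℝ ∙ p)ᗮ : Submodule ℝ E)) f₁ f₂)
    (hf₁ : ∀ g ∈ G, ∃ c : ℝ, adjoint g f₁ = c • f₁)
    (hf₂ : ∀ g ∈ G, ∃ c : ℝ, adjoint g f₂ = c • f₂)
    (h₁ : Module.finrank ℝ (Submodule.span ℝ (P ∩ ((ℝ ∙ f₁)ᗮ : Submodule ℝ E))) ≤ 2)
    (h₂ : Module.finrank ℝ (Submodule.span ℝ (P ∩ ((ℝ ∙ f₂)ᗮ : Submodule ℝ E))) ≤ 2) :
    False := by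
  set S₁ := Submodule.span ℝ (P ∩ ((ℝ ∙ f₁)ᗮ : Submodule ℝ E))
  set S₂ := Submodule.span ℝ (P ∩ ((ℝ ∙ f₂)ᗮ : Submodule ℝ E))
  obtain ⟨v₁, h11, h21⟩ := hb.exists_dual_left
  obtain ⟨v₂, h22, h12⟩ := hb.symm.exists_dual_left
  have hp₁ : p ∈ S₁ := Submodule.subset_span ⟨hp, mem_orthogonal_line.2 (by
    rw [real_inner_comm]; exact mem_orthogonal_line.1 hb.left_mem.2)⟩
  have hp₂ : p ∈ S₂ := Submodule.subset_span ⟨hp, mem_orthogonal_line.2 (by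
    rw [real_inner_comm]; exact mem_orthogonal_line.1 hb.right_mem.2)⟩
  have hker : ∀ f, (∀ g ∈ G, ∃ c : ℝ, adjoint g f = c • f) → ∀ g ∈ G,
      ∀ v ∈ ((ℝ ∙ f)ᗮ : Submodule ℝ E), g v ∈ ((ℝ ∙ f)ᗮ : Submodule ℝ E) := by
    intro f hf g hg v hv
    obtain ⟨c, hc⟩ := hf g hg
    rw [mem_orthogonal_line] at hv ⊢
    rw [← adjoint_inner_left, hc, inner_smul_left, hv, mul_zero]
  have hint : ∀ c ∈ interior P, c ∈ S₁ ⊔ S₂ := by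
    intro c hc
    obtain ⟨s, hs, hxP, hxI, hxt⟩ := h.pair.exists_ray_exit hp hp0 hc
    set x := c - s • p with hx
    have hcx : c = x + s • p := by rw [hx]; abel
    obtain ⟨t, g, gi, k, A, k₀, ht, d, hAp⟩ := h.exists_ray_degeneration hp hp0 hinv hxI hxt
    have hAN : ∀ q ∈ Q, ∃ a b : ℝ, 0 ≤ a ∧ 0 ≤ b ∧ adjoint A q = a • f₁ + b • f₂ := fun q hq =>
      hb.gen _ ⟨d.map_dual h.pair hq, mem_orthogonal_line.2 (by
        rw [adjoint_inner_right, hAp, inner_zero_left])⟩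
    have ha₁ : A v₁ ∈ P := by
      rw [h.pair.mem_left]
      intro q hq
      obtain ⟨a, b, ha, hb', he⟩ := hAN q hq
      rw [← adjoint_inner_left, he, inner_add_left, inner_smul_left, inner_smul_left, h11, h21]
      simpa using ha
    have ha₂ : A v₂ ∈ P := by
      rw [h.pair.mem_left]
      intro q hq
      obtain ⟨a, b, ha, hb', he⟩ := hAN q hq
      rw [← adjoint_inner_left, he, inner_add_left, inner_smul_left, inner_smul_left, h12, h22]
      simpa using hb'
    have hxe : x = ⟪f₁, k₀⟫_ℝ • A v₁ + ⟪f₂, k₀⟫_ℝ • A v₂ := by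
      refine h.pair.eq_of_inner_eq fun q hq => ?_
      obtain ⟨a, b, ha, hb', he⟩ := hAN q hq
      rw [inner_add_right, inner_smul_right, inner_smul_right, ← d.apply_k₀,
        ← adjoint_inner_left, ← adjoint_inner_left, ← adjoint_inner_left, he]
      simp only [inner_add_left, inner_smul_left, conj_trivial, h11, h12, h21, h22]
      ring
    have m₁ : A v₁ ∈ S₂ := Submodule.subset_span ⟨ha₁,
      d.map_submodule (hker f₂ hf₂) (mem_orthogonal_line.2 h21)⟩
    have m₂ : A v₂ ∈ S₁ := Submodule.subset_span ⟨ha₂,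
      d.map_submodule (hker f₁ hf₁) (mem_orthogonal_line.2 h12)⟩
    rw [hcx, hxe]
    exact Submodule.add_mem _ (Submodule.add_mem _
      (Submodule.mem_sup_right (Submodule.smul_mem _ _ m₁))
      (Submodule.mem_sup_left (Submodule.smul_mem _ _ m₂)))
      (Submodule.mem_sup_left (Submodule.smul_mem _ _ hp₁))
  have htop : S₁ ⊔ S₂ = ⊤ := by
    rw [eq_top_iff, ← h.pair.span_eq_top]
    exact Submodule.span_le.2 hint
  have hdim := Submodule.finrank_sup_add_finrank_inf_eq S₁ S₂
  rw [htop, finrank_top, hE] at hdim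
  have := one_le_finrank_of_mem (Submodule.mem_inf.2 ⟨hp₁, hp₂⟩) hp0
  omega

/-- An invariant ray whose dual face is two-dimensional forces a splitting. -/
theorem splits_of_finrank_eq_two (h : QuasiHomogeneous P Q G) (hE : Module.finrank ℝ E = 4)
    {p : E} (hp : p ∈ P) (hp0 : p ≠ 0) (hinv : ∀ g ∈ G, ∃ c : ℝ, g p = c • p)
    (hN : Module.finrank ℝ (Submodule.span ℝ (Q ∩ ((ℝ ∙ p)ᗮ : Submodule ℝ E))) = 2) :
    Splits P Q := by
  have : Nontrivial E := ⟨p, 0, hp0⟩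
  obtain ⟨f₁, f₂, hb⟩ := h.pair.symm.exists_coneBasis _ hN
  have hmap : ∀ g ∈ {g | adjoint g ∈ G}, ∀ f ∈ Q ∩ (((ℝ ∙ p)ᗮ : Submodule ℝ E) : Set E),
      g f ∈ Q ∩ (((ℝ ∙ p)ᗮ : Submodule ℝ E) : Set E) := by
    rintro g hg f ⟨hf, hfp⟩
    refine ⟨h.symm.map g hg f hf, mem_orthogonal_line.2 ?_⟩
    obtain ⟨c, hc⟩ := hinv _ hg
    rw [← adjoint_inner_left, hc, inner_smul_left, mem_orthogonal_line.1 hfp, mul_zero]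
  have h' := h.symm.of_permutes hb.left_ne_zero fun g hg => by
    obtain ⟨k, hk, h1, h2⟩ := h.symm.exists_inv g hg
    exact hb.permutes h2 (hmap g hg) (hmap k hk)
  set G' := {g : E →L[ℝ] E | g ∈ {g | adjoint g ∈ G} ∧ ∃ c : ℝ, g f₁ = c • f₁} with hG'
  have hf₂ : ∀ g ∈ G', ∃ c : ℝ, g f₂ = c • f₂ := by
    rintro g ⟨hg, c, hc⟩
    obtain ⟨k, hk, h1, h2⟩ := h.symm.exists_inv g hg
    exact hb.permutes_right h2 (hmap g hg) (hmap k hk) hc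
  have hf₁ : ∀ g ∈ G', ∃ c : ℝ, g f₁ = c • f₁ := fun g hg => hg.2
  have hfacet : ∀ f ∈ Q, f ≠ 0 → (∀ g ∈ G', ∃ c : ℝ, g f = c • f) →
      ¬ Module.finrank ℝ (Submodule.span ℝ (P ∩ ((ℝ ∙ f)ᗮ : Submodule ℝ E))) ≤ 2 →
      Splits P Q := by
    intro f hf hf0 hfi hd
    refine (h'.splits_of_facet hf hf0 hfi (span_inter_eq ?_)).symm h'.pair
    rw [finrank_orthogonal_line hE hf0]
    omega
  by_cases h₁ : Module.finrank ℝ (Submodule.span ℝ (P ∩ ((ℝ ∙ f₁)ᗮ : Submodule ℝ E))) ≤ 2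
  swap
  · exact hfacet f₁ hb.left_mem.1 hb.left_ne_zero hf₁ h₁
  by_cases h₂ : Module.finrank ℝ (Submodule.span ℝ (P ∩ ((ℝ ∙ f₂)ᗮ : Submodule ℝ E))) ≤ 2
  swap
  · exact hfacet f₂ hb.right_mem.1 hb.right_ne_zero hf₂ h₂
  refine (h'.symm.false_of_two_small_faces hE hp hp0 (fun g hg => ?_) hb (fun g hg => hf₁ _ hg)
    (fun g hg => hf₂ _ hg) h₁ h₂).elim
  refine hinv g ?_
  have := hg.1
  rwa [mem_ofPred_eq, ContinuousLinearMap.adjoint_adjoint] at this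

/-- An invariant boundary ray forces the cone to split or to be strictly convex. -/
theorem splits_or_strict (h : QuasiHomogeneous P Q G) (hE : Module.finrank ℝ E = 4)
    {p : E} (hp : p ∈ P) (hp0 : p ≠ 0) (hpI : p ∉ interior P)
    (hinv : ∀ g ∈ G, ∃ c : ℝ, g p = c • p) : Splits P Q ∨ StrictCone P := by
  have : Nontrivial E := ⟨p, 0, hp0⟩
  obtain ⟨f, hf, hf0, hfp⟩ := h.pair.exists_support hp hpI
  have hfW : f ∈ (ℝ ∙ p)ᗮ := mem_orthogonal_line.2 (by rw [real_inner_comm, hfp])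
  have hfS := Submodule.subset_span (R := ℝ) (s := Q ∩ ((ℝ ∙ p)ᗮ : Submodule ℝ E)) ⟨hf, hfW⟩
  have ha1 := one_le_finrank_of_mem hfS hf0
  have ha3 := Submodule.finrank_mono (span_inter_le Q (ℝ ∙ p)ᗮ)
  rw [finrank_orthogonal_line hE hp0] at ha3
  have hpW : p ∈ (ℝ ∙ f)ᗮ := mem_orthogonal_line.2 hfp
  have hpS := Submodule.subset_span (R := ℝ) (s := P ∩ ((ℝ ∙ f)ᗮ : Submodule ℝ E)) ⟨hp, hpW⟩
  have hb1 := one_le_finrank_of_mem hpS hp0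
  have hb3 := Submodule.finrank_mono (span_inter_le P (ℝ ∙ f)ᗮ)
  rw [finrank_orthogonal_line hE hf0] at hb3
  obtain hN | hN | hN : Module.finrank ℝ
      (Submodule.span ℝ (Q ∩ ((ℝ ∙ p)ᗮ : Submodule ℝ E))) = 1 ∨ Module.finrank ℝ
      (Submodule.span ℝ (Q ∩ ((ℝ ∙ p)ᗮ : Submodule ℝ E))) = 2 ∨ Module.finrank ℝ
      (Submodule.span ℝ (Q ∩ ((ℝ ∙ p)ᗮ : Submodule ℝ E))) = 3 := by omega
  · have hline : ∀ q ∈ Q, ⟪p, q⟫_ℝ = 0 → ∃ c : ℝ, q = c • f := fun q hq hqp =>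
      eq_smul_of_finrank_eq_one hN hfS hf0
        (Submodule.subset_span ⟨hq, mem_orthogonal_line.2 hqp⟩)
    have hfinv : ∀ g ∈ {g | adjoint g ∈ G}, ∃ c : ℝ, g f = c • f := by
      intro g hg
      refine hline _ (h.symm.map g hg f hf) ?_
      obtain ⟨c, hc⟩ := hinv _ hg
      rw [← adjoint_inner_left, hc, inner_smul_left, real_inner_comm, hfp, mul_zero]
    obtain hM | hM | hM : Module.finrank ℝ
        (Submodule.span ℝ (P ∩ ((ℝ ∙ f)ᗮ : Submodule ℝ E))) = 1 ∨ Module.finrank ℝ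
        (Submodule.span ℝ (P ∩ ((ℝ ∙ f)ᗮ : Submodule ℝ E))) = 2 ∨ Module.finrank ℝ
        (Submodule.span ℝ (P ∩ ((ℝ ∙ f)ᗮ : Submodule ℝ E))) = 3 := by omega
    · right
      intro u hu v hv hind
      by_contra hI
      set x := u + v with hx
      have hxP : x ∈ P := h.pair.add_mem hu hv
      have hu0 := h.pair.inner_nonneg hf hu
      have hv0 := h.pair.inner_nonneg hf hv
      rcases eq_or_lt_of_le (h.pair.inner_nonneg hf hxP) with h0 | hpos
      · rw [hx, inner_add_right] at h0
        have hun : u ≠ 0 := by rintro rfl; simpa using hind 1 0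
        obtain ⟨c, hc⟩ := eq_smul_of_finrank_eq_one hM
          (Submodule.subset_span ⟨hu, mem_orthogonal_line.2 (by linarith)⟩) hun
          (Submodule.subset_span ⟨hv, mem_orthogonal_line.2 (by linarith)⟩)
        exact one_ne_zero (neg_eq_zero.1 (hind c (-1) (by rw [hc]; module)).2)
      · have hxt : ∀ t : ℝ, 0 < t → x + t • p ∈ interior P := by
          intro t ht
          refine h.pair.mem_interior_of_inner_pos fun q hq hq0 => ?_
          have q1 := h.pair.inner_nonneg hq hxP
          have q2 := h.pair.inner_nonneg hq hp
          rw [inner_add_right, inner_smul_right]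
          rcases eq_or_lt_of_le q2 with q3 | q3
          · obtain ⟨c, rfl⟩ := hline q hq (by rw [real_inner_comm, ← q3])
            have hc0 : c ≠ 0 := by rintro rfl; simp at hq0
            rw [inner_smul_left, conj_trivial] at q1 ⊢
            have : 0 < c * ⟪f, x⟫_ℝ :=
              lt_of_le_of_ne q1 (mul_ne_zero hc0 hpos.ne').symm
            rw [← q3]; linarith
          · have := mul_pos ht q3
            linarith
        obtain ⟨t, g, gi, k, A, k₀, ht, d, hAp⟩ := h.exists_ray_degeneration hp hp0 hinv hI hxt
        have hfk := h.pair.inner_pos d.k₀_mem hf hf0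
        obtain ⟨u', -, -, hu'⟩ := d.exists_preimage h hu fun n => by
          rw [hx, show u + v + t n • p - u = v + t n • p by abel]
          exact h.pair.add_mem hv (h.pair.smul_mem hp (ht n).le)
        have hux : ⟪f, k₀⟫_ℝ • u = ⟪f, u'⟫_ℝ • x := by
          refine h.pair.eq_of_inner_eq fun q hq => ?_
          obtain ⟨c, hc⟩ := hline (adjoint A q) (d.map_dual h.pair hq) (by
            rw [adjoint_inner_right, hAp, inner_zero_left])
          rw [inner_smul_right, inner_smul_right, ← hu', ← d.apply_k₀, ← adjoint_inner_left,
            ← adjoint_inner_left, hc, inner_smul_left, inner_smul_left]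
          ring
        have h2 := hind (⟪f, k₀⟫_ℝ - ⟪f, u'⟫_ℝ) (-⟪f, u'⟫_ℝ) (by
          rw [sub_smul, hux, hx]; module)
        have h3 : ⟪f, u'⟫_ℝ = 0 := neg_eq_zero.1 h2.2
        have h4 := h2.1
        rw [h3, sub_zero] at h4
        exact hfk.ne' h4
    · exact Or.inl ((h.symm.splits_of_finrank_eq_two hE hf hf0 hfinv hM).symm h.pair.symm)
    · refine Or.inl ((h.symm.splits_of_facet hf hf0 hfinv (span_inter_eq ?_)).symm h.pair.symm)
      rw [finrank_orthogonal_line hE hf0, hM]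
  · exact Or.inl (h.splits_of_finrank_eq_two hE hp hp0 hinv hN)
  · refine Or.inl (h.splits_of_facet hp hp0 hinv (span_inter_eq ?_))
    rw [finrank_orthogonal_line hE hp0, hN]

/-- An invariant subspace meeting the interior of the cone is the whole space. -/
theorem eq_top_of_mem_interior (h : QuasiHomogeneous P Q G) {V : Submodule ℝ E}
    (hV : ∀ g ∈ G, ∀ v ∈ V, g v ∈ V) {v : E} (hv : v ∈ V) (hvI : v ∈ interior P) : V = ⊤ := by
  by_contra hne
  obtain ⟨φ, hφ, hφ0⟩ : ∃ φ ∈ Vᗮ, φ ≠ 0 := by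
    by_contra! hcon
    exact hne (Submodule.orthogonal_eq_bot_iff.1 ((Submodule.eq_bot_iff _).2 hcon))
  have hφV : ∀ w ∈ V, ⟪φ, w⟫_ℝ = 0 := fun w hw => by
    rw [real_inner_comm]; exact (Submodule.mem_orthogonal _ _).1 hφ w hw
  obtain ⟨f₀, hf₀⟩ := h.pair.int_right
  have hfpos : ∀ x ∈ P, x ≠ 0 → 0 < ⟪f₀, x⟫_ℝ := fun x hx hx0 => by
    rw [real_inner_comm]; exact h.pair.symm.inner_pos hf₀ hx hx0
  have : Nontrivial E := ⟨φ, 0, hφ0⟩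
  have hnorm : ∀ x ∈ P, x ≠ 0 → (⟪f₀, x⟫_ℝ)⁻¹ • x ∈ {x | x ∈ P ∧ ⟪f₀, x⟫_ℝ = 1} :=
    fun x hx hx0 => ⟨h.pair.smul_mem hx (inv_pos.2 (hfpos x hx hx0)).le, by
      rw [inner_smul_right, inv_mul_cancel₀ (hfpos x hx hx0).ne']⟩
  obtain ⟨z, hz, hz0⟩ := h.pair.exists_nonzero_mem_interior
  obtain ⟨p, ⟨hp, hp1⟩, hmax⟩ := (h.pair.isCompact_slice hf₀ 1).exists_isMaxOn
    ⟨_, hnorm z (interior_subset hz) hz0⟩ (f := fun x => ⟪φ, x⟫_ℝ) (by fun_prop)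
  set m := ⟪φ, p⟫_ℝ with hm
  have hle : ∀ x ∈ P, ⟪φ, x⟫_ℝ ≤ m * ⟪f₀, x⟫_ℝ := by
    intro x hx
    rcases eq_or_ne x 0 with rfl | hx0
    · simp
    have := hmax (hnorm x hx hx0)
    simp only [inner_smul_right, mem_ofPred_eq] at this
    rwa [inv_mul_le_iff₀ (hfpos x hx hx0), mul_comm] at this
  have hm0 : m ≠ 0 := by
    intro h0
    have hneg : -φ ∈ Q := by
      rw [h.pair.mem_right]
      intro x hx
      have := hle x hx
      rw [h0, zero_mul] at this
      rw [inner_neg_right, real_inner_comm]; linarith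
    have := h.pair.eq_zero_of_inner_eq_zero hvI hneg (by rw [inner_neg_left, hφV v hv, neg_zero])
    exact hφ0 (neg_eq_zero.1 this)
  have hp0 : p ≠ 0 := by rintro rfl; simp at hp1
  have hlim : Tendsto (fun n : ℕ => p + (1 / ((n : ℝ) + 1)) • v) atTop (𝓝 p) := by
    have := (tendsto_one_div_add_atTop_nhds_zero_nat (𝕜 := ℝ)).smul_const v
    simpa using this.const_add p
  obtain ⟨ψ, -, g, gi, k, A, k₀, d⟩ := h.exists_degeneration (fun n : ℕ => by
    rw [add_comm]
    exact h.pair.add_mem_interior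
      (h.pair.smul_mem_interior hvI (t := 1 / ((n : ℝ) + 1)) (by positivity)) hp) hlim
  have hAv : A v ∈ P := d.map v (interior_subset hvI)
  have hAV : A v ∈ V := d.map_submodule hV hv
  obtain ⟨ε, hε, hm1⟩ := h.pair.exists_sub_smul_mem d.k₀_mem v
  have h1 := d.map _ hm1
  rw [map_sub, map_smul, d.apply_k₀] at h1
  have h2 := hle _ h1
  rw [inner_sub_right, inner_sub_right, inner_smul_right, inner_smul_right, hφV _ hAV, hp1,
    ← hm] at h2
  have h3 := hle _ hAv
  rw [hφV _ hAV] at h3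
  have h4 : m * ⟪f₀, A v⟫_ℝ = 0 := by nlinarith
  have h5 : A v = 0 := by
    by_contra hne0
    exact (hfpos _ hAv hne0).ne' ((mul_eq_zero.1 h4).resolve_left hm0)
  obtain ⟨δ, hδ, hm2⟩ := h.pair.exists_sub_smul_mem hvI k₀
  have h6 := d.map _ hm2
  rw [map_sub, map_smul, d.apply_k₀, h5, zero_sub, ← smul_neg] at h6
  exact hp0 (h.pair.sharp hp (h.pair.mem_of_smul_mem hδ h6))

/-- A group acting cocompactly on a four-dimensional cone that neither splits nor is strictly
convex is irreducible. -/
theorem irreducible (h : QuasiHomogeneous P Q G) (hE : Module.finrank ℝ E = 4)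
    (hsplit : ¬ Splits P Q) (hstrict : ¬ StrictCone P) {V : Submodule ℝ E}
    (hV : ∀ g ∈ G, ∀ v ∈ V, g v ∈ V) : V = ⊥ ∨ V = ⊤ := by
  have : Nontrivial E := Module.nontrivial_of_finrank_pos (R := ℝ) (by omega)
  by_contra! hcon
  obtain ⟨hbot, htop⟩ := hcon
  have hVI : ∀ v ∈ V, v ∉ interior P := fun v hv hvI => htop (h.eq_top_of_mem_interior hV hv hvI)
  obtain ⟨p, hp, hp0⟩ : ∃ p ∈ P ∩ V, p ≠ 0 := by
    by_contra! hcon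
    have h1 : ∃ w ∈ Vᗮ, w ∈ interior Q := by
      by_contra! hcon2
      obtain ⟨x, hx, hx0, hxV⟩ := h.pair.symm.exists_orthogonal_of_disjoint Vᗮ hcon2
      refine hx0 (hcon x ⟨hx, ?_⟩)
      rw [← Submodule.orthogonal_orthogonal V]
      exact (Submodule.mem_orthogonal' _ _).2 hxV
    obtain ⟨w, hw, hwI⟩ := h1
    have h2 := h.symm.eq_top_of_mem_interior (V := Vᗮ) (fun g hg y hy => by
      rw [Submodule.mem_orthogonal] at hy ⊢
      intro u hu
      rw [← adjoint_inner_left]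
      exact hy _ (hV _ hg u hu)) hw hwI
    exact hbot ((Submodule.orthogonal_eq_top_iff _).1 h2)
  set V' := Submodule.span ℝ (P ∩ (V : Set E)) with hV'
  have hV'V : V' ≤ V := span_inter_le P V
  have hpV' : p ∈ V' := Submodule.subset_span hp
  have hmap : ∀ g ∈ G, ∀ x ∈ P ∩ (V : Set E), g x ∈ P ∩ (V : Set E) := fun g hg x hx =>
    ⟨h.map g hg x hx.1, hV g hg x hx.2⟩
  have hinv : ∀ g ∈ G, ∀ v ∈ V', g v ∈ V' := by
    intro g hg v hv
    have : V' ≤ V'.comap g.toLinearMap :=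
      Submodule.span_le.2 fun x hx => Submodule.subset_span (hmap g hg x hx)
    exact this hv
  have h1 := one_le_finrank_of_mem hpV' hp0
  have h4 : Module.finrank ℝ V' < 4 := by
    rw [← hE]
    exact Submodule.finrank_lt (lt_of_le_of_lt hV'V (lt_top_iff_ne_top.2 htop)).ne
  obtain hd | hd | hd : Module.finrank ℝ V' = 1 ∨ Module.finrank ℝ V' = 2 ∨
    Module.finrank ℝ V' = 3 := by omega
  · refine (h.splits_or_strict hE hp.1 hp0 (hVI p hp.2) fun g hg => ?_).elim hsplit hstrict
    exact eq_smul_of_finrank_eq_one hd hpV' hp0 (hinv g hg p hpV')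
  · obtain ⟨p₁, p₂, hb⟩ := h.pair.exists_coneBasis V hd
    have h' := h.of_permutes hb.left_ne_zero fun g hg => by
      obtain ⟨k, hk, h1, h2⟩ := h.exists_inv g hg
      exact hb.permutes h2 (hmap g hg) (hmap k hk)
    exact (h'.splits_or_strict hE hb.left_mem.1 hb.left_ne_zero (hVI _ hb.left_mem.2)
      fun g hg => hg.2).elim hsplit hstrict
  · obtain ⟨φ, hφ, hφ0, hφV⟩ := h.pair.exists_orthogonal_of_disjoint V hVI
    have hle : V' ≤ (ℝ ∙ φ)ᗮ := fun v hv => mem_orthogonal_line.2 (hφV v (hV'V hv))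
    have hφeq : V' = (ℝ ∙ φ)ᗮ :=
      Submodule.eq_of_le_of_finrank_le hle (by rw [finrank_orthogonal_line hE hφ0, hd])
    have hperp : ∀ y, (∀ v ∈ V', ⟪y, v⟫_ℝ = 0) → ∃ c : ℝ, y = c • φ := by
      intro y hy
      have : y ∈ (ℝ ∙ φ)ᗮᗮ := by
        rw [← hφeq]; exact (Submodule.mem_orthogonal' _ _).2 hy
      rw [Submodule.orthogonal_orthogonal] at this
      obtain ⟨c, hc⟩ := Submodule.mem_span_singleton.1 this
      exact ⟨c, hc.symm⟩
    refine hsplit ((h.symm.splits_of_facet hφ hφ0 (fun g hg => hperp _ fun v hv => ?_) ?_).symm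
      h.pair.symm)
    · rw [real_inner_comm, ← adjoint_inner_left, real_inner_comm]
      exact hφV _ (hV'V (hinv _ hg v hv))
    · refine le_antisymm (span_inter_le _ _) ?_
      conv_lhs => rw [← hφeq]
      exact Submodule.span_mono fun x hx => ⟨hx.1, hle (Submodule.subset_span hx)⟩

end QuasiHomogeneous

end

section

/-- The endomorphisms which are infinitesimally tangent to every face: `⟪f, X x⟫ = 0` whenever
`x ∈ P` and `f ∈ Q` are incident. -/
def incidence (P Q : Set E) : Submodule ℝ (E →L[ℝ] E) where
  carrier := {X | ∀ x ∈ P, ∀ f ∈ Q, ⟪f, x⟫_ℝ = 0 → ⟪f, X x⟫_ℝ = 0}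
  zero_mem' x _ f _ _ := by simp
  add_mem' {X Y} hX hY x hx f hf h0 := by
    rw [_root_.add_apply, inner_add_right, hX x hx f hf h0, hY x hx f hf h0, add_zero]
  smul_mem' c X hX x hx f hf h0 := by
    rw [_root_.smul_apply, inner_smul_right, hX x hx f hf h0, mul_zero]

theorem mem_incidence {P Q : Set E} {X : E →L[ℝ] E} :
    X ∈ incidence P Q ↔ ∀ x ∈ P, ∀ f ∈ Q, ⟪f, x⟫_ℝ = 0 → ⟪f, X x⟫_ℝ = 0 :=
  Iff.rfl

theorem isClosed_incidence (P Q : Set E) : IsClosed (incidence P Q : Set (E →L[ℝ] E)) := by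
  have : (incidence P Q : Set (E →L[ℝ] E)) =
      ⋂ x ∈ P, ⋂ f ∈ Q, ⋂ (_ : ⟪f, x⟫_ℝ = 0), {X : E →L[ℝ] E | ⟪f, X x⟫_ℝ = 0} := by
    ext X
    simp [mem_incidence]
  rw [this]
  refine isClosed_biInter fun x _ => isClosed_biInter fun f _ => isClosed_iInter fun _ => ?_
  exact isClosed_eq (continuous_const.inner (ContinuousLinearMap.apply ℝ E x).continuous)
    continuous_const

variable [FiniteDimensional ℝ E]

theorem adjoint_mul_apply (g k : E →L[ℝ] E) (f : E) :
    adjoint (g * k) f = adjoint k (adjoint g f) := by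
  refine ext_inner_right ℝ fun v => ?_
  simp only [adjoint_inner_left, mul_apply_eq_comp]

theorem adjoint_apply_ne_zero {g k : E →L[ℝ] E} (hgk : g * k = 1) {f : E} (hf : f ≠ 0) :
    adjoint g f ≠ 0 := by
  intro h0
  apply hf
  rw [← adjoint_apply_adjoint_apply hgk f, h0, map_zero]

theorem orthogonal_map_mem {g : E →L[ℝ] E} {U : Submodule ℝ E}
    (hU : ∀ v ∈ U, adjoint g v ∈ U) {v : E} (hv : v ∈ Uᗮ) : g v ∈ Uᗮ := by
  rw [Submodule.mem_orthogonal] at hv ⊢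
  intro u hu
  rw [← adjoint_inner_left]
  exact hv _ (hU u hu)

namespace QuasiHomogeneous

variable {P Q : Set E} {G : Set (E →L[ℝ] E)}

theorem conj_mem_incidence (h : QuasiHomogeneous P Q G) {g k : E →L[ℝ] E} (hg : g ∈ G)
    (hk : k ∈ G) (hgk : g * k = 1) {X : E →L[ℝ] E} (hX : X ∈ incidence P Q) :
    g * X * k ∈ incidence P Q := by
  intro x hx f hf h0
  rw [mul_apply_eq_comp, mul_apply_eq_comp, ← adjoint_inner_left]
  refine hX _ (h.map k hk x hx) _ (h.map_dual hg hf) ?_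
  rw [adjoint_inner_left, apply_apply_of_mul_eq_one hgk, h0]

theorem span_adjoint_orbit_eq_top (h : QuasiHomogeneous P Q G) (hE : Module.finrank ℝ E = 4)
    (hsplit : ¬ Splits P Q) (hstrict : ¬ StrictCone P) {f : E} (hf0 : f ≠ 0) :
    Submodule.span ℝ ((fun g : E →L[ℝ] E => adjoint g f) '' G) = ⊤ := by
  set U := Submodule.span ℝ ((fun g : E →L[ℝ] E => adjoint g f) '' G) with hU
  have hinv : ∀ g ∈ G, ∀ v ∈ U, adjoint g v ∈ U := by
    intro g hg v hv
    have : U ≤ U.comap (adjoint g).toLinearMap := by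
      refine Submodule.span_le.2 ?_
      rintro _ ⟨k, hk, rfl⟩
      refine Submodule.subset_span ⟨k * g, h.mul_mem k hk g hg, ?_⟩
      exact adjoint_mul_apply k g f
    exact this hv
  have hfU : f ∈ U := Submodule.subset_span ⟨1, h.one_mem, by
    refine ext_inner_right ℝ fun v => ?_
    simp only [adjoint_inner_left, one_apply_eq_self]⟩
  rcases h.irreducible hE hsplit hstrict (V := Uᗮ)
    (fun g hg v hv => orthogonal_map_mem (hinv g hg) hv) with hb | ht
  · exact (Submodule.orthogonal_eq_bot_iff).1 hb
  · rw [Submodule.orthogonal_eq_top_iff] at ht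
    rw [ht] at hfU
    exact absurd ((Submodule.mem_bot ℝ).1 hfU) hf0

/-- A common eigenvector of the transposed incidence algebra forces that algebra to consist of
scalars. -/
theorem incidence_scalar_of_eigenvector (h : QuasiHomogeneous P Q G)
    (hE : Module.finrank ℝ E = 4) (hsplit : ¬ Splits P Q) (hstrict : ¬ StrictCone P) {f : E}
    (hf0 : f ≠ 0) (hf : ∀ X ∈ incidence P Q, ∃ c : ℝ, adjoint X f = c • f) :
    ∀ X ∈ incidence P Q, ∃ c : ℝ, X = c • (1 : E →L[ℝ] E) := by
  have hweight : ∀ g ∈ G, ∀ X ∈ incidence P Q, ∃ c : ℝ,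
      adjoint X (adjoint g f) = c • adjoint g f := by
    intro g hg X hX
    obtain ⟨k, hk, hgk, hkg⟩ := h.exists_inv g hg
    obtain ⟨c, hc⟩ := hf _ (h.conj_mem_incidence hg hk hgk hX)
    refine ⟨c, ?_⟩
    rw [adjoint_mul_apply, adjoint_mul_apply] at hc
    have := congrArg (adjoint g) hc
    rw [adjoint_apply_adjoint_apply hkg, map_smul] at this
    exact this
  choose! w hw using hweight
  choose! l hl using hf
  obtain ⟨B, hBsub, hBspan, hBind⟩ :=
    exists_linearIndependent ℝ ((fun g : E →L[ℝ] E => adjoint g f) '' G)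
  rw [h.span_adjoint_orbit_eq_top hE hsplit hstrict hf0] at hBspan
  let b : Module.Basis B ℝ E := Module.Basis.mk hBind (by
    rw [Subtype.range_coe]
    exact hBspan.ge)
  have hbval : ∀ i : B, b i = (i : E) := fun i => by simp [b]
  have : Finite B := Module.Finite.finite_basis b
  have hcoord : ∀ g ∈ G, ∃ i : B, b.repr (adjoint g f) i ≠ 0 := by
    intro g hg
    obtain ⟨k, hk, hgk, hkg⟩ := h.exists_inv g hg
    by_contra! hcon
    refine adjoint_apply_ne_zero hgk hf0 (b.repr.map_eq_zero_iff.1 ?_)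
    ext i
    exact hcon i
  obtain ⟨i₀, -⟩ := hcoord 1 h.one_mem
  have hF : ∀ g, ∃ i : B, g ∈ G → b.repr (adjoint g f) i ≠ 0 := fun g => by
    by_cases hg : g ∈ G
    · obtain ⟨i, hi⟩ := hcoord g hg
      exact ⟨i, fun _ => hi⟩
    · exact ⟨i₀, fun h' => absurd h' hg⟩
  choose F hF using hF
  have hBw : ∀ i : B, ∃ c : (E →L[ℝ] E) → ℝ, ∀ X ∈ incidence P Q, adjoint X (b i) = c X • b i := by
    intro i
    obtain ⟨g, hg, hgi⟩ := hBsub i.2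
    refine ⟨w g, fun X hX => ?_⟩
    have := hw g hg X hX
    rw [hbval, ← hgi]
    exact this
  choose c hc using hBw
  have hwF : ∀ g ∈ G, ∀ X ∈ incidence P Q, w g X = c (F g) X := by
    intro g hg X hX
    have hlin : b.coord (F g) ∘ₗ (adjoint X).toLinearMap = c (F g) X • b.coord (F g) := by
      refine b.ext fun j => ?_
      simp only [LinearMap.comp_apply, ContinuousLinearMap.coe_coe, hc j X hX, map_smul,
        LinearMap.smul_apply, Module.Basis.coord_apply, Module.Basis.repr_self, smul_eq_mul]
      by_cases hj : j = F g
      · rw [hj]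
      · simp [Finsupp.single_eq_of_ne (Ne.symm hj)]
    have h1 := LinearMap.congr_fun hlin (adjoint g f)
    simp only [LinearMap.comp_apply, ContinuousLinearMap.coe_coe, hw g hg X hX, map_smul,
        LinearMap.smul_apply, Module.Basis.coord_apply, smul_eq_mul] at h1
    exact mul_right_cancel₀ (hF g hg) h1
  let U : Submodule ℝ E :=
    { carrier := {v | ∀ X ∈ incidence P Q, adjoint X v = l X • v}
      zero_mem' := fun X _ => by simp
      add_mem' := fun {u v} hu hv X hX => by rw [map_add, hu X hX, hv X hX, smul_add]
      smul_mem' := fun a v hv X hX => by rw [map_smul, hv X hX, smul_comm] }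
  have hmemU : ∀ v, v ∈ U ↔ ∀ X ∈ incidence P Q, adjoint X v = l X • v := fun v => Iff.rfl
  have hconj : ∀ g ∈ G, ∀ k ∈ G, g * k = 1 → k * g = 1 → adjoint g f ∈ U →
      ∀ X ∈ incidence P Q, l (g * X * k) = l X := by
    intro g hg k hk hgk hkg hgU X hX
    have h1 := hl _ (h.conj_mem_incidence hg hk hgk hX)
    rw [adjoint_mul_apply, adjoint_mul_apply, hgU X hX, map_smul,
      adjoint_apply_adjoint_apply hgk] at h1
    exact (smul_left_injective ℝ hf0 h1).symm
  have hUinv : ∀ g ∈ G, adjoint g f ∈ U → ∀ v ∈ U, adjoint g v ∈ U := by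
    intro g hg hgU v hv X hX
    obtain ⟨k, hk, hgk, hkg⟩ := h.exists_inv g hg
    have h1 := hv _ (h.conj_mem_incidence hg hk hgk hX)
    rw [adjoint_mul_apply, adjoint_mul_apply, hconj g hg k hk hgk hkg hgU X hX] at h1
    have := congrArg (adjoint g) h1
    rw [adjoint_apply_adjoint_apply hkg, map_smul] at this
    exact this
  have h1f : adjoint (1 : E →L[ℝ] E) f = f := by
    refine ext_inner_right ℝ fun v => ?_
    simp only [adjoint_inner_left, one_apply_eq_self]
  have h₀ : QuasiHomogeneous P Q {g | g ∈ G ∧ adjoint g f ∈ U} := by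
    refine h.of_finite_index (fun g hg => hg.1) ⟨h.one_mem, ?_⟩ ?_ ?_ F ?_
    · rw [h1f]
      exact hl
    · rintro g ⟨hg, hgU⟩ k ⟨hk, hkU⟩
      refine ⟨h.mul_mem g hg k hk, ?_⟩
      rw [adjoint_mul_apply]
      exact hUinv k hk hkU _ hgU
    · rintro g ⟨hg, hgU⟩ k hk hgk hkg
      refine ⟨hk, fun X hX => ?_⟩
      have h1 := hl _ (h.conj_mem_incidence hk hg hkg hX)
      have h2 := hconj g hg k hk hgk hkg hgU _ (h.conj_mem_incidence hk hg hkg hX)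
      have h3 : g * (k * X * g) * k = X := by
        calc g * (k * X * g) * k = (g * k) * X * (g * k) := by noncomm_ring
          _ = X := by rw [hgk, one_mul, mul_one]
      rw [h3] at h2
      rw [adjoint_mul_apply, adjoint_mul_apply, ← h2] at h1
      have := congrArg (adjoint k) h1
      rwa [adjoint_apply_adjoint_apply hgk, map_smul] at this
    · intro g hg s hs k hk hsk hks hFgs
      refine ⟨h.mul_mem g hg k hk, fun X hX => ?_⟩
      have hY := h.conj_mem_incidence hk hs hks hX
      have h1 : w s (k * X * s) = l X := by
        have h2 := hw s hs _ hY
        rw [adjoint_mul_apply, adjoint_mul_apply, adjoint_apply_adjoint_apply hsk, hl X hX,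
          map_smul] at h2
        exact (smul_left_injective ℝ (adjoint_apply_ne_zero hsk hf0) h2).symm
      have h2 := hw g hg _ hY
      rw [hwF g hg _ hY, hFgs, ← hwF s hs _ hY, h1, adjoint_mul_apply, adjoint_mul_apply] at h2
      have := congrArg (adjoint k) h2
      rw [adjoint_apply_adjoint_apply hsk, map_smul] at this
      rw [adjoint_mul_apply]
      exact this
  have htop : U = ⊤ := by
    rcases h₀.irreducible hE hsplit hstrict (V := Uᗮ)
      (fun g hg v hv => orthogonal_map_mem (hUinv g hg.1 hg.2) hv) with hb | ht
    · exact (Submodule.orthogonal_eq_bot_iff).1 hb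
    · rw [Submodule.orthogonal_eq_top_iff] at ht
      have hfU : f ∈ U := hl
      rw [ht] at hfU
      exact absurd ((Submodule.mem_bot ℝ).1 hfU) hf0
  intro X hX
  refine ⟨l X, ContinuousLinearMap.ext fun v => ext_inner_left ℝ fun u => ?_⟩
  have hu : u ∈ U := by rw [htop]; trivial
  rw [← adjoint_inner_left, hu X hX, _root_.smul_apply, one_apply_eq_self, inner_smul_left,
    inner_smul_right]
  rfl

end QuasiHomogeneous

end

section

theorem eq_zero_of_forall_affine_nonneg {a b : ℝ} (h : ∀ s : ℝ, 0 ≤ a + s * b) : b = 0 := by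
  by_contra hb
  have := h (-(a + 1) / b)
  rw [div_mul_cancel₀ _ hb] at this
  linarith

theorem eq_zero_of_forall_cubic_nonneg {a b c d : ℝ}
    (h : ∀ s : ℝ, 0 ≤ a + s * b + s ^ 2 * c + s ^ 3 * d) : d = 0 := by
  by_contra hd
  wlog hneg : d < 0 generalizing b d
  · refine this (b := -b) (d := -d) (fun s => ?_) (neg_ne_zero.2 hd) ?_
    · have := h (-s)
      linarith
    · exact neg_neg_of_pos (lt_of_le_of_ne (not_lt.1 hneg) (Ne.symm hd))
  open Polynomial in
  have hlim := Polynomial.tendsto_atBot_of_leadingCoeff_nonpos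
    (C d * X ^ 3 + C c * X ^ 2 + C b * X + C a) (by rw [degree_cubic hd]; norm_num)
    (by rw [leadingCoeff_cubic hd]; exact hneg.le)
  obtain ⟨s, hs⟩ := (hlim.eventually (eventually_lt_atBot 0)).exists
  simp only [Polynomial.eval_add, Polynomial.eval_mul, Polynomial.eval_C, Polynomial.eval_pow,
    Polynomial.eval_X] at hs
  linarith [h s]

theorem DualPair.map_of_map_interior {P Q : Set E} (h : DualPair P Q) {A : E →L[ℝ] E}
    (hA : ∀ x ∈ interior P, A x ∈ P) {x : E} (hx : x ∈ P) : A x ∈ P := by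
  have hcl : closure (interior P) = P := by
    rw [h.convex.closure_interior_eq_closure_of_nonempty_interior h.int_left,
      h.isClosed.closure_eq]
  have := map_mem_closure A.continuous (hcl.symm ▸ hx : x ∈ closure (interior P)) hA
  rwa [h.isClosed.closure_eq] at this

theorem DualPair.eq_zero_of_forall_add_smul_mem {P Q : Set E} (h : DualPair P Q) {x y : E}
    (hxy : ∀ s : ℝ, x + s • y ∈ P) : y = 0 := by
  refine h.eq_of_inner_eq fun q hq => ?_
  rw [inner_zero_right]
  refine eq_zero_of_forall_affine_nonneg (a := ⟪q, x⟫_ℝ) fun s => ?_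
  have := (h.mem_left _).1 (hxy s) q hq
  rwa [inner_add_right, inner_smul_right] at this

theorem exists_jordan_basis (hE : Module.finrank ℝ E = 4) {Y : E →L[ℝ] E}
    (hY3 : ∀ v, Y (Y (Y v)) = 0) {x : E} (hx : Y (Y x) ≠ 0) :
    ∃ w, Y w = 0 ∧ ∀ v, ∃ a b c d : ℝ, v = a • x + b • Y x + c • Y (Y x) + d • w := by
  have : FiniteDimensional ℝ E := Module.finite_of_finrank_pos (by omega)
  have hind : LinearIndependent ℝ ![x, Y x, Y (Y x)] := by
    rw [Fintype.linearIndependent_iff]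
    intro g hg
    replace hg : g 0 • x + g 1 • Y x + g 2 • Y (Y x) = 0 := by
      simpa [Fin.sum_univ_three] using hg
    have e2 := congrArg (fun v => Y (Y v)) hg
    simp only [map_add, map_smul, hY3, map_zero, smul_zero, add_zero] at e2
    have g0 := (smul_eq_zero.1 e2).resolve_right hx
    rw [g0, zero_smul, zero_add] at hg
    have e1 := congrArg Y hg
    simp only [map_add, map_smul, hY3, map_zero, smul_zero, add_zero] at e1
    have g1 := (smul_eq_zero.1 e1).resolve_right hx
    rw [g1, zero_smul, zero_add] at hg
    have g2 := (smul_eq_zero.1 hg).resolve_right hx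
    intro i
    fin_cases i
    · exact g0
    · exact g1
    · exact g2
  set W := Submodule.span ℝ (Set.range ![x, Y x, Y (Y x)]) with hW
  have hWd : Module.finrank ℝ W = 3 := by
    rw [hW, finrank_span_eq_card hind, Fintype.card_fin]
  have hmemW : ∀ v ∈ W, ∃ a b c : ℝ, v = a • x + b • Y x + c • Y (Y x) := by
    intro v hv
    obtain ⟨g, rfl⟩ := (Submodule.mem_span_range_iff_exists_fun ℝ).1 hv
    exact ⟨g 0, g 1, g 2, by simp [Fin.sum_univ_three]⟩
  obtain ⟨w, hw⟩ : ∃ w, w ∉ W := by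
    by_contra! hcon
    have : W = ⊤ := eq_top_iff.2 fun v _ => hcon v
    rw [this, finrank_top] at hWd
    omega
  have htop : W ⊔ ℝ ∙ w = ⊤ := by
    refine Submodule.eq_top_of_finrank_eq (le_antisymm (Submodule.finrank_le _) ?_)
    have : W < W ⊔ ℝ ∙ w := by
      refine lt_of_le_of_ne le_sup_left fun he => hw ?_
      rw [he]
      exact Submodule.mem_sup_right (Submodule.mem_span_singleton_self w)
    have := Submodule.finrank_lt_finrank_of_lt this
    omega
  have hrep : ∀ v, ∃ a b c d : ℝ, v = a • x + b • Y x + c • Y (Y x) + d • w := by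
    intro v
    have hv : v ∈ W ⊔ ℝ ∙ w := by rw [htop]; trivial
    obtain ⟨y, hy, z, hz, rfl⟩ := Submodule.mem_sup.1 hv
    obtain ⟨a, b, c, rfl⟩ := hmemW y hy
    obtain ⟨d, rfl⟩ := Submodule.mem_span_singleton.1 hz
    exact ⟨a, b, c, d, rfl⟩
  have hw0 : w ≠ 0 := fun h0 => hw (h0 ▸ W.zero_mem)
  obtain ⟨a, b, c, d, hYw⟩ := hrep (Y w)
  have hd : d = 0 := by
    by_contra hd
    have h2 : Y (Y w) = a • Y x + b • Y (Y x) + d • Y w := by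
      conv_lhs => rw [hYw]
      simp only [map_add, map_smul, hY3, smul_zero, add_zero]
    have h3 : d • Y (Y w) = -(a • Y (Y x)) := by
      have := hY3 w
      rw [h2] at this
      simp only [map_add, map_smul, hY3, smul_zero, add_zero] at this
      exact eq_neg_of_add_eq_zero_right this
    refine hw ?_
    have hxW : x ∈ W := Submodule.subset_span ⟨0, rfl⟩
    have hYxW : Y x ∈ W := Submodule.subset_span ⟨1, rfl⟩
    have hYYxW : Y (Y x) ∈ W := Submodule.subset_span ⟨2, rfl⟩
    have h4 : Y (Y w) ∈ W := by
      have : Y (Y w) = d⁻¹ • -(a • Y (Y x)) := by rw [← h3, smul_smul, inv_mul_cancel₀ hd, one_smul]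
      rw [this]
      exact W.smul_mem _ (W.neg_mem (W.smul_mem _ hYYxW))
    have h5 : Y w ∈ W := by
      have : Y w = d⁻¹ • (Y (Y w) - (a • Y x + b • Y (Y x))) := by
        rw [h2, add_sub_cancel_left, smul_smul, inv_mul_cancel₀ hd, one_smul]
      rw [this]
      exact W.smul_mem _ (W.sub_mem h4 (W.add_mem (W.smul_mem _ hYxW) (W.smul_mem _ hYYxW)))
    have : w = d⁻¹ • (Y w - (a • x + b • Y x + c • Y (Y x))) := by
      rw [hYw, add_sub_cancel_left, smul_smul, inv_mul_cancel₀ hd, one_smul]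
    rw [this]
    exact W.smul_mem _ (W.sub_mem h5 (W.add_mem (W.add_mem (W.smul_mem _ hxW)
      (W.smul_mem _ hYxW)) (W.smul_mem _ hYYxW)))
  rw [hd, zero_smul, add_zero] at hYw
  have ha : a = 0 := by
    have := hY3 w
    rw [hYw] at this
    simp only [map_add, map_smul, hY3, smul_zero, add_zero] at this
    exact (smul_eq_zero.1 this).resolve_right hx
  rw [ha, zero_smul, zero_add] at hYw
  refine ⟨w - b • x - c • Y x, ?_, fun v => ?_⟩
  · rw [map_sub, map_sub, map_smul, map_smul, hYw]
    abel
  · obtain ⟨a', b', c', d', hv⟩ := hrep v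
    refine ⟨a' + d' * b, b' + d' * c, c', d', ?_⟩
    rw [hv]
    module

variable [FiniteDimensional ℝ E]

/-- The resolvent of a nilpotent element of the incidence algebra preserves the open cone. -/
theorem DualPair.resolvent_mem_interior {P Q : Set E} (h : DualPair P Q) {Y : E →L[ℝ] E}
    (hY : Y ∈ incidence P Q) (hY4 : ∀ v, Y (Y (Y (Y v))) = 0) {x : E} (hx : x ∈ interior P)
    (s : ℝ) : x + s • Y x + s ^ 2 • Y (Y x) + s ^ 3 • Y (Y (Y x)) ∈ interior P := by
  set R : ℝ → E := fun s => x + s • Y x + s ^ 2 • Y (Y x) + s ^ 3 • Y (Y (Y x)) with hR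
  have hcont : Continuous R := by rw [hR]; fun_prop
  have hopen : IsOpen (R ⁻¹' interior P) := isOpen_interior.preimage hcont
  have hclosed : IsClosed (R ⁻¹' interior P) := by
    have heq : R ⁻¹' interior P = R ⁻¹' P := by
      refine Subset.antisymm (preimage_mono interior_subset) fun s hs => ?_
      by_contra hsI
      obtain ⟨f, hf, hf0, hfR⟩ := h.exists_support hs hsI
      have h1 := hY _ hs f hf hfR
      have h2 : x = R s - s • Y (R s) := by
        simp only [hR, map_add, map_smul, hY4, smul_add, smul_smul, smul_zero]
        rw [show s * s ^ 2 = s ^ 3 by ring, show s * s = s ^ 2 by ring]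
        abel
      refine hf0 (h.eq_zero_of_inner_eq_zero hx hf ?_)
      rw [h2, inner_sub_right, inner_smul_right, hfR, h1]
      ring
    rw [heq]
    exact h.isClosed.preimage hcont
  have huniv := IsClopen.eq_univ ⟨hclosed, hopen⟩ ⟨0, by simpa [hR] using hx⟩
  have : s ∈ R ⁻¹' interior P := by rw [huniv]; trivial
  exact this

theorem DualPair.cube_eq_zero {P Q : Set E} (h : DualPair P Q) {Y : E →L[ℝ] E}
    (hY : Y ∈ incidence P Q) (hY4 : ∀ v, Y (Y (Y (Y v))) = 0) (v : E) : Y (Y (Y v)) = 0 := by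
  have h0 := h.linearMap_eq_zero (Y * Y * Y : E →L[ℝ] E).toLinearMap fun x hx => by
    refine h.eq_of_inner_eq fun q hq => ?_
    rw [inner_zero_right]
    refine eq_zero_of_forall_cubic_nonneg (a := ⟪q, x⟫_ℝ) (b := ⟪q, Y x⟫_ℝ) (c := ⟪q, Y (Y x)⟫_ℝ)
      fun s => ?_
    have := (h.mem_left _).1 (interior_subset (h.resolvent_mem_interior hY hY4 hx s)) q hq
    simp only [inner_add_right, inner_smul_right] at this
    exact this
  exact LinearMap.congr_fun h0 v

theorem DualPair.resolvent_mem {P Q : Set E} (h : DualPair P Q) {Y : E →L[ℝ] E}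
    (hY : Y ∈ incidence P Q) (hY4 : ∀ v, Y (Y (Y (Y v))) = 0) {x : E} (hx : x ∈ P) (s : ℝ) :
    x + s • Y x + s ^ 2 • Y (Y x) ∈ P := by
  refine h.map_of_map_interior (A := 1 + s • Y + s ^ 2 • (Y * Y)) (fun y hy => ?_) hx
  have := interior_subset (h.resolvent_mem_interior hY hY4 hy s)
  rwa [h.cube_eq_zero hY hY4, smul_zero, add_zero] at this

theorem DualPair.sq_mem {P Q : Set E} (h : DualPair P Q) {Y : E →L[ℝ] E}
    (hY : Y ∈ incidence P Q) (hY4 : ∀ v, Y (Y (Y (Y v))) = 0) {x : E} (hx : x ∈ P) :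
    Y (Y x) ∈ P := by
  refine (h.mem_left _).2 fun q hq => ?_
  by_contra! hneg
  have hnn : ∀ s : ℝ, 0 ≤ ⟪q, x⟫_ℝ + s ^ 2 * ⟪q, Y (Y x)⟫_ℝ := fun s => by
    have h1 := (h.mem_left _).1 (h.resolvent_mem hY hY4 hx s) q hq
    have h2 := (h.mem_left _).1 (h.resolvent_mem hY hY4 hx (-s)) q hq
    simp only [inner_add_right, inner_smul_right] at h1 h2
    nlinarith
  have hq0 := (h.mem_left _).1 hx q hq
  set b := ⟪q, Y (Y x)⟫_ℝ with hb
  have h1 := hnn (Real.sqrt ((⟪q, x⟫_ℝ + 1) / -b))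
  rw [Real.sq_sqrt (div_nonneg (by linarith) (by linarith))] at h1
  have : (⟪q, x⟫_ℝ + 1) / -b * b = -(⟪q, x⟫_ℝ + 1) := by
    rw [div_neg, neg_mul, div_mul_cancel₀ _ hneg.ne]
  linarith

theorem DualPair.eq_zero_of_sq_eq_zero {P Q : Set E} (h : DualPair P Q) {Y : E →L[ℝ] E}
    (hY : Y ∈ incidence P Q) (hY2 : ∀ x ∈ interior P, Y (Y x) = 0) : Y = 0 := by
  have h2 := h.linearMap_eq_zero (Y * Y : E →L[ℝ] E).toLinearMap hY2
  have hY2' : ∀ v, Y (Y v) = 0 := fun v => LinearMap.congr_fun h2 v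
  have hY4 : ∀ v, Y (Y (Y (Y v))) = 0 := fun v => by rw [hY2']
  have h1 := h.linearMap_eq_zero Y.toLinearMap fun x hx => by
    refine h.eq_zero_of_forall_add_smul_mem (x := x) fun s => ?_
    have := h.resolvent_mem hY hY4 (interior_subset hx) s
    rwa [hY2', smul_zero, add_zero] at this
  exact ContinuousLinearMap.ext fun v => LinearMap.congr_fun h1 v

end

section

/-- No supporting hyperplane of `P` contains three independent vectors of `P`. -/
def NoFacet (P Q : Set E) : Prop :=
  ∀ φ ∈ Q, φ ≠ 0 → ∀ x ∈ P, ∀ y ∈ P, ∀ z ∈ P, ⟪φ, x⟫_ℝ = 0 → ⟪φ, y⟫_ℝ = 0 → ⟪φ, z⟫_ℝ = 0 →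
    ¬ LinearIndependent ℝ ![x, y, z]

theorem linearIndependent_triple {x y z : E}
    (h : ∀ a b c : ℝ, a • x + b • y + c • z = 0 → a = 0 ∧ b = 0 ∧ c = 0) :
    LinearIndependent ℝ ![x, y, z] := by
  rw [Fintype.linearIndependent_iff]
  intro g hg
  obtain ⟨h0, h1, h2⟩ := h (g 0) (g 1) (g 2) (by simpa [Fin.sum_univ_three] using hg)
  intro i
  fin_cases i
  · exact h0
  · exact h1
  · exact h2

/-- Three points of `P` any two of which span a proper face while their sum is interior. -/
structure Triangle (P : Set E) (p₁ p₂ p₃ : E) : Prop where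
  mem₁ : p₁ ∈ P
  mem₂ : p₂ ∈ P
  mem₃ : p₃ ∈ P
  edge₁₂ : p₁ + p₂ ∉ interior P
  edge₁₃ : p₁ + p₃ ∉ interior P
  edge₂₃ : p₂ + p₃ ∉ interior P
  sum_mem : p₁ + p₂ + p₃ ∈ interior P
  indep : ∀ a b c : ℝ, a • p₁ + b • p₂ + c • p₃ = 0 → a = 0 ∧ b = 0 ∧ c = 0

theorem Triangle.swap {P : Set E} {p₁ p₂ p₃ : E} (h : Triangle P p₁ p₂ p₃) :
    Triangle P p₂ p₁ p₃ where
  mem₁ := h.mem₂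
  mem₂ := h.mem₁
  mem₃ := h.mem₃
  edge₁₂ := by rw [add_comm]; exact h.edge₁₂
  edge₁₃ := h.edge₂₃
  edge₂₃ := h.edge₁₃
  sum_mem := by rw [add_comm p₂]; exact h.sum_mem
  indep a b c he := by
    obtain ⟨h1, h2, h3⟩ := h.indep b a c (by rw [← he]; abel)
    exact ⟨h2, h1, h3⟩

theorem Triangle.rotate {P : Set E} {p₁ p₂ p₃ : E} (h : Triangle P p₁ p₂ p₃) :
    Triangle P p₃ p₁ p₂ where
  mem₁ := h.mem₃
  mem₂ := h.mem₁
  mem₃ := h.mem₂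
  edge₁₂ := by rw [add_comm]; exact h.edge₁₃
  edge₁₃ := by rw [add_comm]; exact h.edge₂₃
  edge₂₃ := h.edge₁₂
  sum_mem := by rw [add_assoc, add_comm]; exact h.sum_mem
  indep a b c he := by
    obtain ⟨h1, h2, h3⟩ := h.indep b c a (by rw [← he]; abel)
    exact ⟨h3, h1, h2⟩

variable [FiniteDimensional ℝ E]

/-- A nonzero nilpotent element of the incidence algebra is, up to the scalar function `f`,
proportional on any two points spanning a proper face. -/
theorem DualPair.map_edge_eq_zero {P Q : Set E} (h : DualPair P Q)
    (hE : Module.finrank ℝ E = 4) (hno : NoFacet P Q) {Y : E →L[ℝ] E} (hY : Y ∈ incidence P Q)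
    (hY4 : ∀ v, Y (Y (Y (Y v))) = 0) {x₀ : E} (hx₀ : Y (Y x₀) ≠ 0) {f : E → ℝ}
    (hf : ∀ v, Y (Y v) = f v • Y (Y x₀)) (hfP : ∀ v ∈ P, 0 ≤ f v) {x y : E} (hx : x ∈ P)
    (hy : y ∈ P) (hxy : x + y ∉ interior P) : Y (f y • x - f x • y) = 0 := by
  have hY3 := h.cube_eq_zero hY hY4
  obtain ⟨w, hw, hrep⟩ := exists_jordan_basis hE hY3 hx₀
  set p := Y (Y x₀) with hp
  set m := f x * f y with hm
  have hm0 : 0 ≤ m := mul_nonneg (hfP x hx) (hfP y hy)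
  obtain ⟨a, b, c, d, hv⟩ := hrep (f y • x - f x • y)
  have hYp : Y p = 0 := hY3 x₀
  have ha : a = 0 := by
    have h2 := congrArg (fun v => Y (Y v)) hv
    simp only [map_add, map_sub, map_smul, hYp, hw, ← hp, smul_zero, add_zero] at h2
    rw [hf x, hf y, smul_smul, smul_smul, mul_comm, sub_self] at h2
    exact (smul_eq_zero.1 h2.symm).resolve_right hx₀
  have hYw : Y (f y • x - f x • y) = b • p := by
    rw [hv]
    simp only [ha, zero_smul, zero_add, map_add, map_smul, hYp, hw, ← hp, smul_zero, add_zero]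
  rw [hYw]
  have hflow : ∀ t : ℝ, f y • x + f x • y + (t * b + 2 * t ^ 2 * m) • p ∈ P := by
    intro t
    have h1 := h.resolvent_mem hY hY4 (h.smul_mem hx (hfP y hy)) t
    have h2 := h.resolvent_mem hY hY4 (h.smul_mem hy (hfP x hx)) (-t)
    have h3 := h.add_mem h1 h2
    have h4 : t • Y (f y • x) + -t • Y (f x • y) = (t * b) • p := by
      rw [mul_smul, ← hYw, map_sub]
      module
    have h5 : t ^ 2 • Y (Y (f y • x)) + (-t) ^ 2 • Y (Y (f x • y)) = (2 * t ^ 2 * m) • p := by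
      rw [map_smul, map_smul, map_smul, map_smul, hf x, hf y, hm]
      module
    rw [add_smul, ← h4, ← h5]
    convert h3 using 1
    abel
  rcases hm0.eq_or_lt with hm0 | hm0
  · refine h.eq_zero_of_forall_add_smul_mem (x := f y • x + f x • y) fun t => ?_
    have := hflow t
    rwa [← hm0, mul_zero, add_zero, mul_smul] at this
  · by_contra hb
    have hb0 : b ≠ 0 := fun h0 => hb (by rw [h0, zero_smul])
    have hfx : 0 < f x := lt_of_le_of_ne (hfP x hx) fun h0 => by rw [hm, ← h0] at hm0; simp at hm0
    have hfy : 0 < f y := lt_of_le_of_ne (hfP y hy) fun h0 => by rw [hm, ← h0] at hm0; simp at hm0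
    obtain ⟨φ, hφ, hφ0, hφxy⟩ := h.exists_support (h.add_mem hx hy) hxy
    have hpP : p ∈ P := by
      have := h.sq_mem hY hY4 hx
      rw [hf x] at this
      exact h.mem_of_smul_mem hfx this
    rw [inner_add_right] at hφxy
    have hφx' := h.inner_nonneg hφ hx
    have hφy' := h.inner_nonneg hφ hy
    have hφp' := h.inner_nonneg hφ hpP
    have hφx : ⟪φ, x⟫_ℝ = 0 := by linarith
    have hφy : ⟪φ, y⟫_ℝ = 0 := by linarith
    have hφp : ⟪φ, p⟫_ℝ = 0 := by
      have h1 := h.inner_nonneg hφ (hflow (-(b / (4 * m))))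
      have h2 : -(b / (4 * m)) * b + 2 * (-(b / (4 * m))) ^ 2 * m = -(b ^ 2 / (8 * m)) := by
        field_simp
        ring
      rw [h2, inner_add_right, inner_add_right, inner_smul_right, inner_smul_right,
        inner_smul_right, hφx, hφy] at h1
      have h3 : 0 < b ^ 2 / (8 * m) := by positivity
      nlinarith
    refine hno φ hφ hφ0 x hx y hy p hpP hφx hφy hφp (linearIndependent_triple fun a' b' c' he => ?_)
    have e1 : a' * f x + b' * f y = 0 := by
      have := congrArg (fun v => Y (Y v)) he
      simp only [map_add, map_smul, hYp, map_zero, smul_zero, add_zero] at this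
      rw [hf x, hf y, smul_smul, smul_smul, ← add_smul] at this
      exact (smul_eq_zero.1 this).resolve_right hx₀
    have e2 : a' • Y x + b' • Y y = 0 := by
      have := congrArg Y he
      simpa only [map_add, map_smul, hYp, map_zero, smul_zero, add_zero] using this
    have e3 : (a' * b) • p = 0 := by
      have : f y • (a' • Y x + b' • Y y) = 0 := by rw [e2, smul_zero]
      rw [mul_smul, ← hYw, map_sub, map_smul, map_smul, ← this]
      have hb' : b' * f y = -(a' * f x) := by linarith
      have : f y • b' • Y y = -(a' * f x) • Y y := by rw [← hb']; module
      rw [smul_add, this]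
      module
    have ha' : a' = 0 := by
      have := (smul_eq_zero.1 e3).resolve_right hx₀
      exact (mul_eq_zero.1 this).resolve_right hb0
    have hb' : b' = 0 := by
      rw [ha', zero_mul, zero_add] at e1
      exact (mul_eq_zero.1 e1).resolve_right hfy.ne'
    rw [ha', hb', zero_smul, zero_smul, zero_add, zero_add] at he
    exact ⟨ha', hb', (smul_eq_zero.1 he).resolve_right hx₀⟩

theorem QuasiHomogeneous.exists_triangle {P Q : Set E} {G : Set (E →L[ℝ] E)}
    (h : QuasiHomogeneous P Q G) (hstrict : ¬ StrictCone P) : ∃ p₁ p₂ p₃, Triangle P p₁ p₂ p₃ := by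
  obtain ⟨u₀, hu₀, v₀, hv₀, hind, huv₀⟩ : ∃ u ∈ P, ∃ v ∈ P,
      (∀ a b : ℝ, a • u + b • v = 0 → a = 0 ∧ b = 0) ∧ u + v ∉ interior P := by
    by_contra! hcon
    exact hstrict hcon
  obtain ⟨φ, hφ, hφ0, hφuv⟩ := h.pair.exists_support (h.pair.add_mem hu₀ hv₀) huv₀
  rw [inner_add_right] at hφuv
  have hφu' := h.pair.inner_nonneg hφ hu₀
  have hφv' := h.pair.inner_nonneg hφ hv₀
  have hφu : ⟪φ, u₀⟫_ℝ = 0 := by linarith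
  have hφv : ⟪φ, v₀⟫_ℝ = 0 := by linarith
  set W := Submodule.span ℝ {u₀, v₀} with hW
  have huW : u₀ ∈ W := Submodule.subset_span (by simp)
  have hvW : v₀ ∈ W := Submodule.subset_span (by simp)
  have hφW : ∀ x ∈ W, ⟪φ, x⟫_ℝ = 0 := by
    intro x hx
    obtain ⟨a, b, rfl⟩ := Submodule.mem_span_pair.1 hx
    rw [inner_add_right, inner_smul_right, inner_smul_right, hφu, hφv, mul_zero, mul_zero,
      add_zero]
  have hspan : Submodule.span ℝ (P ∩ (W : Set E)) = W := by
    refine le_antisymm (span_inter_le P W) (Submodule.span_le.2 ?_)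
    rintro x (rfl | rfl)
    · exact Submodule.subset_span ⟨hu₀, huW⟩
    · exact Submodule.subset_span ⟨hv₀, hvW⟩
  have hrank : Module.finrank ℝ W = 2 := by
    have hli : LinearIndependent ℝ ![u₀, v₀] := LinearIndependent.pair_iff.2 hind
    have hr : Set.range ![u₀, v₀] = {u₀, v₀} := by
      simp [Matrix.range_cons, Set.pair_comm]
    rw [hW, ← hr, finrank_span_eq_card hli, Fintype.card_fin]
  obtain ⟨u, v, hb⟩ := h.pair.exists_coneBasis W (by rw [hspan]; exact hrank)
  obtain ⟨⟨hu, huW⟩, ⟨hv, hvW⟩⟩ := And.intro hb.left_mem hb.right_mem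
  have huv : u + v ∉ interior P := fun hint =>
    hφ0 (h.pair.eq_zero_of_inner_eq_zero hint hφ (hφW _ (W.add_mem huW hvW)))
  have hexit : ∀ ε : ℝ, 0 < ε → u - ε • v ∉ P := by
    intro ε hε hmem
    obtain ⟨a, b, -, hb0, he⟩ := hb.gen _ ⟨hmem, W.sub_mem huW (W.smul_mem ε hvW)⟩
    have := (hb.indep (a - 1) (b + ε) (by
      have : a • u + b • v - (u - ε • v) = 0 := by rw [← he, sub_self]
      rw [← this]
      module)).2
    linarith
  have hexit' : ∀ ε : ℝ, 0 < ε → v - ε • u ∉ P := by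
    intro ε hε hmem
    obtain ⟨a, b, ha0, -, he⟩ := hb.gen _ ⟨hmem, W.sub_mem hvW (W.smul_mem ε huW)⟩
    have := (hb.indep (a + ε) (b - 1) (by
      have : a • u + b • v - (v - ε • u) = 0 := by rw [← he, sub_self]
      rw [← this]
      module)).1
    linarith
  obtain ⟨y, hy⟩ := h.pair.int_left
  have hlim : Tendsto (fun n : ℕ => (u + v) + (1 / ((n : ℝ) + 1)) • y) atTop (𝓝 (u + v)) := by
    have := (tendsto_one_div_add_atTop_nhds_zero_nat (𝕜 := ℝ)).smul_const y
    simpa using this.const_add (u + v)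
  obtain ⟨ψ, -, g, gi, k, A, k₀, d⟩ := h.exists_degeneration (fun n => by
    rw [add_comm]
    exact h.pair.add_mem_interior (h.pair.smul_mem_interior hy (by positivity))
      (h.pair.add_mem hu hv)) hlim
  obtain ⟨u', hu', v', hv', hm, hAu, hAv, hint⟩ := d.exists_preimage_pair h hu hv fun n => by
    have : u + v + (1 / ((ψ n : ℝ) + 1)) • y - u - v = (1 / ((ψ n : ℝ) + 1)) • y := by abel
    simp only [Function.comp_apply, this]
    exact h.pair.smul_mem (interior_subset hy) (by positivity)
  set m := k₀ - u' - v' with hmdef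
  have hAm : A m = 0 := by
    rw [hmdef, map_sub, map_sub, d.apply_k₀, hAu, hAv]
    abel
  have hsum : u' + v' + m = k₀ := by rw [hmdef]; abel
  have hm0 : m ≠ 0 := fun h0 => huv (hint (by
    have := hsum
    rw [h0, add_zero] at this
    rw [this]
    exact d.k₀_mem))
  refine ⟨u', v', m, hu', hv', hm, fun h' => huv (hint h'), fun h' => ?_, fun h' => ?_,
    hsum ▸ d.k₀_mem, fun a b c he => ?_⟩
  · obtain ⟨ε, hε, hmem⟩ := h.pair.exists_sub_smul_mem h' v'
    have := d.map _ hmem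
    rw [map_sub, map_add, map_smul, hAm, hAu, hAv, add_zero] at this
    exact hexit ε hε this
  · obtain ⟨ε, hε, hmem⟩ := h.pair.exists_sub_smul_mem h' u'
    have := d.map _ hmem
    rw [map_sub, map_add, map_smul, hAm, hAu, hAv, add_zero] at this
    exact hexit' ε hε this
  · have h1 := congrArg A he
    rw [map_add, map_add, map_smul, map_smul, map_smul, hAm, hAu, hAv, smul_zero, add_zero,
      map_zero] at h1
    obtain ⟨rfl, rfl⟩ := hb.indep a b h1
    rw [zero_smul, zero_smul, zero_add, zero_add] at he
    exact ⟨rfl, rfl, (smul_eq_zero.1 he).resolve_right hm0⟩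

theorem DualPair.sq_apply_mem_span_of_pos {P Q : Set E} (h : DualPair P Q)
    (hE : Module.finrank ℝ E = 4) (hno : NoFacet P Q) {Y : E →L[ℝ] E} (hY : Y ∈ incidence P Q)
    (hY4 : ∀ v, Y (Y (Y (Y v))) = 0) {x₀ : E} (hx₀ : Y (Y x₀) ≠ 0) {f : E → ℝ}
    (hf : ∀ v, Y (Y v) = f v • Y (Y x₀)) (hfP : ∀ v ∈ P, 0 ≤ f v) {p₁ p₂ p₃ : E}
    (hT : Triangle P p₁ p₂ p₃) (hp₁ : 0 < f p₁) {U : Submodule ℝ E} (h₁ : p₁ ∈ U) (h₂ : p₂ ∈ U)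
    (h₃ : p₃ ∈ U) : Y (Y x₀) ∈ U := by
  have hY3 := h.cube_eq_zero hY hY4
  obtain ⟨w, hw, hrep⟩ := exists_jordan_basis hE hY3 hx₀
  set p := Y (Y x₀) with hp
  have hYp : Y p = 0 := hY3 x₀
  have hker : ∀ v, Y v = 0 → ∃ c d : ℝ, v = c • p + d • w := by
    intro v hv
    obtain ⟨a, b, c, d, rfl⟩ := hrep v
    simp only [map_add, map_smul, hYp, hw, ← hp, smul_zero, add_zero] at hv
    have ha : a = 0 := by
      have := congrArg Y hv
      simp only [map_add, map_smul, hYp, ← hp, smul_zero, add_zero, map_zero] at this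
      exact (smul_eq_zero.1 this).resolve_right hx₀
    rw [ha, zero_smul, zero_add] at hv
    have hb := (smul_eq_zero.1 hv).resolve_right hx₀
    exact ⟨c, d, by rw [ha, hb, zero_smul, zero_smul, zero_add, zero_add]⟩
  have e2 := h.map_edge_eq_zero hE hno hY hY4 hx₀ hf hfP hT.mem₁ hT.mem₂ hT.edge₁₂
  have e3 := h.map_edge_eq_zero hE hno hY hY4 hx₀ hf hfP hT.mem₁ hT.mem₃ hT.edge₁₃
  set w₂ := f p₂ • p₁ - f p₁ • p₂ with hw₂
  set w₃ := f p₃ • p₁ - f p₁ • p₃ with hw₃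
  have hw₂U : w₂ ∈ U := U.sub_mem (U.smul_mem _ h₁) (U.smul_mem _ h₂)
  have hw₃U : w₃ ∈ U := U.sub_mem (U.smul_mem _ h₁) (U.smul_mem _ h₃)
  have hind : ∀ a b : ℝ, a • w₂ + b • w₃ = 0 → a = 0 ∧ b = 0 := by
    intro a b he
    obtain ⟨-, ha, hb⟩ := hT.indep (a * f p₂ + b * f p₃) (-(a * f p₁)) (-(b * f p₁)) (by
      rw [← he, hw₂, hw₃]
      module)
    exact ⟨(mul_eq_zero.1 (neg_eq_zero.1 ha)).resolve_right hp₁.ne',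
      (mul_eq_zero.1 (neg_eq_zero.1 hb)).resolve_right hp₁.ne'⟩
  obtain ⟨a, b, hab⟩ := hker _ e2
  obtain ⟨c, d, hcd⟩ := hker _ e3
  have hdet : a * d - b * c ≠ 0 := by
    intro h0
    have h1 : d • w₂ + (-b) • w₃ = 0 := by
      rw [hab, hcd]
      have : d • (a • p + b • w) + -b • (c • p + d • w) = (a * d - b * c) • p := by module
      rw [this, h0, zero_smul]
    obtain ⟨hd, hb⟩ := hind _ _ h1
    have hb := neg_eq_zero.1 hb
    have h2 : c • w₂ + (-a) • w₃ = 0 := by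
      rw [hab, hcd, hd, hb]
      module
    obtain ⟨hc, ha⟩ := hind _ _ h2
    have ha := neg_eq_zero.1 ha
    have h3 := hind 1 0 (by rw [hab, ha, hb]; module)
    exact one_ne_zero h3.1
  have : p = (a * d - b * c)⁻¹ • (d • w₂ - b • w₃) := by
    rw [hab, hcd]
    have : d • (a • p + b • w) - b • (c • p + d • w) = (a * d - b * c) • p := by module
    rw [this, smul_smul, inv_mul_cancel₀ hdet, one_smul]
  rw [this]
  exact U.smul_mem _ (U.sub_mem (U.smul_mem _ hw₂U) (U.smul_mem _ hw₃U))

theorem DualPair.sq_apply_mem_span {P Q : Set E} (h : DualPair P Q)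
    (hE : Module.finrank ℝ E = 4) (hno : NoFacet P Q) {Y : E →L[ℝ] E} (hY : Y ∈ incidence P Q)
    (hY4 : ∀ v, Y (Y (Y (Y v))) = 0) {p₁ p₂ p₃ : E} (hT : Triangle P p₁ p₂ p₃)
    {U : Submodule ℝ E} (h₁ : p₁ ∈ U) (h₂ : p₂ ∈ U) (h₃ : p₃ ∈ U) {x₀ : E}
    (hxI : x₀ ∈ interior P) : Y (Y x₀) ∈ U := by
  by_cases hx₀ : Y (Y x₀) = 0
  · rw [hx₀]
    exact U.zero_mem
  have hY3 := h.cube_eq_zero hY hY4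
  obtain ⟨w, hw, hrep⟩ := exists_jordan_basis hE hY3 hx₀
  have hsq : ∀ v, ∃ c : ℝ, Y (Y v) = c • Y (Y x₀) := by
    intro v
    obtain ⟨a, b, c, d, rfl⟩ := hrep v
    exact ⟨a, by simp only [map_add, map_smul, hY3, hw, smul_zero, add_zero]⟩
  choose f hf using hsq
  have hp : Y (Y x₀) ∈ P := h.sq_mem hY hY4 (interior_subset hxI)
  have hfP : ∀ v ∈ P, 0 ≤ f v := by
    intro v hv
    by_contra! hneg
    have h1 := h.sq_mem hY hY4 hv
    rw [hf v] at h1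
    refine hx₀ (h.sharp hp (h.mem_of_smul_mem (neg_pos.2 hneg) ?_))
    rwa [smul_neg, neg_smul, neg_neg]
  have hsum : 0 < f p₁ + f p₂ + f p₃ := by
    obtain ⟨ε, hε, hmem⟩ := h.exists_sub_smul_mem hT.sum_mem x₀
    have h1 := hfP _ hmem
    have h2 : f (p₁ + p₂ + p₃ - ε • x₀) = f p₁ + f p₂ + f p₃ - ε := by
      refine smul_left_injective ℝ hx₀ ?_
      simp only
      rw [← hf, map_sub, map_sub, map_add, map_add, map_add, map_add, map_smul, map_smul, hf p₁,
        hf p₂, hf p₃]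
      module
    linarith
  have g₁ := hfP _ hT.mem₁
  have g₂ := hfP _ hT.mem₂
  have g₃ := hfP _ hT.mem₃
  rcases g₁.lt_or_eq with g₁ | g₁
  · exact h.sq_apply_mem_span_of_pos hE hno hY hY4 hx₀ hf hfP hT g₁ h₁ h₂ h₃
  rcases g₂.lt_or_eq with g₂ | g₂
  · exact h.sq_apply_mem_span_of_pos hE hno hY hY4 hx₀ hf hfP hT.swap g₂ h₂ h₁ h₃
  · exact h.sq_apply_mem_span_of_pos hE hno hY hY4 hx₀ hf hfP hT.rotate (by linarith) h₃ h₁ h₂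

theorem QuasiHomogeneous.nilpotent_eq_zero {P Q : Set E} {G : Set (E →L[ℝ] E)}
    (h : QuasiHomogeneous P Q G) (hE : Module.finrank ℝ E = 4) (hsplit : ¬ Splits P Q)
    (hstrict : ¬ StrictCone P) (hno : NoFacet P Q) {Y : E →L[ℝ] E} (hY : Y ∈ incidence P Q)
    (hY4 : ∀ v, Y (Y (Y (Y v))) = 0) : Y = 0 := by
  refine h.pair.eq_zero_of_sq_eq_zero hY fun x₀ hx₀ => ?_
  obtain ⟨p₁, p₂, p₃, hT⟩ := h.exists_triangle hstrict
  set U := Submodule.span ℝ (Set.range ![p₁, p₂, p₃]) with hU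
  have hUtop : U ≠ ⊤ := by
    intro ht
    have := finrank_range_le_card (R := ℝ) ![p₁, p₂, p₃]
    rw [Set.finrank, ← hU, ht, finrank_top, hE, Fintype.card_fin] at this
    omega
  set V := Submodule.span ℝ ((fun g : E →L[ℝ] E => g (Y (Y x₀))) '' G) with hV
  have hVU : V ≤ U := by
    refine Submodule.span_le.2 ?_
    rintro _ ⟨g, hg, rfl⟩
    obtain ⟨k, hk, hgk, hkg⟩ := h.exists_inv g hg
    have hconj : ∀ v, (g * Y * k) (g v) = g (Y v) := fun v => by
      rw [mul_apply_eq_comp, mul_apply_eq_comp, apply_apply_of_mul_eq_one hkg]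
    have := h.pair.sq_apply_mem_span hE hno (h.conj_mem_incidence hg hk hgk hY) (fun v => by
      rw [← apply_apply_of_mul_eq_one hgk v, hconj, hconj, hconj, hconj, hY4, map_zero]) hT
      (U := U) (Submodule.subset_span ⟨0, rfl⟩) (Submodule.subset_span ⟨1, rfl⟩)
      (Submodule.subset_span ⟨2, rfl⟩) (h.map_interior hg hx₀)
    rwa [hconj, hconj] at this
  have hinv : ∀ g ∈ G, ∀ v ∈ V, g v ∈ V := by
    intro g hg v hv
    have : V ≤ V.comap g.toLinearMap := by
      refine Submodule.span_le.2 ?_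
      rintro _ ⟨k, hk, rfl⟩
      exact Submodule.subset_span ⟨g * k, h.mul_mem g hg k hk, rfl⟩
    exact this hv
  rcases h.irreducible hE hsplit hstrict hinv with hb | ht
  · have : Y (Y x₀) ∈ V := Submodule.subset_span ⟨1, h.one_mem, rfl⟩
    rw [hb] at this
    exact (Submodule.mem_bot ℝ).1 this
  · exact absurd (top_le_iff.1 (ht ▸ hVU)) hUtop

end

section

theorem exists_quartic_relation (hE : Module.finrank ℝ E = 4) (X : E →L[ℝ] E) :
    ∃ a b c d : ℝ, ∀ v, X (X (X (X v))) = a • v + b • X v + c • X (X v) + d • X (X (X v)) := by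
  have : FiniteDimensional ℝ E := Module.finite_of_finrank_pos (by omega)
  have h := LinearMap.aeval_self_charpoly X.toLinearMap
  have hdeg := LinearMap.charpoly_natDegree X.toLinearMap
  rw [hE] at hdeg
  have hlead := (LinearMap.charpoly_monic X.toLinearMap).coeff_natDegree
  rw [hdeg] at hlead
  rw [Polynomial.aeval_eq_sum_range, hdeg] at h
  set q := X.toLinearMap.charpoly
  refine ⟨-q.coeff 0, -q.coeff 1, -q.coeff 2, -q.coeff 3, fun v => ?_⟩
  have hv := LinearMap.congr_fun h v
  simp only [Finset.sum_range_succ, Finset.sum_range_zero, zero_add, hlead, LinearMap.add_apply,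
    LinearMap.smul_apply, LinearMap.zero_apply, pow_succ, pow_zero, one_mul, Module.End.mul_apply,
    Module.End.one_apply, one_smul, ContinuousLinearMap.coe_coe] at hv
  rw [← sub_eq_zero, ← hv]
  module

variable [FiniteDimensional ℝ E]

theorem DualPair.exists_extreme [Nontrivial E] {P Q : Set E} (h : DualPair P Q) :
    ∃ f₀ ∈ Q, ∃ x ∈ P, ⟪f₀, x⟫_ℝ = 1 ∧
      ∀ a ∈ P, ∀ b ∈ P, a + b = x → a = ⟪f₀, a⟫_ℝ • x := by
  obtain ⟨f₀, hf₀, hf₀0⟩ := h.symm.exists_nonzero_mem_interior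
  obtain ⟨y, hy, hy0⟩ := h.exists_nonzero_mem_interior
  have hpos : ∀ a ∈ P, a ≠ 0 → 0 < ⟪f₀, a⟫_ℝ := fun a ha ha0 => by
    rw [real_inner_comm]
    exact h.symm.inner_pos hf₀ ha ha0
  have hne : {x | x ∈ P ∧ ⟪f₀, x⟫_ℝ = 1}.Nonempty := by
    have hy' := hpos y (interior_subset hy) hy0
    refine ⟨(⟪f₀, y⟫_ℝ)⁻¹ • y, h.smul_mem (interior_subset hy) (inv_nonneg.2 hy'.le), ?_⟩
    rw [inner_smul_right, inv_mul_cancel₀ hy'.ne']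
  obtain ⟨x, ⟨hx, hx1⟩, hext⟩ := (h.isCompact_slice hf₀ 1).extremePoints_nonempty hne
  refine ⟨f₀, interior_subset hf₀, x, hx, hx1, fun a ha b hb hab => ?_⟩
  have hsum : ⟪f₀, a⟫_ℝ + ⟪f₀, b⟫_ℝ = 1 := by rw [← inner_add_right, hab, hx1]
  rcases eq_or_ne a 0 with rfl | ha0
  · simp
  rcases eq_or_ne b 0 with rfl | hb0
  · rw [inner_zero_right, add_zero] at hsum
    rw [hsum, one_smul, ← hab, add_zero]
  have hα := hpos a ha ha0
  have hβ := hpos b hb hb0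
  have key := hext (x₁ := (⟪f₀, a⟫_ℝ)⁻¹ • a)
    ⟨h.smul_mem ha (inv_nonneg.2 hα.le), by rw [inner_smul_right, inv_mul_cancel₀ hα.ne']⟩
    (x₂ := (⟪f₀, b⟫_ℝ)⁻¹ • b)
    ⟨h.smul_mem hb (inv_nonneg.2 hβ.le), by rw [inner_smul_right, inv_mul_cancel₀ hβ.ne']⟩
    ⟨⟪f₀, a⟫_ℝ, ⟪f₀, b⟫_ℝ, hα, hβ, hsum, by
      rw [smul_smul, smul_smul, mul_inv_cancel₀ hα.ne', mul_inv_cancel₀ hβ.ne', one_smul,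
        one_smul, hab]⟩
  rw [← key, smul_smul, mul_inv_cancel₀ hα.ne', one_smul]

/-- Degenerating to an extreme ray produces a limit of rank one. -/
theorem QuasiHomogeneous.exists_rank_one_limit [Nontrivial E] {P Q : Set E} {G : Set (E →L[ℝ] E)}
    (h : QuasiHomogeneous P Q G) :
    ∃ (g gi : ℕ → E →L[ℝ] E) (A : E →L[ℝ] E) (f₀ φ x : E), (∀ n, g n ∈ G) ∧ (∀ n, gi n ∈ G) ∧
      (∀ n, g n * gi n = 1) ∧ (∀ n, gi n * g n = 1) ∧ Tendsto g atTop (𝓝 A) ∧ φ ≠ 0 ∧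
      ⟪f₀, x⟫_ℝ = 1 ∧ ∀ v, A v = ⟪φ, v⟫_ℝ • x := by
  obtain ⟨f₀, hf₀, x, hx, hx1, hext⟩ := h.pair.exists_extreme
  obtain ⟨y, hy⟩ := h.pair.int_left
  have hlim : Tendsto (fun n : ℕ => x + (1 / ((n : ℝ) + 1)) • y) atTop (𝓝 x) := by
    have := (tendsto_one_div_add_atTop_nhds_zero_nat (𝕜 := ℝ)).smul_const y
    simpa using this.const_add x
  obtain ⟨ψ, -, g, gi, k, A, k₀, d⟩ := h.exists_degeneration (fun n => by
    rw [add_comm]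
    exact h.pair.add_mem_interior (h.pair.smul_mem_interior hy (by positivity)) hx) hlim
  have hA : ∀ v ∈ P, A v = ⟪f₀, A v⟫_ℝ • x := by
    intro v hv
    obtain ⟨ε, hε, hmem⟩ := h.pair.exists_sub_smul_mem d.k₀_mem v
    have := hext _ (d.map _ (h.pair.smul_mem hv hε.le)) _ (d.map _ hmem) (by
      rw [← map_add, add_sub_cancel, d.apply_k₀])
    rw [map_smul, inner_smul_right, mul_smul] at this
    exact smul_right_injective E hε.ne' this
  refine ⟨g, gi, A, f₀, adjoint A f₀, x, d.g_mem, d.gi_mem, d.mul_inv, d.inv_mul, d.tendsto_g,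
    fun h0 => ?_, hx1, fun v => ?_⟩
  · have : ⟪adjoint A f₀, k₀⟫_ℝ = 1 := by rw [adjoint_inner_left, d.apply_k₀, hx1]
    rw [h0, inner_zero_left] at this
    exact zero_ne_one this
  · have h0 := h.pair.linearMap_eq_zero
      (A - (innerSL ℝ (adjoint A f₀)).smulRight x).toLinearMap fun v hv => by
        have := hA v (interior_subset hv)
        rw [← adjoint_inner_left] at this
        exact sub_eq_zero.2 this
    exact sub_eq_zero.1 (LinearMap.congr_fun h0 v)

theorem QuasiHomogeneous.incidence_scalar_of_facet {P Q : Set E} {G : Set (E →L[ℝ] E)}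
    (h : QuasiHomogeneous P Q G) (hE : Module.finrank ℝ E = 4) (hsplit : ¬ Splits P Q)
    (hstrict : ¬ StrictCone P) (hno : ¬ NoFacet P Q) :
    ∀ X ∈ incidence P Q, ∃ c : ℝ, X = c • (1 : E →L[ℝ] E) := by
  unfold NoFacet at hno
  push Not at hno
  obtain ⟨φ, hφ, hφ0, x, hx, y, hy, z, hz, hφx, hφy, hφz, hli⟩ := hno
  set W := Submodule.span ℝ (Set.range ![x, y, z]) with hW
  have hWd : Module.finrank ℝ W = 3 := by rw [hW, finrank_span_eq_card hli, Fintype.card_fin]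
  have hWo : Module.finrank ℝ (Wᗮ : Submodule ℝ E) = 1 := by
    have := Submodule.finrank_add_finrank_orthogonal W
    omega
  have hmem : ∀ ψ : E, ⟪ψ, x⟫_ℝ = 0 → ⟪ψ, y⟫_ℝ = 0 → ⟪ψ, z⟫_ℝ = 0 → ψ ∈ Wᗮ := by
    intro ψ h1 h2 h3
    rw [hW, Submodule.mem_orthogonal']
    intro u hu
    have hle : Submodule.span ℝ (Set.range ![x, y, z]) ≤ (ℝ ∙ ψ)ᗮ := by
      refine Submodule.span_le.2 ?_
      rintro _ ⟨i, rfl⟩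
      rw [SetLike.mem_coe, mem_orthogonal_line]
      fin_cases i
      · exact h1
      · exact h2
      · exact h3
    exact mem_orthogonal_line.1 (hle hu)
  refine h.incidence_scalar_of_eigenvector hE hsplit hstrict hφ0 fun X hX => ?_
  refine eq_smul_of_finrank_eq_one hWo (hmem φ hφx hφy hφz) hφ0 (hmem _ ?_ ?_ ?_)
  · rw [adjoint_inner_left, hX x hx φ hφ hφx]
  · rw [adjoint_inner_left, hX y hy φ hφ hφy]
  · rw [adjoint_inner_left, hX z hz φ hφ hφz]

/-- A divergent sequence of conjugates of `X` subconverges, after rescaling, to a nilpotent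
direction. -/
theorem QuasiHomogeneous.exists_nilpotent_limit {P Q : Set E} {G : Set (E →L[ℝ] E)}
    (h : QuasiHomogeneous P Q G) (hE : Module.finrank ℝ E = 4) {X : E →L[ℝ] E}
    (hX : X ∈ incidence P Q) {g gi : ℕ → E →L[ℝ] E} (hg : ∀ n, g n ∈ G) (hgi : ∀ n, gi n ∈ G)
    (hggi : ∀ n, g n * gi n = 1) (hgig : ∀ n, gi n * g n = 1)
    (hlim : Tendsto (fun n => ‖g n * X * gi n‖) atTop atTop) :
    ∃ Y ∈ incidence P Q, Y ≠ 0 ∧ ∀ v, Y (Y (Y (Y v))) = 0 := by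
  obtain ⟨a, b, c, d, hrel⟩ := exists_quartic_relation hE X
  set Z : ℕ → E →L[ℝ] E := fun n => g n * X * gi n with hZ
  set r : ℕ → ℝ := fun n => ‖Z n‖⁻¹ with hr
  have hr0 : Tendsto r atTop (𝓝 0) := tendsto_inv_atTop_zero.comp hlim
  have hZg : ∀ n v, Z n (g n v) = g n (X v) := fun n v => by
    simp only [hZ, mul_apply_eq_comp]
    rw [apply_apply_of_mul_eq_one (hgig n)]
  have hZrel : ∀ n v, Z n (Z n (Z n (Z n v))) =
      a • v + b • Z n v + c • Z n (Z n v) + d • Z n (Z n (Z n v)) := by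
    intro n v
    rw [← apply_apply_of_mul_eq_one (hggi n) v]
    simp only [hZg, hrel, map_add, map_smul]
  obtain ⟨Y, -, ψ, hψ, hY⟩ := tendsto_subseq_of_bounded
    (Metric.isBounded_closedBall (x := (0 : E →L[ℝ] E)) (r := 1)) (x := fun n => r n • Z n)
    fun n => by
      rw [mem_closedBall_zero_iff, norm_smul, hr, norm_inv, norm_norm]
      exact inv_mul_le_one
  have hrψ : Tendsto (fun n => r (ψ n)) atTop (𝓝 0) := hr0.comp hψ.tendsto_atTop
  refine ⟨Y, (isClosed_incidence P Q).mem_of_tendsto hY (Eventually.of_forall fun n =>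
    (incidence P Q).smul_mem _ (h.conj_mem_incidence (hg _) (hgi _) (hggi _) hX)), ?_, fun v => ?_⟩
  · have h1 : ∀ᶠ n in atTop, ‖r (ψ n) • Z (ψ n)‖ = 1 := by
      filter_upwards [(hlim.comp hψ.tendsto_atTop).eventually_gt_atTop 0] with n hn
      rw [norm_smul, hr, norm_inv, norm_norm]
      exact inv_mul_cancel₀ hn.ne'
    have h2 : ‖Y‖ = 1 := tendsto_nhds_unique hY.norm
      ((tendsto_congr' h1).2 tendsto_const_nhds)
    intro h0
    rw [h0, norm_zero] at h2
    exact zero_ne_one h2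
  · have t1 := tendsto_clm_apply hY (tendsto_const_nhds (x := v))
    have t2 := tendsto_clm_apply hY t1
    have t3 := tendsto_clm_apply hY t2
    have t4 := tendsto_clm_apply hY t3
    refine tendsto_nhds_unique t4 ?_
    have hz : Tendsto (fun n => (r (ψ n) ^ 4 * a) • v +
        (r (ψ n) ^ 3 * b) • ((r (ψ n) • Z (ψ n)) v) +
        (r (ψ n) ^ 2 * c) • ((r (ψ n) • Z (ψ n)) ((r (ψ n) • Z (ψ n)) v)) +
        (r (ψ n) * d) • ((r (ψ n) • Z (ψ n)) ((r (ψ n) • Z (ψ n)) ((r (ψ n) • Z (ψ n)) v))))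
        atTop (𝓝 (((0 : ℝ) ^ 4 * a) • v + ((0 : ℝ) ^ 3 * b) • Y v + ((0 : ℝ) ^ 2 * c) • Y (Y v) +
          ((0 : ℝ) * d) • Y (Y (Y v)))) :=
      (((((hrψ.pow 4).mul_const a).smul_const v).add (((hrψ.pow 3).mul_const b).smul t1)).add
        (((hrψ.pow 2).mul_const c).smul t2)).add ((hrψ.mul_const d).smul t3)
    have e0 : ((0 : ℝ) ^ 4 * a) • v + ((0 : ℝ) ^ 3 * b) • Y v + ((0 : ℝ) ^ 2 * c) • Y (Y v) +
        ((0 : ℝ) * d) • Y (Y (Y v)) = 0 := by simp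
    rw [e0] at hz
    refine hz.congr fun n => ?_
    simp only [Function.comp_apply, _root_.smul_apply, map_smul, hZrel]
    module

/-- The incidence algebra of an irreducible, non-strictly convex cone consists of scalars. -/
theorem QuasiHomogeneous.incidence_scalar {P Q : Set E} {G : Set (E →L[ℝ] E)}
    (h : QuasiHomogeneous P Q G) (hE : Module.finrank ℝ E = 4) (hsplit : ¬ Splits P Q)
    (hstrict : ¬ StrictCone P) :
    ∀ X ∈ incidence P Q, ∃ c : ℝ, X = c • (1 : E →L[ℝ] E) := by
  by_cases hno : NoFacet P Q
  swap
  · exact h.incidence_scalar_of_facet hE hsplit hstrict hno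
  have : Nontrivial E := Module.nontrivial_of_finrank_pos (R := ℝ) (by omega)
  obtain ⟨g, gi, A, f₀, φ, x, hg, hgi, hggi, hgig, hlim, hφ0, hf₀x, hA⟩ := h.exists_rank_one_limit
  refine h.incidence_scalar_of_eigenvector hE hsplit hstrict hφ0 fun X hX => ?_
  by_cases hb : ∃ R : ℝ, ∃ᶠ n in atTop, ‖g n * X * gi n‖ ≤ R
  · obtain ⟨R, hR⟩ := hb
    obtain ⟨Z, -, ψ, hψ, hZ⟩ := tendsto_subseq_of_frequently_bounded
      (Metric.isBounded_closedBall (x := (0 : E →L[ℝ] E)) (r := R)) (x := fun n => g n * X * gi n)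
      (hR.mono fun n hn => by rwa [mem_closedBall_zero_iff])
    have hgψ := hlim.comp hψ.tendsto_atTop
    refine ⟨⟪f₀, Z x⟫_ℝ, ext_inner_right ℝ fun v => ?_⟩
    have h1 : Z (A v) = A (X v) := by
      refine tendsto_nhds_unique
        (tendsto_clm_apply hZ (tendsto_clm_apply hgψ (tendsto_const_nhds (x := v)))) ?_
      refine (tendsto_clm_apply hgψ (tendsto_const_nhds (x := X v))).congr fun n => ?_
      simp only [Function.comp_apply, mul_apply_eq_comp]
      rw [apply_apply_of_mul_eq_one (hgig _)]
    rw [hA, hA, map_smul] at h1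
    have h2 := congrArg (fun u => ⟪f₀, u⟫_ℝ) h1
    simp only [inner_smul_right, hf₀x, mul_one] at h2
    rw [adjoint_inner_left, real_inner_smul_left, ← h2, mul_comm]
  · push Not at hb
    obtain ⟨Y, hY, hY0, hY4⟩ := h.exists_nilpotent_limit hE hX hg hgi hggi hgig
      (tendsto_atTop.2 fun R => (hb R).mono fun n hn => hn.le)
    exact absurd (h.nilpotent_eq_zero hE hsplit hstrict hno hY hY4) hY0

end

section

variable [FiniteDimensional ℝ E]

theorem eq_one_of_smul_one_of_det {g : E →L[ℝ] E} {c : ℝ} (hE : Module.finrank ℝ E ≠ 0)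
    (hg : g = c • (1 : E →L[ℝ] E)) (hc : 0 < c)
    (hdet : |LinearMap.det (g : E →ₗ[ℝ] E)| = 1) : g = 1 := by
  have h1 : (g : E →ₗ[ℝ] E) = c • (1 : E →ₗ[ℝ] E) := by rw [hg]; rfl
  rw [h1, LinearMap.det_smul, map_one, mul_one, abs_pow, abs_of_pos hc,
    pow_eq_one_iff_of_nonneg hc.le hE] at hdet
  rw [hg, hdet, one_smul]

/-- An infinitesimal automorphism tangent to a sequence of automorphisms converging to the identity
preserves all incidences. -/
theorem QuasiHomogeneous.mem_incidence_of_tendsto {P Q : Set E} {G : Set (E →L[ℝ] E)}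
    (h : QuasiHomogeneous P Q G) {g X : ℕ → E →L[ℝ] E} {c ε : ℕ → ℝ} {Y : E →L[ℝ] E}
    (hg : ∀ n, g n ∈ G) (hgX : ∀ n, g n = c n • (1 : E →L[ℝ] E) + ε n • X n)
    (hε : ∀ n, 0 < ε n) (hlim : Tendsto g atTop (𝓝 1)) (hX : Tendsto X atTop (𝓝 Y))
    (hc : Tendsto c atTop (𝓝 1)) :
    Y ∈ incidence P Q := by
  have := FiniteDimensional.complete ℝ E
  intro x hx f hf hfx
  refine le_antisymm ?_ ?_
  · choose gi hgi hggi hgig using fun n => h.exists_inv (g n) (hg n)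
    have hgilim : Tendsto gi atTop (𝓝 1) := by
      have h1 := (NormedRing.inverse_continuousAt (1 : (E →L[ℝ] E)ˣ)).tendsto
      rw [Units.val_one, Ring.inverse_one] at h1
      refine (h1.comp hlim).congr fun n => ?_
      exact Ring.inverse_unit ⟨g n, gi n, hggi n, hgig n⟩
    have h1 := (tendsto_const_nhds (x := f)).inner (𝕜 := ℝ)
      (tendsto_clm_apply hgilim (tendsto_clm_apply hX (tendsto_const_nhds (x := x))))
    refine le_of_tendsto h1 ?_
    filter_upwards [hc.eventually_const_lt zero_lt_one] with n hn
    have h2 := congrArg (fun v => ⟪f, gi n v⟫_ℝ) (congrArg (fun T : E →L[ℝ] E => T x) (hgX n))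
    simp only [_root_.add_apply, _root_.smul_apply, one_apply_eq_self, map_add, map_smul,
      inner_add_right, inner_smul_right, apply_apply_of_mul_eq_one (hgig n), hfx] at h2
    have h3 := h.pair.inner_nonneg hf (h.map _ (hgi n) x hx)
    have h4 : ε n * ⟪f, gi n (X n x)⟫_ℝ ≤ 0 := by nlinarith [mul_nonneg hn.le h3]
    exact nonpos_of_mul_nonpos_right h4 (hε n)
  · have h1 := (tendsto_const_nhds (x := f)).inner (𝕜 := ℝ)
      (tendsto_clm_apply hX (tendsto_const_nhds (x := x)))
    refine ge_of_tendsto' h1 fun n => ?_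
    have h3 := h.pair.inner_nonneg hf (h.map _ (hg n) x hx)
    simp only [hgX, _root_.add_apply, _root_.smul_apply, one_apply_eq_self, inner_add_right,
      inner_smul_right, hfx, mul_zero, zero_add] at h3
    exact nonneg_of_mul_nonneg_right h3 (hε n)

/-- Unimodular automorphisms of an irreducible, non-strictly convex cone are isolated. -/
theorem QuasiHomogeneous.exists_nhds_one {P Q : Set E} {G : Set (E →L[ℝ] E)}
    (h : QuasiHomogeneous P Q G) (hE : Module.finrank ℝ E = 4) (hsplit : ¬ Splits P Q)
    (hstrict : ¬ StrictCone P) :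
    ∃ U ∈ 𝓝 (1 : E →L[ℝ] E), ∀ g ∈ G, g ∈ U →
      |LinearMap.det (g : E →ₗ[ℝ] E)| = 1 → g = 1 := by
  by_contra! hcon
  have hpos : ∀ n : ℕ, (0 : ℝ) < 1 / (n + 1) := fun n => by positivity
  choose g hg hgU hdet hg1 using fun n : ℕ => hcon _ (Metric.ball_mem_nhds 1 (hpos n))
  have hlim : Tendsto g atTop (𝓝 1) := by
    rw [tendsto_iff_dist_tendsto_zero]
    exact squeeze_zero (fun n => dist_nonneg) (fun n => (Metric.mem_ball.1 (hgU n)).le)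
      tendsto_one_div_add_atTop_nhds_zero_nat
  set τ : (E →L[ℝ] E) →ₗ[ℝ] ℝ :=
    LinearMap.trace ℝ E ∘ₗ ContinuousLinearMap.coeLM ℝ with hτ
  have hτc : Continuous τ := τ.continuous_of_finiteDimensional
  have hτ1 : τ 1 = 4 := by
    have : τ 1 = LinearMap.trace ℝ E 1 := rfl
    rw [this, LinearMap.trace_one, hE]
    norm_num
  have hclim : Tendsto (fun n => τ (g n) / 4) atTop (𝓝 1) := by
    have := ((hτc.tendsto 1).comp hlim).div_const 4
    rwa [hτ1, div_self four_ne_zero] at this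
  obtain ⟨N, hN⟩ := eventually_atTop.1 (hclim.eventually_const_lt zero_lt_one)
  set c : ℕ → ℝ := fun n => τ (g n) / 4 with hc
  set D : ℕ → E →L[ℝ] E := fun n => g n - c n • 1 with hD
  have hD0 : ∀ n, D (n + N) ≠ 0 := fun n h0 =>
    hg1 (n + N) (eq_one_of_smul_one_of_det (by omega) (sub_eq_zero.1 h0) (hN _ (by omega)) (hdet _))
  obtain ⟨Y, -, ψ, hψ, hY⟩ := tendsto_subseq_of_bounded
    (Metric.isBounded_closedBall (x := (0 : E →L[ℝ] E)) (r := 1))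
    (x := fun n => ‖D (n + N)‖⁻¹ • D (n + N)) fun n => by
      rw [mem_closedBall_zero_iff, norm_smul, norm_inv, norm_norm]
      exact inv_mul_le_one
  have hY1 : ‖Y‖ = 1 := tendsto_nhds_unique hY.norm
    ((tendsto_congr fun n => by
      rw [Function.comp_apply, norm_smul, norm_inv, norm_norm,
        inv_mul_cancel₀ (norm_ne_zero_iff.2 (hD0 _))]).2 tendsto_const_nhds)
  have hYτ : τ Y = 0 := by
    refine tendsto_nhds_unique ((hτc.tendsto Y).comp hY) ?_
    refine tendsto_const_nhds.congr fun n => ?_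
    simp only [Function.comp_apply, map_smul, hD, map_sub, hτ1, hc, smul_eq_mul]
    ring
  have hψN : Tendsto (fun n => ψ n + N) atTop atTop :=
    (tendsto_add_atTop_nat N).comp hψ.tendsto_atTop
  obtain ⟨r, hr⟩ := h.incidence_scalar hE hsplit hstrict Y <|
    h.mem_incidence_of_tendsto (g := fun n => g (ψ n + N)) (c := fun n => c (ψ n + N))
      (ε := fun n => ‖D (ψ n + N)‖) (fun n => hg _) (fun n => by
        rw [Function.comp_apply, smul_smul, mul_inv_cancel₀ (norm_ne_zero_iff.2 (hD0 _)), one_smul,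
          hD, add_sub_cancel])
      (fun n => norm_pos_iff.2 (hD0 _)) (hlim.comp hψN) hY (hclim.comp hψN)
  rw [hr, map_smul, hτ1, smul_eq_mul] at hYτ
  have hr0 : r = 0 := by linarith
  rw [hr, hr0, zero_smul, norm_zero] at hY1
  exact zero_ne_one hY1

end

section

theorem zero_mem_closure_cone {C : Set E} (hne : C.Nonempty)
    (hcone : ∀ x ∈ C, ∀ t : ℝ, 0 < t → t • x ∈ C) : (0 : E) ∈ closure C := by
  obtain ⟨x, hx⟩ := hne
  have := (tendsto_one_div_add_atTop_nhds_zero_nat (𝕜 := ℝ)).smul_const x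
  rw [zero_smul] at this
  exact mem_closure_of_tendsto this
    (Eventually.of_forall fun n => hcone x hx _ (by positivity))

theorem smul_mem_closure_cone {C : Set E} (hcone : ∀ x ∈ C, ∀ t : ℝ, 0 < t → t • x ∈ C) {x : E}
    (hx : x ∈ closure C) {t : ℝ} (ht : 0 < t) : t • x ∈ closure C :=
  map_mem_closure (continuous_const_smul t) hx fun y hy => hcone y hy t ht

/-- The dual of a subset of `E`. -/
def dual (P : Set E) : Set E := {f | ∀ x ∈ P, 0 ≤ ⟪x, f⟫_ℝ}

theorem mem_closure_cone_of_dual [CompleteSpace E] {C : Set E} (hne : C.Nonempty)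
    (hconv : Convex ℝ C) (hcone : ∀ x ∈ C, ∀ t : ℝ, 0 < t → t • x ∈ C) {x : E}
    (hx : ∀ f ∈ dual (closure C), 0 ≤ ⟪f, x⟫_ℝ) : x ∈ closure C := by
  by_contra hxC
  obtain ⟨F, u, hFx, hF⟩ := geometric_hahn_banach_point_closed hconv.closure isClosed_closure hxC
  have hu : u < 0 := by simpa using hF 0 (zero_mem_closure_cone hne hcone)
  set f := (InnerProductSpace.toDual ℝ E).symm F with hf
  have hfF : ∀ z, ⟪f, z⟫_ℝ = F z := fun z => InnerProductSpace.toDual_symm_apply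
  have hfd : f ∈ dual (closure C) := by
    intro z hz
    rw [real_inner_comm, hfF]
    by_contra! hneg
    have h1 := hF _ (smul_mem_closure_cone hcone hz (div_pos_of_neg_of_neg hu hneg))
    rw [map_smul, smul_eq_mul, div_mul_cancel₀ _ hneg.ne] at h1
    exact lt_irrefl u h1
  have := hx f hfd
  rw [hfF] at this
  linarith

theorem convex_dual (P : Set E) : Convex ℝ (dual P) := by
  intro f hf g hg a b ha hb _ x hx
  rw [inner_add_right, inner_smul_right, inner_smul_right]
  exact add_nonneg (mul_nonneg ha (hf x hx)) (mul_nonneg hb (hg x hx))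

theorem DualPair.interior_eq_image2_of_split {P Q : Set E} (h : DualPair P Q) {p φ : E}
    (hp : p ∈ P) (hφ : φ ∈ Q) (hφp : ⟪φ, p⟫_ℝ = 1) (hsplit : ∀ c ∈ P, c - ⟪φ, c⟫_ℝ • p ∈ P) :
    interior P = Set.image2 (· + ·) ((fun s : ℝ => s • p) '' Ioi 0)
      ((fun c => c - ⟪φ, c⟫_ℝ • p) '' interior P) := by
  have hφ0 : φ ≠ 0 := fun h0 => by simp [h0] at hφp
  ext c
  constructor
  · intro hc
    exact ⟨_, ⟨⟪φ, c⟫_ℝ, h.inner_pos hc hφ hφ0, rfl⟩, _, ⟨c, hc, rfl⟩, add_sub_cancel _ _⟩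
  · rintro ⟨_, ⟨s, hs, rfl⟩, _, ⟨c, hc, rfl⟩, rfl⟩
    rw [mem_Ioi] at hs
    have hφc := h.inner_pos hc hφ hφ0
    have hsum : 0 < s + ⟪φ, c⟫_ℝ := add_pos hs hφc
    set δ := s / (s + ⟪φ, c⟫_ℝ) with hδ
    have hδ1 : δ * (s + ⟪φ, c⟫_ℝ) = s := div_mul_cancel₀ _ hsum.ne'
    have hδ0 : 0 < δ := div_pos hs hsum
    have hδle : δ ≤ 1 := (div_le_one hsum).2 (by linarith)
    have h1 : 0 ≤ s - δ * ⟪φ, c⟫_ℝ := by nlinarith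
    have h2 := h.add_mem_interior (h.smul_mem_interior hc hδ0)
      (h.add_mem (h.smul_mem hp h1)
        (h.smul_mem (hsplit c (interior_subset hc)) (sub_nonneg.2 hδle)))
    convert h2 using 1
    module

variable [FiniteDimensional ℝ E]

theorem interior_dual_nonempty {C : Set E} (hne : C.Nonempty) (hconv : Convex ℝ C)
    (hcone : ∀ x ∈ C, ∀ t : ℝ, 0 < t → t • x ∈ C)
    (hsharp : ∀ x, x ∈ closure C → -x ∈ closure C → x = 0) :
    (interior (dual (closure C))).Nonempty := by
  have := FiniteDimensional.complete ℝ E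
  have h0 : (0 : E) ∈ dual (closure C) := fun x _ => by rw [inner_zero_right]
  rw [(convex_dual _).interior_nonempty_iff_affineSpan_eq_top,
    AffineSubspace.affineSpan_eq_top_iff_vectorSpan_eq_top_of_nonempty ℝ E E ⟨0, h0⟩,
    vectorSpan_eq_span_vsub_set_right ℝ h0]
  simp only [vsub_eq_sub, sub_zero, image_id']
  rw [← Submodule.orthogonal_eq_bot_iff, Submodule.eq_bot_iff]
  intro x hx
  have hx' : ∀ f ∈ dual (closure C), ⟪f, x⟫_ℝ = 0 := fun f hf =>
    (Submodule.mem_orthogonal _ x).1 hx f (Submodule.subset_span hf)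
  refine hsharp x (mem_closure_cone_of_dual hne hconv hcone fun f hf => (hx' f hf).ge)
    (mem_closure_cone_of_dual hne hconv hcone fun f hf => ?_)
  rw [inner_neg_right, hx' f hf, neg_zero]

theorem dualPair_closure {C : Set E} (hne : C.Nonempty) (hopen : IsOpen C) (hconv : Convex ℝ C)
    (hcone : ∀ x ∈ C, ∀ t : ℝ, 0 < t → t • x ∈ C)
    (hsharp : ∀ x, x ∈ closure C → -x ∈ closure C → x = 0) :
    DualPair (closure C) (dual (closure C)) where
  mem_left x := ⟨fun hx f hf => by rw [real_inner_comm]; exact hf x hx,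
    have := FiniteDimensional.complete ℝ E
    mem_closure_cone_of_dual hne hconv hcone⟩
  mem_right f := Iff.rfl
  int_left := hne.mono (interior_maximal subset_closure hopen)
  int_right := interior_dual_nonempty hne hconv hcone hsharp

end

theorem linAct_mul (g h : GL (Fin 4) ℝ) (x : Fin 4 → ℝ) :
    linAct (g * h) x = linAct g (linAct h x) :=
  (Matrix.mulVec_mulVec x g.val h.val).symm

theorem linAct_one (x : Fin 4 → ℝ) : linAct 1 x = x := Matrix.one_mulVec x

theorem mul_mem_autCone {C : Set (Fin 4 → ℝ)} {g h : GL (Fin 4) ℝ} (hg : g ∈ AutCone C)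
    (hh : h ∈ AutCone C) : g * h ∈ AutCone C := by
  have : linAct (g * h) = linAct g ∘ linAct h := funext (linAct_mul g h)
  change linAct (g * h) '' C = C
  rw [this, image_comp, show linAct h '' C = C from hh]
  exact hg

theorem inv_mem_autCone {C : Set (Fin 4 → ℝ)} {g : GL (Fin 4) ℝ} (hg : g ∈ AutCone C) :
    g⁻¹ ∈ AutCone C := by
  have : linAct g⁻¹ ∘ linAct g = id := funext fun x => by
    rw [Function.comp_apply, ← linAct_mul, inv_mul_cancel, linAct_one, id]
  change linAct g⁻¹ '' C = C
  nth_rewrite 1 [← show linAct g '' C = C from hg]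
  rw [← image_comp, this, image_id]

/-- The coordinate model of `ℝ⁴` as a Euclidean space. -/
abbrev E4 := EuclideanSpace ℝ (Fin 4)

/-- The identification of the Euclidean space with coordinate space. -/
abbrev coord : E4 ≃L[ℝ] (Fin 4 → ℝ) := EuclideanSpace.equiv (Fin 4) ℝ

/-- The operator on Euclidean space of an invertible matrix. -/
def op (g : GL (Fin 4) ℝ) : E4 →L[ℝ] E4 := Matrix.toEuclideanCLM (n := Fin 4) (𝕜 := ℝ) g.val

theorem coord_op (g : GL (Fin 4) ℝ) (x : E4) : coord (op g x) = linAct g (coord x) := rfl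

theorem op_mul (g h : GL (Fin 4) ℝ) : op (g * h) = op g * op h :=
  map_mul (Matrix.toEuclideanCLM (n := Fin 4) (𝕜 := ℝ)) g.val h.val

theorem op_one : op 1 = 1 := map_one (Matrix.toEuclideanCLM (n := Fin 4) (𝕜 := ℝ))

theorem op_injective : Function.Injective op := fun _ _ h =>
  Units.ext ((Matrix.toEuclideanCLM (n := Fin 4) (𝕜 := ℝ)).injective h)

theorem continuous_op : Continuous op := by
  set T := (Matrix.toEuclideanCLM (n := Fin 4) (𝕜 := ℝ)).toAlgEquiv.toLinearMap
  have h1 : Continuous T := T.continuous_of_finiteDimensional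
  exact h1.comp Units.continuous_val

theorem det_op (g : GL (Fin 4) ℝ) : LinearMap.det (op g : E4 →ₗ[ℝ] E4) = g.val.det := by
  have h : (op g : E4 →ₗ[ℝ] E4) =
      Matrix.toLin (PiLp.basisFun 2 ℝ (Fin 4)) (PiLp.basisFun 2 ℝ (Fin 4)) g.val :=
    DFunLike.congr_fun (Matrix.toLpLin_eq_toLin 2 2) g.val
  rw [h, LinearMap.det_toLin]

theorem quasiHomogeneous_preimage_coord {C : Set (Fin 4 → ℝ)}
    (hne : C.Nonempty) (hopen : IsOpen C) (hconv : Convex ℝ C)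
    (hcone : ∀ x ∈ C, ∀ t : ℝ, 0 < t → t • x ∈ C)
    (hsharp : closure C ∩ (-(closure C)) = {0})
    (hqh : ∃ K : Set (Fin 4 → ℝ), IsCompact K ∧ K ⊆ C ∧
      (⋃ g ∈ AutCone C, linAct g '' K) = C) :
    interior (closure (coord ⁻¹' C)) = coord ⁻¹' C ∧
    QuasiHomogeneous (closure (coord ⁻¹' C)) (dual (closure (coord ⁻¹' C))) (op '' AutCone C) := by
  set C' : Set E4 := coord ⁻¹' C with hC'
  have hne' : C'.Nonempty := hne.preimage coord.surjective
  have hopen' : IsOpen C' := hopen.preimage coord.continuous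
  have hconv' : Convex ℝ C' := hconv.linear_preimage coord.toLinearEquiv.toLinearMap
  have hcone' : ∀ x ∈ C', ∀ t : ℝ, 0 < t → t • x ∈ C' := fun x hx t ht => by
    rw [hC', mem_preimage, map_smul]
    exact hcone _ hx t ht
  have hcl : closure C' = coord ⁻¹' closure C :=
    (coord.toHomeomorph.preimage_closure C).symm
  have hsharp' : ∀ x, x ∈ closure C' → -x ∈ closure C' → x = 0 := by
    intro x hx hx'
    rw [hcl, mem_preimage] at hx hx'
    rw [map_neg] at hx'
    have : coord x ∈ closure C ∩ (-(closure C)) := ⟨hx, hx'⟩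
    rw [hsharp, mem_singleton_iff] at this
    exact (map_eq_zero_iff coord coord.injective).1 this
  have hint : interior (closure C') = C' := by
    rw [hconv'.interior_closure_eq_interior_of_nonempty_interior (by rwa [hopen'.interior_eq]),
      hopen'.interior_eq]
  refine ⟨hint, dualPair_closure hne' hopen' hconv' hcone' hsharp', ⟨1, ?_, op_one⟩, ?_, ?_, ?_, ?_⟩
  · change linAct 1 '' C = C
    rw [show linAct 1 = id from funext linAct_one, image_id]
  · rintro _ ⟨g, hg, rfl⟩ _ ⟨k, hk, rfl⟩
    exact ⟨g * k, mul_mem_autCone hg hk, op_mul g k⟩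
  · rintro _ ⟨g, hg, rfl⟩
    refine ⟨_, ⟨g⁻¹, inv_mem_autCone hg, rfl⟩, ?_, ?_⟩
    · rw [← op_mul, mul_inv_cancel, op_one]
    · rw [← op_mul, inv_mul_cancel, op_one]
  · rintro _ ⟨g, hg, rfl⟩ x hx
    refine map_mem_closure (op g).continuous hx fun y hy => ?_
    have : linAct g (coord y) ∈ linAct g '' C := ⟨_, hy, rfl⟩
    rwa [show linAct g '' C = C from hg] at this
  · obtain ⟨K, hK, hKC, hcov⟩ := hqh
    refine ⟨coord ⁻¹' K, coord.toHomeomorph.isCompact_preimage.2 hK, ?_, fun x hx => ?_⟩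
    · rw [hint]
      exact preimage_mono hKC
    · rw [hint] at hx
      have hx' : coord x ∈ ⋃ g ∈ AutCone C, linAct g '' K := by rw [hcov]; exact hx
      simp only [mem_iUnion] at hx'
      obtain ⟨g, hg, k, hk, hgk⟩ := hx'
      refine ⟨_, ⟨g, hg, rfl⟩, coord.symm k, ?_, ?_⟩
      · rwa [mem_preimage, coord.apply_symm_apply]
      · apply coord.injective
        rw [coord_op, coord.apply_symm_apply, hgk]

theorem not_strictCone_of_frontier_segment {C : Set (Fin 4 → ℝ)} (hopen : IsOpen C)
    (hcone : ∀ x ∈ C, ∀ t : ℝ, 0 < t → t • x ∈ C)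
    (hint : interior (closure (coord ⁻¹' C)) = coord ⁻¹' C)
    (hnotstrict : ∃ u ∈ frontier C, ∃ v ∈ frontier C,
      LinearIndependent ℝ ![u, v] ∧ segment ℝ u v ⊆ frontier C) :
    ¬ StrictCone (closure (coord ⁻¹' C)) := by
  obtain ⟨u, hu, v, hv, hli, hseg⟩ := hnotstrict
  intro hs
  have hcl : closure (coord ⁻¹' C) = coord ⁻¹' closure C :=
    (coord.toHomeomorph.preimage_closure C).symm
  have h1 := hs (coord.symm u) (by
      rw [hcl, mem_preimage, coord.apply_symm_apply]; exact hu.1) (coord.symm v) (by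
      rw [hcl, mem_preimage, coord.apply_symm_apply]; exact hv.1) (fun a b hab => by
      rw [← map_smul, ← map_smul, ← map_add, map_eq_zero_iff _ coord.symm.injective] at hab
      exact LinearIndependent.pair_iff.1 hli a b hab)
  rw [hint, mem_preimage, ← map_add, coord.apply_symm_apply] at h1
  have h2 := hcone _ h1 (1 / 2) (by norm_num)
  have h3 : (1 / 2 : ℝ) • (u + v) ∈ frontier C := hseg
    ⟨1 / 2, 1 / 2, by norm_num, by norm_num, by norm_num, (smul_add _ _ _).symm⟩
  rw [hopen.frontier_eq] at h3
  exact h3.2 h2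

theorem not_splits_of_indecomposable {C : Set (Fin 4 → ℝ)} (hconv : Convex ℝ C)
    (hne : C.Nonempty)
    (hint : interior (closure (coord ⁻¹' C)) = coord ⁻¹' C) {Q : Set E4}
    (hPQ : DualPair (closure (coord ⁻¹' C)) Q)
    (hindec : ¬ ∃ (V₁ V₂ : Submodule ℝ (Fin 4 → ℝ)) (C₁ C₂ : Set (Fin 4 → ℝ)),
      V₁ ≠ ⊥ ∧ V₂ ≠ ⊥ ∧ IsCompl V₁ V₂ ∧
      C₁ ⊆ (V₁ : Set (Fin 4 → ℝ)) ∧ C₂ ⊆ (V₂ : Set (Fin 4 → ℝ)) ∧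
      C₁.Nonempty ∧ C₂.Nonempty ∧ Convex ℝ C₁ ∧ Convex ℝ C₂ ∧
      (∀ x ∈ C₁, ∀ t : ℝ, 0 < t → t • x ∈ C₁) ∧
      (∀ x ∈ C₂, ∀ t : ℝ, 0 < t → t • x ∈ C₂) ∧
      C = Set.image2 (· + ·) C₁ C₂) :
    ¬ Splits (closure (coord ⁻¹' C)) Q := by
  rintro ⟨p, hp, φ, hφ, hφp, hsplit⟩
  have hdec := hPQ.interior_eq_image2_of_split hp hφ hφp hsplit
  rw [hint] at hdec
  set q : Fin 4 → ℝ := coord p with hq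
  set F : (Fin 4 → ℝ) →ₗ[ℝ] ℝ :=
    (innerSL ℝ φ).toLinearMap ∘ₗ coord.symm.toLinearEquiv.toLinearMap with hF
  have hFc : ∀ x, F (coord x) = ⟪φ, x⟫_ℝ := fun x => rfl
  have hFq : F q = 1 := hφp
  set R : (Fin 4 → ℝ) →ₗ[ℝ] (Fin 4 → ℝ) := LinearMap.id - F.smulRight q with hR
  have hRa : ∀ x, R x = x - F x • q := fun x => rfl
  have hcone : ∀ x ∈ C, ∀ t : ℝ, 0 < t → t • x ∈ C := by
    intro x hx t ht
    have h1 : coord.symm x ∈ interior (closure (coord ⁻¹' C)) := by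
      rwa [hint, mem_preimage, coord.apply_symm_apply]
    have h2 := hPQ.smul_mem_interior h1 ht
    rwa [hint, mem_preimage, map_smul, coord.apply_symm_apply] at h2
  refine hindec ⟨ℝ ∙ q, LinearMap.ker F, (fun s : ℝ => s • q) '' Ioi 0, R '' C, ?_, ?_, ?_, ?_, ?_,
    ?_, hne.image _, ?_, hconv.linear_image R, ?_, ?_, ?_⟩
  · rw [Ne, Submodule.span_singleton_eq_bot]
    intro h0
    rw [h0, map_zero] at hFq
    exact zero_ne_one hFq
  · intro h0
    have h1 := F.finrank_range_add_finrank_ker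
    rw [h0, finrank_bot, Module.finrank_fin_fun] at h1
    have h2 := F.range.finrank_le
    rw [Module.finrank_self] at h2
    omega
  · refine ⟨?_, codisjoint_iff.2 (F.span_singleton_sup_ker_eq_top (by rw [hFq]; exact one_ne_zero))⟩
    refine (Submodule.disjoint_span_singleton_of_notMem ?_).symm
    rw [LinearMap.mem_ker, hFq]
    exact one_ne_zero
  · rintro _ ⟨s, -, rfl⟩
    exact Submodule.smul_mem _ _ (Submodule.mem_span_singleton_self q)
  · rintro _ ⟨c, -, rfl⟩
    rw [SetLike.mem_coe, LinearMap.mem_ker, hRa, map_sub, map_smul, hFq, smul_eq_mul, mul_one,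
      sub_self]
  · exact nonempty_Ioi.image _
  · exact (convex_Ioi 0).linear_image (LinearMap.toSpanSingleton ℝ _ q)
  · rintro _ ⟨s, hs, rfl⟩ t ht
    exact ⟨t * s, mul_pos ht hs, mul_smul t s q⟩
  · rintro _ ⟨c, hc, rfl⟩ t ht
    exact ⟨t • c, hcone c hc t ht, map_smul R t c⟩
  · rw [← image_preimage_eq C coord.surjective]
    nth_rewrite 1 [hdec]
    rw [image_image2_distrib (map_add coord), image_image, image_image, image_image]
    simp only [map_smul, map_sub, hRa, hFc, ← hq]

end ConeDuality

/-- a sharp open convex cone in ℝ⁴ whose projectivization is a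
quasi-homogeneous properly convex projective domain, which is indecomposable and
not strictly convex, has irreducible automorphism group, and its unimodular
automorphisms form a discrete subgroup of GL(4,ℝ). -/
theorem indecomposable_nonstrict_cone_irreducible_discrete (C : Set (Fin 4 → ℝ))
    (hne : C.Nonempty) (hopen : IsOpen C) (hconv : Convex ℝ C)
    (hcone : ∀ x ∈ C, ∀ t : ℝ, 0 < t → t • x ∈ C)
    (hsharp : closure C ∩ (-(closure C)) = {0})
    (hqh : ∃ K : Set (Fin 4 → ℝ), IsCompact K ∧ K ⊆ C ∧
      (⋃ g ∈ AutCone C, linAct g '' K) = C)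
    (hindec : ¬ ∃ (V₁ V₂ : Submodule ℝ (Fin 4 → ℝ)) (C₁ C₂ : Set (Fin 4 → ℝ)),
      V₁ ≠ ⊥ ∧ V₂ ≠ ⊥ ∧ IsCompl V₁ V₂ ∧
      C₁ ⊆ (V₁ : Set (Fin 4 → ℝ)) ∧ C₂ ⊆ (V₂ : Set (Fin 4 → ℝ)) ∧
      C₁.Nonempty ∧ C₂.Nonempty ∧ Convex ℝ C₁ ∧ Convex ℝ C₂ ∧
      (∀ x ∈ C₁, ∀ t : ℝ, 0 < t → t • x ∈ C₁) ∧
      (∀ x ∈ C₂, ∀ t : ℝ, 0 < t → t • x ∈ C₂) ∧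
      C = Set.image2 (· + ·) C₁ C₂)
    (hnotstrict : ∃ u ∈ frontier C, ∃ v ∈ frontier C,
      LinearIndependent ℝ ![u, v] ∧ segment ℝ u v ⊆ frontier C) :
    (¬ ∃ V : Submodule ℝ (Fin 4 → ℝ), V ≠ ⊥ ∧ V ≠ ⊤ ∧
        ∀ g ∈ AutCone C, linAct g '' (V : Set (Fin 4 → ℝ)) = (V : Set (Fin 4 → ℝ))) ∧
      DiscreteTopology {g : GL (Fin 4) ℝ | g ∈ AutCone C ∧ |g.val.det| = 1} := by
  open ConeDuality in
  obtain ⟨hint, hQ⟩ := quasiHomogeneous_preimage_coord hne hopen hconv hcone hsharp hqh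
  have hsplit := not_splits_of_indecomposable hconv hne hint hQ.pair hindec
  have hstrict := not_strictCone_of_frontier_segment hopen hcone hint hnotstrict
  have hE : Module.finrank ℝ E4 = 4 := finrank_euclideanSpace_fin
  refine ⟨?_, ?_⟩
  · rintro ⟨V, hbot, htop, hV⟩
    have hmap : ∀ g ∈ op '' AutCone C,
        ∀ v ∈ V.comap coord.toLinearEquiv.toLinearMap,
          g v ∈ V.comap coord.toLinearEquiv.toLinearMap := by
      rintro _ ⟨g, hg, rfl⟩ v hv
      have h1 : linAct g (coord v) ∈ linAct g '' (V : Set (Fin 4 → ℝ)) := ⟨_, hv, rfl⟩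
      rwa [hV g hg] at h1
    have hVmap := Submodule.map_comap_eq_of_surjective
      (f := coord.toLinearEquiv.toLinearMap) coord.surjective V
    rcases hQ.irreducible hE hsplit hstrict hmap with h | h
    · rw [h, Submodule.map_bot] at hVmap
      exact hbot hVmap.symm
    · rw [h, Submodule.map_top, LinearMap.range_eq_top.2 coord.surjective] at hVmap
      exact htop hVmap.symm
  · obtain ⟨U, hU, hU1⟩ := hQ.exists_nhds_one hE hsplit hstrict
    rw [discreteTopology_iff_singleton_mem_nhds]
    rintro ⟨x, hx, hxdet⟩
    have hcont : Continuous
        fun y : {g : GL (Fin 4) ℝ | g ∈ AutCone C ∧ |g.val.det| = 1} => op (x⁻¹ * y.1) :=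
      continuous_op.comp (continuous_const.mul continuous_subtype_val)
    have hnhds := hcont.continuousAt.preimage_mem_nhds (x := ⟨x, hx, hxdet⟩) (t := U) (by
      rwa [inv_mul_cancel, op_one])
    refine mem_of_superset hnhds ?_
    rintro ⟨y, hy, hydet⟩ hyU
    have h1 := hU1 _ ⟨x⁻¹ * y, mul_mem_autCone (inv_mem_autCone hx) hy, rfl⟩ hyU (by
      have h2 := congrArg (fun g : GL (Fin 4) ℝ => g.val.det) (mul_inv_cancel_left x y)
      simp only [Units.val_mul, Matrix.det_mul] at h2
      rw [← h2, abs_mul, hxdet, one_mul] at hydet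
      rw [det_op, Units.val_mul, Matrix.det_mul]
      exact hydet)
    rw [← op_one] at h1
    exact Subtype.ext (inv_mul_eq_one.1 (op_injective h1)).symm
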